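/- arXiv:1602.04131 — 7 statements merged into one kernel-verified Lean document; each statement's English description precedes it below -/
import Mathlib

section
/- For every finite subset X of Euclidean 3-space ℝ³, the projection map p : R(X) → S(X) from the Rips complex of X at scale 1 to its shadow induces a surjection on fundamental groups π₁(R(X), x) → π₁(S(X), p(x)) for every choice of basepoint x. -/
open Metric Function

noncomputable section

/-- The geometric realization of the Rips complex `R(X) = R(X;1)` of a set `X ⊆ ℝ³`:
formal convex combinations of the points of `X` whose support is a face of `R(X)`
(i.e. a finite subset of `X` of diameter `< 1`), topologized as a subspace of the
product `(ℝ³) → ℝ`. (For finite `X` this carries the usual topology of the geometric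
realization.) -/
def ripsRealization (X : Set (EuclideanSpace ℝ (Fin 3))) :
    Set ((EuclideanSpace ℝ (Fin 3)) → ℝ) :=
  {f | (∀ v, 0 ≤ f v) ∧ (support f).Finite ∧ support f ⊆ X ∧
    Metric.diam (support f) < 1 ∧ ∑ᶠ v, f v = 1}

/-- The shadow `S(X) = S(X;1) ⊆ ℝ³`: the union of the convex hulls of the finite
subsets of `X` of diameter less than `1`. -/
def shadow (X : Set (EuclideanSpace ℝ (Fin 3))) : Set (EuclideanSpace ℝ (Fin 3)) :=
  {y | ∃ Y : Finset (EuclideanSpace ℝ (Fin 3)), (Y : Set (EuclideanSpace ℝ (Fin 3))) ⊆ X ∧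
    Metric.diam (Y : Set (EuclideanSpace ℝ (Fin 3))) < 1 ∧
    y ∈ convexHull ℝ (Y : Set (EuclideanSpace ℝ (Fin 3)))}

/-- The underlying function of the projection map `p : R(X) → S(X) ⊆ ℝ³`, sending a
formal convex combination to the corresponding point of `ℝ³`. -/
def projFun (f : (EuclideanSpace ℝ (Fin 3)) → ℝ) : EuclideanSpace ℝ (Fin 3) :=
  ∑ᶠ v, f v • v

lemma projFun_mem_shadow (X : Set (EuclideanSpace ℝ (Fin 3)))
    (f : (EuclideanSpace ℝ (Fin 3)) → ℝ) (hf : f ∈ ripsRealization X) :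
    projFun f ∈ shadow X := by
  obtain ⟨h0, hfin, hsub, hdiam, hsum⟩ := hf
  refine ⟨hfin.toFinset, ?_, ?_, ?_⟩
  · rwa [Set.Finite.coe_toFinset]
  · rwa [Set.Finite.coe_toFinset]
  · have hsupp : support f ⊆ ↑hfin.toFinset := by rw [Set.Finite.coe_toFinset]
    have hsum' : ∑ v ∈ hfin.toFinset, f v = 1 := by
      rw [← finsum_eq_sum_of_support_subset f hsupp]; exact hsum
    have hsmul : support (fun v => f v • v) ⊆ ↑hfin.toFinset := by
      refine subset_trans ?_ hsupp
      intro v hv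
      simp only [mem_support, ne_eq] at hv ⊢
      intro h; exact hv (by rw [h, zero_smul])
    have : projFun f = hfin.toFinset.centerMass f id := by
      rw [Finset.centerMass_eq_of_sum_1 _ _ hsum', projFun,
        finsum_eq_sum_of_support_subset _ hsmul]
      rfl
    rw [this]
    exact Finset.centerMass_mem_convexHull _ (fun i _ => h0 i) (by rw [hsum']; norm_num)
      (fun i hi => hi)

lemma projFun_continuous (X : Set (EuclideanSpace ℝ (Fin 3))) (hX : X.Finite) :
    Continuous fun f : ripsRealization X => projFun f.1 := by
  have : (fun f : ripsRealization X => projFun f.1) =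
      fun f : ripsRealization X => ∑ v ∈ hX.toFinset, f.1 v • v := by
    funext f
    refine finsum_eq_sum_of_support_subset _ ?_
    intro v hv
    have hv' : v ∈ support f.1 := by
      simp only [mem_support, ne_eq] at hv ⊢
      intro h; exact hv (by rw [h, zero_smul])
    have hvX : v ∈ X := f.2.2.2.1 hv'
    simpa [Set.Finite.mem_toFinset] using hvX
  rw [this]
  exact continuous_finset_sum _ fun v _ =>
    (((continuous_apply v).comp continuous_subtype_val).smul continuous_const)

/-- The projection map `p : R(X) → S(X)` as a continuous map. -/
def projMap (X : Set (EuclideanSpace ℝ (Fin 3))) (hX : X.Finite) :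
    C(ripsRealization X, shadow X) :=
  ⟨fun f => ⟨projFun f.1, projFun_mem_shadow X f.1 f.2⟩,
    (projFun_continuous X hX).subtype_mk _⟩

section Geometry

variable {V : Type*} [NormedAddCommGroup V] [InnerProductSpace ℝ V]

lemma dist_lt_dist_iff_lt_inner (a d x : V) :
    dist x d < dist x a ↔ (‖d‖ ^ 2 - ‖a‖ ^ 2) / 2 < inner ℝ (d - a) x := by
  rw [dist_eq_norm, dist_eq_norm, ← sq_lt_sq₀ (norm_nonneg _) (norm_nonneg _),
    norm_sub_sq_real, norm_sub_sq_real, inner_sub_left, real_inner_comm d x, real_inner_comm a x]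
  constructor <;> intro h <;> linarith

/-- The open half-space of the points closer to `d` than to `a` is convex. -/
lemma convex_setOf_dist_lt_dist (a d : V) : Convex ℝ {x | dist x d < dist x a} := by
  simp_rw [dist_lt_dist_iff_lt_inner]
  exact convex_halfSpace_gt (innerₛₗ ℝ (d - a)).isLinear _

lemma convex_setOf_dist_le_dist (a d : V) : Convex ℝ {x | dist x a ≤ dist x d} := by
  simp_rw [← not_lt, dist_lt_dist_iff_lt_inner, not_lt]
  exact convex_halfSpace_le (innerₛₗ ℝ (d - a)).isLinear _

/-- If the convex hulls of two sets of diameter less than `1` meet, then for `a` in the first set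
and `d` in the second one, `a` is close to a point of the second set other than `d` or `d` is
close to a point of the first set other than `a`. -/
lemma exists_dist_lt_one_of_mem_convexHull {σ τ : Finset V} {y : V}
    (hσ : ∀ b ∈ σ, ∀ b' ∈ σ, dist b b' < 1) (hτ : ∀ c ∈ τ, ∀ c' ∈ τ, dist c c' < 1)
    (hyσ : y ∈ convexHull ℝ (σ : Set V)) (hyτ : y ∈ convexHull ℝ (τ : Set V))
    {a d : V} (ha : a ∈ σ) (hd : d ∈ τ) (had : a ≠ d) :
    (∃ c ∈ τ, c ≠ d ∧ dist a c < 1) ∨ ∃ b ∈ σ, b ≠ a ∧ dist b d < 1 := by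
  by_contra! h
  have h₁ : dist y d < dist y a := by
    refine convexHull_min (fun c hc ↦ ?_) (convex_setOf_dist_lt_dist a d) hyτ
    rcases eq_or_ne c d with rfl | hcd
    · simpa using had.symm
    · exact (hτ c hc d hd).trans_le (by simpa [dist_comm] using h.1 c hc hcd)
  have h₂ : dist y a ≤ dist y d := by
    refine convexHull_min (fun b hb ↦ ?_) (convex_setOf_dist_le_dist a d) hyσ
    rcases eq_or_ne b a with rfl | hba
    · simp
    · exact (hσ b hb a ha).le.trans (h.2 b hb hba)
  exact h₁.not_ge h₂

/-- If two sets of diameter less than `1` have at most five points together, the first one at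
most as many as the second one, and their convex hulls meet, then some point of one of the sets is
at distance less than `1` from all points of the other one. -/
lemma exists_forall_dist_lt_one_of_card_le {σ τ : Finset V} {y : V}
    (hσ : ∀ b ∈ σ, ∀ b' ∈ σ, dist b b' < 1) (hτ : ∀ c ∈ τ, ∀ c' ∈ τ, dist c c' < 1)
    (hyσ : y ∈ convexHull ℝ (σ : Set V)) (hyτ : y ∈ convexHull ℝ (τ : Set V))
    (hcard : σ.card + τ.card ≤ 5) (hle : σ.card ≤ τ.card) :
    (∃ a ∈ σ, ∀ c ∈ τ, dist a c < 1) ∨ ∃ c ∈ τ, ∀ a ∈ σ, dist a c < 1 := by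
  classical
  by_contra! h
  obtain ⟨hA, hB⟩ := h
  have hne : ∀ a ∈ σ, ∀ d ∈ τ, a ≠ d := by
    rintro a ha _ hd rfl
    obtain ⟨c, hc, hac⟩ := hA a ha
    exact hac.not_gt (hτ a hd c hc)
  have hpos : σ.Nonempty := by
    rw [← Finset.coe_nonempty, ← convexHull_nonempty_iff (𝕜 := ℝ)]
    exact ⟨y, hyσ⟩
  have hcases : σ.card = 1 ∨ σ.card = 2 := by
    have := hpos.card_pos
    omega
  rcases hcases with h₁ | h₂
  · obtain ⟨a, rfl⟩ := Finset.card_eq_one.mp h₁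
    obtain rfl : y = a := by simpa using hyσ
    obtain ⟨c, hc, hac⟩ := hA y (by simp)
    have : y ∈ ball c 1 :=
      convexHull_min (fun c' hc' ↦ hτ c' hc' c hc) (convex_ball c 1) hyτ
    exact hac.not_gt this
  · obtain ⟨a, b, hab, rfl⟩ := Finset.card_eq_two.mp h₂
    obtain ⟨c, hc, hac⟩ := hA a (by simp)
    obtain ⟨d, hd, hbd⟩ := hA b (by simp)
    have ha (e : V) (he : e ∈ τ) (hbe : 1 ≤ dist b e) : ∃ f ∈ τ, f ≠ e ∧ dist a f < 1 := by
      rcases exists_dist_lt_one_of_mem_convexHull hσ hτ hyσ hyτ (a := a) (by simp) he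
        (hne a (by simp) e he) with h | ⟨b', hb', hne', hlt⟩
      · exact h
      · obtain rfl : b' = b := by simpa [hne'] using hb'
        exact absurd hlt hbe.not_gt
    have hb (e : V) (he : e ∈ τ) (hae : 1 ≤ dist a e) : ∃ f ∈ τ, f ≠ e ∧ dist b f < 1 := by
      rcases exists_dist_lt_one_of_mem_convexHull hσ hτ hyσ hyτ (a := b) (by simp) he
        (hne b (by simp) e he) with h | ⟨a', ha', hne', hlt⟩
      · exact h
      · obtain rfl : a' = a := by simpa [hne'] using ha'
        exact absurd hlt hae.not_gt
    have hor (e : V) (he : e ∈ τ) : 1 ≤ dist a e ∨ 1 ≤ dist b e := by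
      simpa using hB e he
    -- Two points of `τ` are close to `a` only, and two others are close to `b` only.
    obtain ⟨e, he, -, hae⟩ := ha d hd hbd
    have hbe := (hor e he).resolve_left hae.not_ge
    obtain ⟨e', he', hee', hae'⟩ := ha e he hbe
    have hbe' := (hor e' he').resolve_left hae'.not_ge
    obtain ⟨f, hf, -, hbf⟩ := hb c hc hac
    have haf := (hor f hf).resolve_right hbf.not_ge
    obtain ⟨f', hf', hff', hbf'⟩ := hb f hf haf
    have hsub : ({e, e', f, f'} : Finset V) ⊆ τ := by
      simp [Finset.insert_subset_iff, he, he', hf, hf']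
    have hfour : ({e, e', f, f'} : Finset V).card = 4 := by
      have h₁ : e ≠ f := by rintro rfl; exact hbf.not_ge hbe
      have h₂ : e ≠ f' := by rintro rfl; exact hbf'.not_ge hbe
      have h₃ : e' ≠ f := by rintro rfl; exact hbf.not_ge hbe'
      have h₄ : e' ≠ f' := by rintro rfl; exact hbf'.not_ge hbe'
      simp [h₁, h₂, h₃, h₄, hee'.symm, hff'.symm]
    have := Finset.card_le_card hsub
    omega

/-- Two finite sets in a space of dimension `n` with intersecting convex hulls have subsets with at
most `n + 2` points in total whose convex hulls intersect. -/
lemma exists_subset_card_add_card_le {W : Type*} [AddCommGroup W] [Module ℝ W]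
    [FiniteDimensional ℝ W] {σ τ : Finset W} {y : W}
    (hyσ : y ∈ convexHull ℝ (σ : Set W)) (hyτ : y ∈ convexHull ℝ (τ : Set W)) :
    ∃ σ' ⊆ σ, ∃ τ' ⊆ τ, σ'.card + τ'.card ≤ Module.finrank ℝ W + 2 ∧
      ∃ z, z ∈ convexHull ℝ (σ' : Set W) ∧ z ∈ convexHull ℝ (τ' : Set W) := by
  classical
  -- By the Cayley trick, this is Carathéodory's theorem in `W × ℝ`.
  let i : W →ᵃ[ℝ] W × ℝ := (AffineMap.id ℝ W).prod (AffineMap.const ℝ W 1)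
  let j : W →ᵃ[ℝ] W × ℝ := (-LinearMap.id : W →ₗ[ℝ] W).toAffineMap.prod (AffineMap.const ℝ W 0)
  have hi (w : W) : i w = (w, 1) := rfl
  have hj (w : W) : j w = (-w, 0) := rfl
  have hmem : ((0, 1 / 2) : W × ℝ) ∈ convexHull ℝ (i '' σ ∪ j '' τ) := by
    have hu : (y, (1 : ℝ)) ∈ convexHull ℝ (i '' σ ∪ j '' τ) := by
      refine convexHull_mono Set.subset_union_left ?_
      rw [← AffineMap.image_convexHull]
      exact ⟨y, hyσ, rfl⟩
    have hv : (-y, (0 : ℝ)) ∈ convexHull ℝ (i '' σ ∪ j '' τ) := by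
      refine convexHull_mono Set.subset_union_right ?_
      rw [← AffineMap.image_convexHull]
      exact ⟨y, hyτ, rfl⟩
    have := (convex_convexHull ℝ (i '' (σ : Set W) ∪ j '' τ)) hu hv
      (show (0 : ℝ) ≤ 1 / 2 by norm_num) (show (0 : ℝ) ≤ 1 / 2 by norm_num) (by norm_num)
    simpa using this
  rw [convexHull_eq_union] at hmem
  simp only [Set.mem_iUnion] at hmem
  obtain ⟨t, htsub, hind, ht⟩ := hmem
  let σ' := σ.filter (fun w ↦ i w ∈ t)
  let τ' := τ.filter (fun w ↦ j w ∈ t)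
  have htu : (t : Set (W × ℝ)) = i '' σ' ∪ j '' τ' := by
    ext z
    constructor
    · intro hz
      rcases htsub hz with ⟨w, hw, rfl⟩ | ⟨w, hw, rfl⟩
      · exact Or.inl ⟨w, by simpa [σ'] using ⟨hw, hz⟩, rfl⟩
      · exact Or.inr ⟨w, by simpa [τ'] using ⟨hw, hz⟩, rfl⟩
    · rintro (⟨w, hw, rfl⟩ | ⟨w, hw, rfl⟩)
      · exact (Finset.mem_filter.mp hw).2
      · exact (Finset.mem_filter.mp hw).2
  have hcard : σ'.card + τ'.card ≤ t.card := by
    have hdisj : Disjoint (σ'.image i) (τ'.image j) := by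
      simp [Finset.disjoint_left, hi, hj]
    rw [← Finset.card_image_of_injective σ' (f := i) (fun a b h ↦ by simpa [hi] using h),
      ← Finset.card_image_of_injective τ' (f := j) (fun a b h ↦ by simpa [hj] using h),
      ← Finset.card_union_of_disjoint hdisj]
    refine Finset.card_le_card ?_
    rw [← Finset.coe_subset, htu]
    simp
  have htcard : t.card ≤ Module.finrank ℝ W + 2 := by
    have := hind.card_le_finrank_succ
    have h' := Submodule.finrank_le (vectorSpan ℝ (Set.range ((↑) : t → W × ℝ)))
    rw [Module.finrank_prod, Module.finrank_self] at h'
    rw [Fintype.card_coe] at this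
    omega
  refine ⟨σ', Finset.filter_subset _ _, τ', Finset.filter_subset _ _, hcard.trans htcard, ?_⟩
  have hσ' : (σ' : Set W).Nonempty := by
    by_contra! h
    have : (0, 1 / 2) ∈ {z : W × ℝ | z.2 = 0} := by
      refine convexHull_min ?_ (convex_hyperplane (LinearMap.snd ℝ W ℝ).isLinear 0) ht
      rw [htu, h]
      rintro _ (⟨w, hw, rfl⟩ | ⟨w, hw, rfl⟩)
      · exact hw.elim
      · rfl
    norm_num at this
  have hτ' : (τ' : Set W).Nonempty := by
    by_contra! h
    have : (0, 1 / 2) ∈ {z : W × ℝ | z.2 = 1} := by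
      refine convexHull_min ?_ (convex_hyperplane (LinearMap.snd ℝ W ℝ).isLinear 1) ht
      rw [htu, h]
      rintro _ (⟨w, hw, rfl⟩ | ⟨w, hw, rfl⟩)
      · rfl
      · exact hw.elim
    norm_num at this
  rw [htu, convexHull_union (hσ'.image i) (hτ'.image j), mem_convexJoin,
    ← AffineMap.image_convexHull, ← AffineMap.image_convexHull] at ht
  obtain ⟨_, ⟨u, hu, rfl⟩, _, ⟨v, hv, rfl⟩, r, s, -, -, hrs, h⟩ := ht
  simp only [hi, hj, Prod.smul_mk, Prod.mk_add_mk, Prod.mk.injEq] at h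
  obtain ⟨h₁, h₂⟩ := h
  obtain rfl : r = 1 / 2 := by simpa using h₂
  obtain rfl : s = 1 / 2 := by linarith
  rw [← smul_add, smul_eq_zero_iff_right (by norm_num), add_neg_eq_zero] at h₁
  exact ⟨u, hu, h₁ ▸ hv⟩

end Geometry

section StarConvex

variable {W : Type*} [AddCommGroup W] [Module ℝ W] [TopologicalSpace W] [ContinuousAdd W]
  [ContinuousSMul ℝ W] {S C : Set W} {c : W}

lemma StarConvex.exists_path_mem (hC : StarConvex ℝ c C) (hCS : C ⊆ S) {a b : S}
    (ha : (a : W) ∈ C) (hb : (b : W) ∈ C) : ∃ γ : Path a b, ∀ t, (γ t : W) ∈ C := by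
  obtain ⟨γ, hγ⟩ := (hC.isPathConnected (hC.mem ⟨_, ha⟩)).joinedIn _ ha _ hb
  exact ⟨⟨⟨fun t ↦ ⟨γ t, hCS (hγ t)⟩, by fun_prop⟩, by simp, by simp⟩, hγ⟩

lemma StarConvex.path_homotopic (hC : StarConvex ℝ c C) (hCS : C ⊆ S) {a b : S}
    {γ γ' : Path a b} (hγ : ∀ t, (γ t : W) ∈ C) (hγ' : ∀ t, (γ' t : W) ∈ C) :
    γ.Homotopic γ' := by
  have ha : (a : W) ∈ C := by simpa using hγ 0
  have hb : (b : W) ∈ C := by simpa using hγ 1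
  have := hC.contractibleSpace ⟨_, ha⟩
  let restrict (ω : Path a b) (hω : ∀ t, (ω t : W) ∈ C) : Path (⟨a, ha⟩ : C) ⟨b, hb⟩ :=
    ⟨⟨fun t ↦ ⟨ω t, hω t⟩, by fun_prop⟩, by simp, by simp⟩
  exact (SimplyConnectedSpace.paths_homotopic (restrict γ hγ) (restrict γ' hγ')).map
    ⟨Set.inclusion hCS, continuous_inclusion hCS⟩

end StarConvex

section LiftsPath

variable {A B : Type*} [TopologicalSpace A] [TopologicalSpace B] {p : C(A, B)}

/-- The path `γ` is homotopic rel endpoints to the image under `p` of a path from `a` to `b`. -/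
def LiftsPath (p : C(A, B)) (a b : A) {y z : B} (γ : Path y z) : Prop :=
  ∃ (ha : p a = y) (hb : p b = z) (δ : Path a b),
    ((δ.map p.continuous).cast ha.symm hb.symm).Homotopic γ

lemma LiftsPath.trans {a b c : A} {x y z : B} {γ : Path x y} {γ' : Path y z}
    (h : LiftsPath p a b γ) (h' : LiftsPath p b c γ') : LiftsPath p a c (γ.trans γ') := by
  obtain ⟨rfl, rfl, δ, hδ⟩ := h
  obtain ⟨_, rfl, δ', hδ'⟩ := h'
  refine ⟨rfl, rfl, δ.trans δ', ?_⟩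
  rw [Path.map_trans]
  exact hδ.hcomp hδ'

lemma LiftsPath.symm {a b : A} {x y : B} {γ : Path x y} (h : LiftsPath p a b γ) :
    LiftsPath p b a γ.symm := by
  obtain ⟨rfl, rfl, δ, hδ⟩ := h
  exact ⟨rfl, rfl, δ.symm, hδ.symm₂⟩

lemma LiftsPath.congr {a b : A} {x y : B} {γ γ' : Path x y} (h : LiftsPath p a b γ)
    (hγ : γ.Homotopic γ') : LiftsPath p a b γ' := by
  obtain ⟨ha, hb, δ, hδ⟩ := h
  exact ⟨ha, hb, δ, hδ.trans hγ⟩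

lemma LiftsPath.refl (a : A) : LiftsPath p a a (Path.refl (p a)) :=
  ⟨rfl, rfl, Path.refl a, Path.Homotopic.refl _⟩

/-- If any two points of a fibre of `p` are joined by a path whose image is null-homotopic, then
the endpoints of a lift of a path can be chosen freely in the fibres. -/
lemma LiftsPath.change_endpoints
    (hp : ∀ (a b : A) (y : B), p a = y → p b = y → LiftsPath p a b (Path.refl y))
    {a b a' b' : A} {x y : B} {γ : Path x y} (h : LiftsPath p a b γ) (ha : p a' = x)
    (hb : p b' = y) : LiftsPath p a' b' γ := by
  have h' := ((hp a' a x ha h.choose).trans h).trans (hp b b' y h.choose_spec.choose hb)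
  exact h'.congr (Path.Homotopic.trans ⟨Path.Homotopy.transRefl _⟩ ⟨Path.Homotopy.reflTrans _⟩)

/-- If `p` is surjective and any path that stays in some member of an open cover lifts up to
homotopy with arbitrary endpoints, then so does every path. -/
lemma liftsPath_of_open_cover (hp : Surjective p) {ι : Type*} {U : ι → Set B}
    (hUo : ∀ i, IsOpen (U i)) (hU : ∀ y, ∃ i, y ∈ U i)
    (hl : ∀ (i : ι) (a b : A) (γ : Path (p a) (p b)), (∀ t, γ t ∈ U i) → LiftsPath p a b γ)
    (a b : A) (γ : Path (p a) (p b)) : LiftsPath p a b γ := by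
  obtain ⟨t, ht₀, htm, ⟨n, hn⟩, ht⟩ := exists_monotone_Icc_subset_open_cover_unitInterval
    (c := fun i ↦ γ ⁻¹' U i) (fun i ↦ (hUo i).preimage γ.continuous)
    (fun s _ ↦ Set.mem_iUnion.mpr (hU (γ s)))
  have step (c d : A) (k : ℕ) (hc : p c = γ (t k)) (hd : p d = γ (t (k + 1))) :
      LiftsPath p c d (γ.subpath (t k) (t (k + 1))) := by
    obtain ⟨i, hi⟩ := ht k
    have hmem (s) : γ.subpath (t k) (t (k + 1)) s ∈ U i := by
      have : γ.subpath (t k) (t (k + 1)) s ∈ Set.range (γ.subpath (t k) (t (k + 1))) := ⟨s, rfl⟩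
      rw [Path.range_subpath_of_le _ _ _ (htm k.le_succ)] at this
      obtain ⟨r, hr, hr'⟩ := this
      exact hr' ▸ hi hr
    generalize γ.subpath (t k) (t (k + 1)) = ω at hmem
    generalize γ (t k) = u at *
    generalize γ (t (k + 1)) = v at *
    subst hc hd
    exact hl i c d ω hmem
  have key (k : ℕ) (d : A) (hd : p d = γ (t (k + 1))) :
      LiftsPath p a d (γ.subpath (t 0) (t (k + 1))) := by
    induction k generalizing d with
    | zero => exact step a d 0 (by simp [ht₀]) hd
    | succ k ih =>
      obtain ⟨c, hc⟩ := hp (γ (t (k + 1)))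
      exact ((ih c hc).trans (step c d (k + 1) hc hd)).congr
        ⟨Path.Homotopy.subpathTransSubpath γ _ _ _⟩
  have h1 := hn (n + 1) n.le_succ
  obtain ⟨_, _, δ, hδ⟩ := key n b (by simp [h1])
  refine ⟨rfl, rfl, δ, ?_⟩
  have : γ.subpath (t 0) (t (n + 1)) = γ.cast (by simp [ht₀]) (by simp [h1]) := by
    ext s
    simp [Path.subpath, ht₀, h1]
  rw [this] at hδ
  exact hδ

end LiftsPath

section Rips

variable {X : Set (EuclideanSpace ℝ (Fin 3))} {σ τ : Finset (EuclideanSpace ℝ (Fin 3))}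

/-- The finite set `σ` is a face of the Rips complex `R(X)`. -/
def IsRipsFace (X : Set (EuclideanSpace ℝ (Fin 3))) (σ : Finset (EuclideanSpace ℝ (Fin 3))) :
    Prop :=
  (σ : Set (EuclideanSpace ℝ (Fin 3))) ⊆ X ∧ Metric.diam (σ : Set (EuclideanSpace ℝ (Fin 3))) < 1

lemma diam_lt_one_iff_forall_dist_lt {M : Type*} [PseudoMetricSpace M] {σ : Finset M} :
    Metric.diam (σ : Set M) < 1 ↔ ∀ a ∈ σ, ∀ b ∈ σ, dist a b < 1 := by
  constructor
  · intro h a ha b hb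
    exact (dist_le_diam_of_mem σ.finite_toSet.isBounded ha hb).trans_lt h
  · intro h
    rcases σ.eq_empty_or_nonempty with rfl | hne
    · simp
    · obtain ⟨⟨a, b⟩, hab, hmax⟩ := (σ ×ˢ σ).exists_max_image (fun q ↦ dist q.1 q.2)
        (hne.product hne)
      rw [Finset.mem_product] at hab
      refine (diam_le_of_forall_dist_le dist_nonneg fun c hc d hd ↦ ?_).trans_lt
        (h a hab.1 b hab.2)
      exact hmax (c, d) (Finset.mem_product.mpr ⟨hc, hd⟩)

lemma IsRipsFace.dist_lt (hσ : IsRipsFace X σ) : ∀ a ∈ σ, ∀ b ∈ σ, dist a b < 1 :=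
  diam_lt_one_iff_forall_dist_lt.mp hσ.2

lemma IsRipsFace.mono (hτ : IsRipsFace X τ) (h : σ ⊆ τ) : IsRipsFace X σ :=
  ⟨(Finset.coe_subset.mpr h).trans hτ.1,
    (diam_mono (Finset.coe_subset.mpr h) τ.finite_toSet.isBounded).trans_lt hτ.2⟩

open Classical in
lemma IsRipsFace.insert (hτ : IsRipsFace X τ) {a : EuclideanSpace ℝ (Fin 3)} (ha : a ∈ X)
    (h : ∀ c ∈ τ, dist a c < 1) : IsRipsFace X (insert a τ) := by
  refine ⟨by simpa [Set.insert_subset_iff] using ⟨ha, hτ.1⟩,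
    diam_lt_one_iff_forall_dist_lt.mpr ?_⟩
  simp only [Finset.mem_insert]
  rintro b (rfl | hb) c (rfl | hc)
  · simp
  · exact h c hc
  · simpa [dist_comm] using h b hb
  · exact hτ.dist_lt b hb c hc

lemma IsRipsFace.convexHull_subset (hσ : IsRipsFace X σ) :
    convexHull ℝ (σ : Set (EuclideanSpace ℝ (Fin 3))) ⊆ shadow X :=
  fun _ hy ↦ ⟨σ, hσ.1, hσ.2, hy⟩

/-- The closed simplex of the geometric realization that is spanned by `σ`. -/
def closedSimplex (σ : Finset (EuclideanSpace ℝ (Fin 3))) :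
    Set (EuclideanSpace ℝ (Fin 3) → ℝ) :=
  {f | (∀ v, 0 ≤ f v) ∧ support f ⊆ σ ∧ ∑ v ∈ σ, f v = 1}

lemma convex_closedSimplex (σ : Finset (EuclideanSpace ℝ (Fin 3))) :
    Convex ℝ (closedSimplex σ) := by
  rintro f ⟨hf₀, hfσ, hf₁⟩ g ⟨hg₀, hgσ, hg₁⟩ r s hr hs hrs
  refine ⟨fun v ↦ ?_, fun v hv ↦ ?_, ?_⟩
  · have := hf₀ v
    have := hg₀ v
    simp only [Pi.add_apply, Pi.smul_apply, smul_eq_mul]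
    positivity
  · by_contra hvσ
    have hf : f v = 0 := notMem_support.mp fun h ↦ hvσ (hfσ h)
    have hg : g v = 0 := notMem_support.mp fun h ↦ hvσ (hgσ h)
    simp [hf, hg] at hv
  · simp [Finset.sum_add_distrib, ← Finset.mul_sum, hf₁, hg₁, hrs]

lemma IsRipsFace.closedSimplex_subset (hσ : IsRipsFace X σ) :
    closedSimplex σ ⊆ ripsRealization X := by
  rintro f ⟨hf₀, hfσ, hf₁⟩
  exact ⟨hf₀, σ.finite_toSet.subset hfσ, hfσ.trans hσ.1,
    (diam_mono hfσ σ.finite_toSet.isBounded).trans_lt hσ.2,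
    by rwa [finsum_eq_sum_of_support_subset f hfσ]⟩

lemma mem_closedSimplex_of_support_subset {f : EuclideanSpace ℝ (Fin 3) → ℝ}
    (hf : f ∈ ripsRealization X) (h : support f ⊆ σ) : f ∈ closedSimplex σ :=
  ⟨hf.1, h, by rw [← finsum_eq_sum_of_support_subset f h]; exact hf.2.2.2.2⟩

lemma exists_isRipsFace_mem_closedSimplex (f : ripsRealization X) :
    ∃ σ, IsRipsFace X σ ∧ f.1 ∈ closedSimplex σ :=
  ⟨f.2.2.1.toFinset, ⟨by simpa using f.2.2.2.1, by simpa using f.2.2.2.2.1⟩,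
    mem_closedSimplex_of_support_subset f.2 (by simp)⟩

lemma closedSimplex_mono (h : σ ⊆ τ) : closedSimplex σ ⊆ closedSimplex τ := by
  rintro f ⟨hf₀, hfσ, hf₁⟩
  refine ⟨hf₀, hfσ.trans (Finset.coe_subset.mpr h), ?_⟩
  rw [← hf₁]
  refine (Finset.sum_subset h fun v _ hv ↦ ?_).symm
  exact notMem_support.mp fun h' ↦ hv (hfσ h')

lemma projFun_eq_sum {f : EuclideanSpace ℝ (Fin 3) → ℝ} (hf : support f ⊆ σ) :
    projFun f = ∑ v ∈ σ, f v • v :=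
  finsum_eq_sum_of_support_subset _ ((support_smul_subset_left _ _).trans hf)

lemma projFun_mem_convexHull {f : EuclideanSpace ℝ (Fin 3) → ℝ} (hf : f ∈ closedSimplex σ) :
    projFun f ∈ convexHull ℝ (σ : Set (EuclideanSpace ℝ (Fin 3))) := by
  rw [Finset.mem_convexHull']
  exact ⟨f, fun v _ ↦ hf.1 v, hf.2.2, (projFun_eq_sum hf.2.1).symm⟩

lemma exists_mem_closedSimplex_projFun_eq {y : EuclideanSpace ℝ (Fin 3)}
    (hy : y ∈ convexHull ℝ (σ : Set (EuclideanSpace ℝ (Fin 3)))) :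
    ∃ f ∈ closedSimplex σ, projFun f = y := by
  classical
  obtain ⟨w, hw₀, hw₁, rfl⟩ := Finset.mem_convexHull'.mp hy
  have hsupp : support (fun v ↦ if v ∈ σ then w v else 0) ⊆ (σ : Set _) := by
    intro v hv
    by_contra hvσ
    simp [Finset.mem_coe.not.mp hvσ] at hv
  refine ⟨fun v ↦ if v ∈ σ then w v else 0, ⟨fun v ↦ ?_, hsupp, ?_⟩, ?_⟩
  · dsimp only
    split_ifs with h
    exacts [hw₀ v h, le_rfl]
  · rw [← hw₁]
    exact Finset.sum_congr rfl fun v hv ↦ by simp [hv]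
  · rw [projFun_eq_sum hsupp]
    exact Finset.sum_congr rfl fun v hv ↦ by simp [hv]

variable {hX : X.Finite}

lemma IsRipsFace.exists_lift (hσ : IsRipsFace X σ) {y : shadow X}
    (hy : y.1 ∈ convexHull ℝ (σ : Set (EuclideanSpace ℝ (Fin 3)))) :
    ∃ f : ripsRealization X, f.1 ∈ closedSimplex σ ∧ projMap X hX f = y := by
  obtain ⟨f, hf, hfy⟩ := exists_mem_closedSimplex_projFun_eq hy
  exact ⟨⟨f, hσ.closedSimplex_subset hf⟩, hf, Subtype.ext hfy⟩

/-- A path in the convex hull of a face lifts, with arbitrary endpoints in the corresponding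
simplex. -/
lemma IsRipsFace.liftsPath (hσ : IsRipsFace X σ) {f g : ripsRealization X} {y z : shadow X}
    (hf : f.1 ∈ closedSimplex σ) (hg : g.1 ∈ closedSimplex σ) (hfy : projMap X hX f = y)
    (hgz : projMap X hX g = z) {γ : Path y z}
    (hγ : ∀ t, (γ t).1 ∈ convexHull ℝ (σ : Set (EuclideanSpace ℝ (Fin 3)))) :
    LiftsPath (projMap X hX) f g γ := by
  subst hfy hgz
  obtain ⟨δ, hδ⟩ := ((convex_closedSimplex σ).starConvex hf).exists_path_mem
    hσ.closedSimplex_subset hf hg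
  refine ⟨rfl, rfl, δ, ?_⟩
  exact ((convex_convexHull ℝ _).starConvex (projFun_mem_convexHull hf)).path_homotopic
    hσ.convexHull_subset (fun t ↦ projFun_mem_convexHull (hδ t)) hγ

/-- Any two lifts, in the closed simplices of `σ` and of `τ`, of the same point of the shadow are
joined by a path whose projection is null-homotopic. -/
def FibreLinked (hX : X.Finite) (σ τ : Finset (EuclideanSpace ℝ (Fin 3))) : Prop :=
  ∀ (f g : ripsRealization X) (y : shadow X), f.1 ∈ closedSimplex σ → g.1 ∈ closedSimplex τ →
    projMap X hX f = y → projMap X hX g = y → LiftsPath (projMap X hX) f g (Path.refl y)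

lemma FibreLinked.symm (h : FibreLinked hX σ τ) : FibreLinked hX τ σ :=
  fun f g y hf hg hfy hgy ↦ (h g f y hg hf hgy hfy).symm

lemma FibreLinked.mono {σ' τ' : Finset (EuclideanSpace ℝ (Fin 3))} (h : FibreLinked hX σ τ)
    (hσ : σ' ⊆ σ) (hτ : τ' ⊆ τ) : FibreLinked hX σ' τ' :=
  fun f g y hf hg ↦ h f g y (closedSimplex_mono hσ hf) (closedSimplex_mono hτ hg)

/-- It suffices to join two lifts of a single common point of the two convex hulls. -/
lemma FibreLinked.of_liftsPath (hσ : IsRipsFace X σ) (hτ : IsRipsFace X τ)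
    {f' g' : ripsRealization X} {y' : shadow X} (hf' : f'.1 ∈ closedSimplex σ)
    (hg' : g'.1 ∈ closedSimplex τ) (h : LiftsPath (projMap X hX) f' g' (Path.refl y')) :
    FibreLinked hX σ τ := by
  intro f g y hf hg hfy hgy
  have hfy' : projMap X hX f' = y' := h.choose
  have hgy' : projMap X hX g' = y' := h.choose_spec.choose
  have hy : y.1 ∈ convexHull ℝ (σ : Set (EuclideanSpace ℝ (Fin 3))) ∩ convexHull ℝ τ :=
    ⟨hfy ▸ projFun_mem_convexHull hf, hgy ▸ projFun_mem_convexHull hg⟩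
  have hy' : y'.1 ∈ convexHull ℝ (σ : Set (EuclideanSpace ℝ (Fin 3))) ∩ convexHull ℝ τ :=
    ⟨hfy' ▸ projFun_mem_convexHull hf', hgy' ▸ projFun_mem_convexHull hg'⟩
  obtain ⟨γ, hγ⟩ := (((convex_convexHull ℝ _).inter (convex_convexHull ℝ _)).starConvex
    hy).exists_path_mem (Set.inter_subset_left.trans hσ.convexHull_subset) hy hy'
  have h₁ := hσ.liftsPath hf hf' hfy hfy' fun t ↦ (hγ t).1
  have h₂ := hτ.liftsPath hg hg' hgy hgy' fun t ↦ (hγ t).2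
  refine ((h₁.trans h).trans h₂.symm).congr ?_
  exact (Path.Homotopic.hcomp ⟨Path.Homotopy.transRefl γ⟩ (Path.Homotopic.refl _)).trans
    ⟨(Path.Homotopy.reflTransSymm γ).symm⟩

/-- Two faces are linked if some vertex of the first one is close to all vertices of the second
one. -/
lemma FibreLinked.of_forall_dist_lt (hσ : IsRipsFace X σ) (hτ : IsRipsFace X τ)
    {a : EuclideanSpace ℝ (Fin 3)} (ha : a ∈ σ) (h : ∀ c ∈ τ, dist a c < 1) :
    FibreLinked hX σ τ := by
  classical
  have hmem : a ∈ convexHull ℝ (({a} : Finset (EuclideanSpace ℝ (Fin 3))) :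
      Set (EuclideanSpace ℝ (Fin 3))) := by simp
  have hτ' := hτ.insert (hσ.1 ha) h
  have haσ : {a} ⊆ σ := Finset.singleton_subset_iff.mpr ha
  obtain ⟨f, hf, -⟩ := (hσ.mono haσ).exists_lift (hX := hX)
    (y := ⟨a, (hσ.mono haσ).convexHull_subset hmem⟩) hmem
  exact (FibreLinked.of_liftsPath hσ hτ' (closedSimplex_mono haσ hf)
    (closedSimplex_mono (by simp) hf) (LiftsPath.refl f)).mono subset_rfl
    (Finset.subset_insert a τ)

theorem FibreLinked.of_isRipsFace (hσ : IsRipsFace X σ) (hτ : IsRipsFace X τ) :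
    FibreLinked hX σ τ := by
  intro f g y hf hg hfy hgy
  have hyσ : y.1 ∈ convexHull ℝ (σ : Set (EuclideanSpace ℝ (Fin 3))) :=
    hfy ▸ projFun_mem_convexHull hf
  have hyτ : y.1 ∈ convexHull ℝ (τ : Set (EuclideanSpace ℝ (Fin 3))) :=
    hgy ▸ projFun_mem_convexHull hg
  obtain ⟨σ', hσσ', τ', hττ', hcard, z, hzσ, hzτ⟩ := exists_subset_card_add_card_le hyσ hyτ
  rw [finrank_euclideanSpace_fin] at hcard
  have hσ' := hσ.mono hσσ'
  have hτ' := hτ.mono hττ'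
  have hlink : FibreLinked hX σ' τ' := by
    rcases le_total σ'.card τ'.card with hle | hle
    · rcases exists_forall_dist_lt_one_of_card_le hσ'.dist_lt hτ'.dist_lt hzσ hzτ hcard hle with
        ⟨a, ha, h⟩ | ⟨a, ha, h⟩
      · exact .of_forall_dist_lt hσ' hτ' ha h
      · exact (FibreLinked.of_forall_dist_lt hτ' hσ' ha
          fun c hc ↦ by simpa [dist_comm] using h c hc).symm
    · rcases exists_forall_dist_lt_one_of_card_le hτ'.dist_lt hσ'.dist_lt hzτ hzσ
        (by omega) hle with ⟨a, ha, h⟩ | ⟨a, ha, h⟩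
      · exact (FibreLinked.of_forall_dist_lt hτ' hσ' ha h).symm
      · exact .of_forall_dist_lt hσ' hτ' ha fun c hc ↦ by simpa [dist_comm] using h c hc
  obtain ⟨f', hf', hfz⟩ := hσ'.exists_lift (hX := hX) (y := ⟨z, hσ'.convexHull_subset hzσ⟩) hzσ
  obtain ⟨g', hg', hgz⟩ := hτ'.exists_lift (hX := hX) (y := ⟨z, hσ'.convexHull_subset hzσ⟩) hzτ
  exact FibreLinked.of_liftsPath hσ hτ (closedSimplex_mono hσσ' hf') (closedSimplex_mono hττ' hg')
    (hlink f' g' _ hf' hg' hfz hgz) f g y hf hg hfy hgy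

/-- Any two lifts of a point of the shadow are joined by a path whose projection is
null-homotopic. -/
lemma liftsPath_refl_of_projMap_eq (f g : ripsRealization X) (y : shadow X)
    (hfy : projMap X hX f = y) (hgy : projMap X hX g = y) :
    LiftsPath (projMap X hX) f g (Path.refl y) := by
  obtain ⟨σ, hσ, hf⟩ := exists_isRipsFace_mem_closedSimplex f
  obtain ⟨τ, hτ, hg⟩ := exists_isRipsFace_mem_closedSimplex g
  exact FibreLinked.of_isRipsFace hσ hτ f g y hf hg hfy hgy

lemma finite_setOf_isRipsFace (hX : X.Finite) : {σ | IsRipsFace X σ}.Finite :=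
  (hX.toFinset.powerset.finite_toSet).subset fun σ hσ ↦ by
    simpa [← Finset.coe_subset] using hσ.1

/-- Near a point `y` of the shadow there are only faces whose convex hulls contain `y`. -/
lemma exists_ball_forall_mem_convexHull (hX : X.Finite) (y : EuclideanSpace ℝ (Fin 3)) :
    ∃ ε > 0, ∀ σ, IsRipsFace X σ → ∀ z ∈ ball y ε,
      z ∈ convexHull ℝ (σ : Set (EuclideanSpace ℝ (Fin 3))) →
        y ∈ convexHull ℝ (σ : Set (EuclideanSpace ℝ (Fin 3))) := by
  have hclosed (σ : Finset (EuclideanSpace ℝ (Fin 3))) :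
      IsClosed (convexHull ℝ (σ : Set (EuclideanSpace ℝ (Fin 3)))) :=
    σ.finite_toSet.isClosed_convexHull ℝ
  have hev : ∀ᶠ z in nhds y, ∀ σ ∈ {σ | IsRipsFace X σ},
      z ∈ convexHull ℝ (σ : Set (EuclideanSpace ℝ (Fin 3))) →
        y ∈ convexHull ℝ (σ : Set (EuclideanSpace ℝ (Fin 3))) := by
    rw [(finite_setOf_isRipsFace hX).eventually_all]
    intro σ _
    by_cases hy : y ∈ convexHull ℝ (σ : Set (EuclideanSpace ℝ (Fin 3)))
    · exact Filter.Eventually.of_forall fun _ _ ↦ hy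
    · filter_upwards [(hclosed σ).isOpen_compl.mem_nhds hy] with z hz hz'
      exact absurd hz' hz
  obtain ⟨ε, hε, h⟩ := Metric.eventually_nhds_iff_ball.mp hev
  exact ⟨ε, hε, fun σ hσ z hz ↦ h z hz σ hσ⟩

/-- A path in a small ball of the shadow lifts up to homotopy. -/
lemma liftsPath_of_mem_ball {y : shadow X} {ε : ℝ} (hε : 0 < ε)
    (hy : ∀ σ, IsRipsFace X σ → ∀ z ∈ ball y.1 ε,
      z ∈ convexHull ℝ (σ : Set (EuclideanSpace ℝ (Fin 3))) →
        y.1 ∈ convexHull ℝ (σ : Set (EuclideanSpace ℝ (Fin 3))))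
    (f g : ripsRealization X) (γ : Path (projMap X hX f) (projMap X hX g))
    (hγ : ∀ t, (γ t).1 ∈ ball y.1 ε) : LiftsPath (projMap X hX) f g γ := by
  have hstar : StarConvex ℝ y.1 (ball y.1 ε ∩ shadow X) := by
    rintro z ⟨hz, σ, hσX, hσ, hzσ⟩ r s hr hs hrs
    exact ⟨convex_ball _ _ (mem_ball_self hε) hz hr hs hrs, σ, hσX, hσ,
      convex_convexHull ℝ _ (hy σ ⟨hσX, hσ⟩ z hz hzσ) hzσ hr hs hrs⟩
  have cone (h : ripsRealization X) (hh : (projMap X hX h).1 ∈ ball y.1 ε) (h' : ripsRealization X)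
      (hh' : projMap X hX h' = y) : ∃ ω : Path (projMap X hX h) y,
      (∀ t, (ω t).1 ∈ ball y.1 ε ∩ shadow X) ∧ LiftsPath (projMap X hX) h h' ω := by
    obtain ⟨σ, hσX, hσ, hz⟩ := (projMap X hX h).2
    have hface : IsRipsFace X σ := ⟨hσX, hσ⟩
    have hyσ := hy σ hface _ hh hz
    obtain ⟨ω, hω⟩ := (((convex_ball y.1 ε).inter (convex_convexHull ℝ _)).starConvex
      ⟨hh, hz⟩).exists_path_mem (S := shadow X) (b := y)
      (Set.inter_subset_right.trans hface.convexHull_subset) ⟨hh, hz⟩ ⟨mem_ball_self hε, hyσ⟩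
    obtain ⟨f₁, hf₁, hfz⟩ := hface.exists_lift (hX := hX) hz
    obtain ⟨g₁, hg₁, hgy⟩ := hface.exists_lift (hX := hX) hyσ
    refine ⟨ω, fun t ↦ ⟨(hω t).1, (ω t).2⟩, ?_⟩
    exact (hface.liftsPath hf₁ hg₁ hfz hgy fun t ↦ (hω t).2).change_endpoints
      liftsPath_refl_of_projMap_eq rfl hh'
  obtain ⟨σ, hσX, hσ, hyσ⟩ := y.2
  obtain ⟨h, -, hh⟩ := IsRipsFace.exists_lift (hX := hX) (σ := σ) ⟨hσX, hσ⟩ hyσ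
  obtain ⟨ω₁, hω₁, hl₁⟩ := cone f (by simpa using hγ 0) h hh
  obtain ⟨ω₂, hω₂, hl₂⟩ := cone g (by simpa using hγ 1) h hh
  refine (hl₁.trans hl₂.symm).congr ?_
  refine hstar.path_homotopic Set.inter_subset_right (fun t ↦ ?_) fun t ↦ ⟨hγ t, (γ t).2⟩
  rw [Path.trans_apply]
  split_ifs
  exacts [hω₁ _, hω₂ _]

lemma surjective_projMap : Surjective (projMap X hX) := by
  intro y
  obtain ⟨σ, hσX, hσ, hyσ⟩ := y.2
  obtain ⟨f, -, hf⟩ := IsRipsFace.exists_lift (hX := hX) (σ := σ) ⟨hσX, hσ⟩ hyσ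
  exact ⟨f, hf⟩

end Rips

/-- **`π₁`-surjectivity of the projection to the shadow in `ℝ³`.** For every finite
`X ⊆ ℝ³` and every basepoint `x` of the Rips complex `R(X)`, the projection
`p : R(X) → S(X)` induces a surjection on fundamental groups: every loop `γ` in the
shadow `S(X)` based at `p x` is path-homotopic to the image under `p` of a loop in
`R(X)` based at `x`. -/
theorem rips_to_shadow_pi1_surjective (X : Set (EuclideanSpace ℝ (Fin 3))) (hX : X.Finite)
    (x : ripsRealization X) (γ : Path (projMap X hX x) (projMap X hX x)) :
    ∃ δ : Path x x, (δ.map (projMap X hX).continuous).Homotopic γ := by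
  choose ε hε hball using exists_ball_forall_mem_convexHull hX
  obtain ⟨_, _, δ, hδ⟩ := liftsPath_of_open_cover (p := projMap X hX) surjective_projMap
    (U := fun y : shadow X ↦ Subtype.val ⁻¹' ball y.1 (ε y.1))
    (fun y ↦ isOpen_ball.preimage continuous_subtype_val)
    (fun y ↦ ⟨y, mem_ball_self (hε y.1)⟩)
    (fun y f g γ hγ ↦ liftsPath_of_mem_ball (hε y.1) (hball y.1) f g γ hγ) x x γ
  exact ⟨δ, hδ⟩

end
end

section
/- Let d ≥ 2 and let X ⊂ ℝ² be a finite subset such that the Rips complex R(X) is a d-dimensional normal pseudomanifold. Then R(X) is isomorphic (as a simplicial complex) to O_d, the boundary complex of the (d+1)-dimensional crosspolytope. (Equivalently, since induced subcomplexes of R(X) are Rips complexes of subsets of X: any d-dimensional normal pseudomanifold, d ≥ 2, occurring as an induced subcomplex of a planar Rips complex is a crosspolytope boundary.) -/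
open Metric
open scoped Classical

/-- The set of faces of the Rips complex `R(X) = R(X;1)` of `X ⊆ ℝ²`: the nonempty
finite subsets of `X` of diameter less than `1`. -/
def ripsFaces (X : Set (EuclideanSpace ℝ (Fin 2))) : Set (Finset (EuclideanSpace ℝ (Fin 2))) :=
  {s | s.Nonempty ∧ (s : Set (EuclideanSpace ℝ (Fin 2))) ⊆ X ∧
    Metric.diam (s : Set (EuclideanSpace ℝ (Fin 2))) < 1}

/-- The vertex set of a complex given by its set of faces. -/
def vertexSet {α : Type*} (F : Set (Finset α)) : Set α :=
  {v | {v} ∈ F}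

/-- Two vertices are adjacent if they are distinct and span an edge of the complex. -/
def complexAdj {α : Type*} [DecidableEq α] (F : Set (Finset α)) (u w : α) : Prop :=
  u ≠ w ∧ ({u, w} : Finset α) ∈ F

/-- A complex is connected if it has a vertex and any two vertices are joined by an
edge path. -/
def IsConnectedComplex {α : Type*} [DecidableEq α] (F : Set (Finset α)) : Prop :=
  (vertexSet F).Nonempty ∧
    ∀ u ∈ vertexSet F, ∀ w ∈ vertexSet F, Relation.ReflTransGen (complexAdj F) u w

/-- The link of a face `s`: all nonempty faces `t` disjoint from `s` with `s ∪ t` a face. -/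
def complexLink {α : Type*} [DecidableEq α] (F : Set (Finset α)) (s : Finset α) :
    Set (Finset α) :=
  {t | t.Nonempty ∧ Disjoint s t ∧ s ∪ t ∈ F}

/-- A complex is pure of dimension `d` if every face is contained in a face with `d + 1`
vertices and no face has more than `d + 1` vertices. -/
def IsPureComplex {α : Type*} (F : Set (Finset α)) (d : ℕ) : Prop :=
  (∀ s ∈ F, ∃ t ∈ F, s ⊆ t ∧ t.card = d + 1) ∧ ∀ s ∈ F, s.card ≤ d + 1

/-- A `d`-dimensional normal pseudomanifold: a pure, connected `d`-complex in which every
`(d−1)`-face is contained in precisely two `d`-faces and the link of every face of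
dimension at most `d − 2` is connected. -/
def IsNormalPseudomanifold {α : Type*} [DecidableEq α] (F : Set (Finset α)) (d : ℕ) : Prop :=
  IsPureComplex F d ∧ IsConnectedComplex F ∧
    (∀ s ∈ F, s.card = d → {t | t ∈ F ∧ s ⊆ t ∧ t.card = d + 1}.ncard = 2) ∧
    (∀ s ∈ F, s.card ≤ d - 1 → IsConnectedComplex (complexLink F s))

/-- The boundary complex `O_d` of the `(d+1)`-dimensional crosspolytope: the join of
`d + 1` copies of the two-point complex, i.e. all nonempty subsets of the `2(d+1)`
vertices containing no antipodal pair. -/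
def crossPolytopeBoundary (d : ℕ) : Set (Finset (Fin (d + 1) × Fin 2)) :=
  {s | s.Nonempty ∧ ∀ i : Fin (d + 1), ¬((i, 0) ∈ s ∧ (i, 1) ∈ s)}

/-- Isomorphism of simplicial complexes given by their sets of faces: a map of vertex
sets which is a bijection between them and under which faces correspond exactly. -/
def ComplexIso {α β : Type*} [DecidableEq β] (F : Set (Finset α)) (G : Set (Finset β)) : Prop :=
  ∃ f : α → β, Set.BijOn f (vertexSet F) (vertexSet G) ∧
    ∀ s : Finset α, (s : Set α) ⊆ vertexSet F → (s ∈ F ↔ s.image f ∈ G)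

section Combinatorics

variable {α : Type*} [MetricSpace α]

/-- A finite subset of `X` whose points are pairwise at distance less than `1`. -/
def IsNearClique (X : Set α) (s : Finset α) : Prop :=
  (s : Set α) ⊆ X ∧ ∀ u ∈ s, ∀ v ∈ s, dist u v < 1

/-- The points of `X` outside `s` that are at distance less than `1` from every point of `s`. -/
def nearLink (X : Set α) (s : Finset α) : Set α :=
  {v | v ∈ X ∧ v ∉ s ∧ ∀ u ∈ s, dist u v < 1}

/-- Nonemptiness and connectedness of the graph joining points of `Y` at distance less
than `1`. -/
def NearConnected (Y : Set α) : Prop :=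
  Y.Nonempty ∧ ∀ u ∈ Y, ∀ w ∈ Y,
    Relation.ReflTransGen (fun x y => x ∈ Y ∧ y ∈ Y ∧ dist x y < 1) u w

/-- The normal pseudomanifold condition for a Rips complex, in terms of its flag structure. -/
structure IsNearPseudomanifold (X : Set α) (d : ℕ) : Prop where
  pure : ∀ s, IsNearClique X s → ∃ t, IsNearClique X t ∧ s ⊆ t ∧ t.card = d + 1
  card_le : ∀ s, IsNearClique X s → s.card ≤ d + 1
  connected : NearConnected X
  two : ∀ s, IsNearClique X s → s.Nonempty → s.card = d → (nearLink X s).ncard = 2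
  link : ∀ s, IsNearClique X s → s.Nonempty → s.card ≤ d - 1 → NearConnected (nearLink X s)

/-- Every point of `X` has a unique point of `X` at distance at least `1`. -/
def HasAntipodes (X : Set α) : Prop :=
  ∀ x ∈ X, ∃! y, y ∈ X ∧ 1 ≤ dist x y

theorem NearConnected.induction {Y : Set α} (hY : NearConnected Y) {P : α → Prop} {u : α}
    (hu : u ∈ Y) (h0 : P u)
    (hs : ∀ x ∈ Y, ∀ y ∈ Y, dist x y < 1 → P x → P y) : ∀ w ∈ Y, P w := by
  intro w hw
  have h := hY.2 u hu w hw
  induction h using Relation.ReflTransGen.head_induction_on with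
  | refl => exact h0
  | head hab _ ih => exact ih hab.2.1 (hs _ hab.1 _ hab.2.1 hab.2.2 h0)

theorem isNearClique_insert [DecidableEq α] {X : Set α} {s : Finset α} {v : α} :
    IsNearClique X (insert v s) ↔ v ∈ X ∧ (∀ u ∈ s, dist u v < 1) ∧ IsNearClique X s := by
  constructor
  · rintro ⟨h1, h2⟩
    refine ⟨h1 (by simp), fun u hu => h2 u (by simp [hu]) v (by simp), fun u hu => h1 ?_,
      fun u hu w hw => h2 u (by simp [hu]) w (by simp [hw])⟩
    simp only [Finset.mem_coe] at hu
    simp [hu]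
  · rintro ⟨h1, h2, h3, h4⟩
    refine ⟨?_, ?_⟩
    · intro u hu
      simp only [Finset.coe_insert, Set.mem_insert_iff, Finset.mem_coe] at hu
      rcases hu with rfl | hu
      · exact h1
      · exact h3 hu
    · intro u hu w hw
      rw [Finset.mem_insert] at hu hw
      rcases hu with rfl | hu <;> rcases hw with rfl | hw
      · simp
      · rw [dist_comm]; exact h2 _ hw
      · exact h2 _ hu
      · exact h4 _ hu _ hw

theorem isNearClique_empty (X : Set α) : IsNearClique X ∅ := by
  simp [IsNearClique]

theorem mem_nearLink_singleton {X : Set α} {x v : α} :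
    v ∈ nearLink X {x} ↔ v ∈ X ∧ v ≠ x ∧ dist x v < 1 := by
  simp only [nearLink, Finset.mem_singleton, forall_eq, Set.mem_ofPred_eq]

theorem isNearClique_nearLink_singleton [DecidableEq α] {X : Set α} {x : α} (hx : x ∈ X)
    {s : Finset α} :
    IsNearClique (nearLink X {x}) s ↔ x ∉ s ∧ IsNearClique X (insert x s) := by
  rw [isNearClique_insert]
  constructor
  · rintro ⟨h1, h2⟩
    have h3 : ∀ u ∈ s, u ∈ X ∧ u ≠ x ∧ dist x u < 1 := fun u hu =>
      mem_nearLink_singleton.1 (h1 hu)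
    refine ⟨fun h => (h3 x h).2.1 rfl, hx, fun u hu => ?_, fun u hu => (h3 u hu).1, h2⟩
    rw [dist_comm]; exact (h3 u hu).2.2
  · rintro ⟨h1, -, h2, h3, h4⟩
    refine ⟨fun u hu => ?_, h4⟩
    have hu' : u ∈ s := hu
    simp only [nearLink, Finset.mem_singleton, forall_eq, Set.mem_ofPred_eq]
    refine ⟨h3 hu, fun h => h1 (h ▸ hu'), ?_⟩
    rw [dist_comm]; exact h2 u hu'

theorem nearLink_nearLink_singleton [DecidableEq α] {X : Set α} {x : α} {s : Finset α} :
    nearLink (nearLink X {x}) s = nearLink X (insert x s) := by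
  ext v
  simp only [nearLink, Finset.mem_singleton, forall_eq, Set.mem_ofPred_eq, Finset.mem_insert,
    forall_eq_or_imp, not_or]
  tauto

theorem IsNearPseudomanifold.nearLink_singleton {X : Set α} {d : ℕ}
    (h : IsNearPseudomanifold X (d + 1)) (hd : 1 ≤ d) {x : α} (hx : x ∈ X) :
    IsNearPseudomanifold (nearLink X {x}) d := by
  have hc : ∀ s, IsNearClique (nearLink X {x}) s →
      IsNearClique X (insert x s) ∧ (insert x s).card = s.card + 1 := fun s hs => by
    rw [isNearClique_nearLink_singleton hx] at hs
    exact ⟨hs.2, Finset.card_insert_of_notMem hs.1⟩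
  refine ⟨fun s hs => ?_, fun s hs => ?_, ?_, fun s hs _ hcard => ?_, fun s hs _ hcard => ?_⟩
  · obtain ⟨t, ht, hst, htc⟩ := h.pure _ (hc s hs).1
    have hxt : x ∈ t := hst (by simp)
    refine ⟨t.erase x, ?_, ?_, ?_⟩
    · rw [isNearClique_nearLink_singleton hx, Finset.insert_erase hxt]
      exact ⟨by simp, ht⟩
    · intro u hu
      rw [isNearClique_nearLink_singleton hx] at hs
      exact Finset.mem_erase.2 ⟨fun e => hs.1 (e ▸ hu), hst (by simp [hu])⟩
    · rw [Finset.card_erase_of_mem hxt, htc]; rfl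
  · have := h.card_le _ (hc s hs).1
    have := (hc s hs).2
    omega
  · refine h.link {x} ?_ (by simp) (by simp; omega)
    simpa using isNearClique_insert.2 ⟨hx, by simp, isNearClique_empty X⟩
  · rw [nearLink_nearLink_singleton]
    exact h.two _ (hc s hs).1 (by simp) (by have := (hc s hs).2; omega)
  · rw [nearLink_nearLink_singleton]
    exact h.link _ (hc s hs).1 (by simp) (by have := (hc s hs).2; omega)

/-- If all vertex links have antipodes, then so does the whole space. -/
theorem hasAntipodes_of_nearLink {X : Set α} (hX : NearConnected X)
    (hc : ∀ x ∈ X, NearConnected (nearLink X {x}))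
    (ha : ∀ x ∈ X, HasAntipodes (nearLink X {x})) : HasAntipodes X := by
  intro x hx
  obtain ⟨y, hy⟩ := (hc x hx).1
  obtain ⟨hyX, hyx, hxy⟩ := mem_nearLink_singleton.1 hy
  have hxN : ∀ z ∈ nearLink X {x}, x ∈ nearLink X {z} := fun z hz => by
    obtain ⟨h1, h2, h3⟩ := mem_nearLink_singleton.1 hz
    exact mem_nearLink_singleton.2 ⟨hx, h2.symm, by rwa [dist_comm]⟩
  obtain ⟨x', ⟨hx'y, hfar⟩, -⟩ := ha y hyX x (hxN y hy)
  have hx'X : x' ∈ X := (mem_nearLink_singleton.1 hx'y).1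
  have hxx' : x ≠ x' := by
    rintro rfl
    simp at hfar
    linarith
  have key : ∀ z ∈ nearLink X {x}, x' ∈ nearLink X {z} := by
    refine (hc x hx).induction hy hx'y ?_
    intro u hu z hz huz hP
    obtain ⟨huX, hux, hxu⟩ := mem_nearLink_singleton.1 hu
    obtain ⟨hzX, hzx, hxz⟩ := mem_nearLink_singleton.1 hz
    have hzx' : z ≠ x' := by
      rintro rfl
      linarith
    refine mem_nearLink_singleton.2 ⟨hx'X, hzx'.symm, ?_⟩
    by_contra hcon
    by_cases hzu : z = u
    · subst hzu
      exact hcon (mem_nearLink_singleton.1 hP).2.2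
    have hzN : z ∈ nearLink X {u} := mem_nearLink_singleton.2 ⟨hzX, hzu, huz⟩
    exact hzx ((ha u huX x' hP).unique ⟨hzN, by rw [dist_comm]; exact not_lt.1 hcon⟩
      ⟨hxN u hu, by rwa [dist_comm]⟩)
  have near_or : ∀ z ∈ nearLink X {x}, ∀ v ∈ X, dist z v < 1 →
      v = x ∨ v = x' ∨ v ∈ nearLink X {x} := by
    intro z hz v hv hzv
    by_cases hvx : v = x
    · exact Or.inl hvx
    by_cases hxv : dist x v < 1
    · exact Or.inr (Or.inr (mem_nearLink_singleton.2 ⟨hv, hvx, hxv⟩))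
    have hvz : v ≠ z := by
      rintro rfl
      exact hxv (mem_nearLink_singleton.1 hz).2.2
    have hzX := (mem_nearLink_singleton.1 hz).1
    exact Or.inr (Or.inl ((ha z hzX x (hxN z hz)).unique
      ⟨mem_nearLink_singleton.2 ⟨hv, hvz, hzv⟩, not_lt.1 hxv⟩ ⟨key z hz, hfar⟩))
  have hyx' : y ∈ nearLink X {x'} := by
    obtain ⟨h1, h2, h3⟩ := mem_nearLink_singleton.1 hx'y
    exact mem_nearLink_singleton.2 ⟨hyX, h2.symm, by rwa [dist_comm]⟩
  have hx'sub : ∀ v ∈ nearLink X {x'}, v ∈ nearLink X {x} := by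
    refine (hc x' hx'X).induction hyx' hy ?_
    intro u hu v hv huv hP
    obtain ⟨hvX, hvx', hx'v⟩ := mem_nearLink_singleton.1 hv
    rcases near_or u hP v hvX huv with h | h | h
    · subst h
      rw [dist_comm] at hx'v
      linarith
    · exact absurd h hvx'
    · exact h
  have all : ∀ v ∈ X, v = x ∨ v = x' ∨ v ∈ nearLink X {x} := by
    refine hX.induction hx (Or.inl rfl) ?_
    rintro u hu v hv huv (rfl | rfl | h)
    · by_cases hvu : v = u
      · exact Or.inl hvu
      · exact Or.inr (Or.inr (mem_nearLink_singleton.2 ⟨hv, hvu, huv⟩))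
    · by_cases hvu : v = u
      · exact Or.inr (Or.inl hvu)
      · exact Or.inr (Or.inr (hx'sub v (mem_nearLink_singleton.2 ⟨hv, hvu, huv⟩)))
    · exact near_or u h v hv huv
  refine ⟨x', ⟨hx'X, hfar⟩, ?_⟩
  rintro w ⟨hwX, hw⟩
  rcases all w hwX with rfl | h | h
  · simp at hw
    linarith
  · exact h
  · have := (mem_nearLink_singleton.1 h).2.2
    linarith

theorem IsNearPseudomanifold.hasAntipodes {Q : Set α → Prop}
    (hQ : ∀ X x, Q X → Q (nearLink X {x}))
    (base : ∀ X : Set α, Q X → IsNearPseudomanifold X 2 → HasAntipodes X) (k : ℕ) :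
    ∀ X : Set α, Q X → IsNearPseudomanifold X (k + 2) → HasAntipodes X := by
  induction k with
  | zero => exact base
  | succ k ih =>
    intro X hXf h
    refine hasAntipodes_of_nearLink h.connected
      (fun x hx => (h.nearLink_singleton (by omega) hx).connected) (fun x hx => ?_)
    exact ih _ (hQ X x hXf) (h.nearLink_singleton (by omega) hx)

end Combinatorics

section PlaneGeometry

/-- The Euclidean plane. -/
abbrev Plane := EuclideanSpace ℝ (Fin 2)

/-- Twice the signed area of the triangle `a b p`. -/
def orient (a b p : Plane) : ℝ :=
  (b 0 - a 0) * (p 1 - a 1) - (b 1 - a 1) * (p 0 - a 0)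

theorem orient_swap (a b p : Plane) : orient b a p = -orient a b p := by
  simp only [orient]; ring

theorem orient_left (a b : Plane) : orient a b a = 0 := by
  simp [orient]

theorem orient_right (a b : Plane) : orient a b b = 0 := by
  simp only [orient]; ring

theorem orient_combo (a b u v : Plane) {s t : ℝ} (h : s + t = 1) :
    orient a b (s • u + t • v) = s * orient a b u + t * orient a b v := by
  obtain rfl : s = 1 - t := by linarith
  simp only [orient, PiLp.add_apply, PiLp.smul_apply, smul_eq_mul]
  ring

theorem orient_lineMap (a b u v : Plane) (t : ℝ) :
    orient a b (AffineMap.lineMap u v t) = (1 - t) * orient a b u + t * orient a b v := by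
  rw [AffineMap.lineMap_apply_module, orient_combo a b u v (by ring)]

theorem convex_orient_pos (a b : Plane) : Convex ℝ {p | 0 < orient a b p} := by
  intro u hu v hv s t hs ht hst
  simp only [Set.mem_ofPred_eq] at *
  rw [orient_combo _ _ _ _ hst]
  rcases hs.eq_or_lt with rfl | hs
  · have : t = 1 := by linarith
    subst this
    linarith
  · have := mul_pos hs hu
    have := mul_nonneg ht hv.le
    linarith

theorem convex_orient_nonneg (a b : Plane) : Convex ℝ {p | 0 ≤ orient a b p} := by
  intro u hu v hv s t hs ht hst
  simp only [Set.mem_ofPred_eq] at *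
  rw [orient_combo _ _ _ _ hst]
  positivity

theorem sq_add_sq_pos_of_ne {a b : Plane} (hab : a ≠ b) :
    0 < (b 0 - a 0) ^ 2 + (b 1 - a 1) ^ 2 := by
  by_contra hcon
  apply hab
  have h0 : b 0 - a 0 = 0 := by nlinarith [sq_nonneg (b 0 - a 0), sq_nonneg (b 1 - a 1)]
  have h1 : b 1 - a 1 = 0 := by nlinarith [sq_nonneg (b 0 - a 0), sq_nonneg (b 1 - a 1)]
  ext i
  fin_cases i
  · simp; linarith
  · simp; linarith

theorem exists_lineMap_of_orient_eq_zero {a b p : Plane} (hab : a ≠ b) (h : orient a b p = 0) :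
    ∃ t : ℝ, p = AffineMap.lineMap a b t := by
  have hL := sq_add_sq_pos_of_ne hab
  refine ⟨((b 0 - a 0) * (p 0 - a 0) + (b 1 - a 1) * (p 1 - a 1)) /
    ((b 0 - a 0) ^ 2 + (b 1 - a 1) ^ 2), ?_⟩
  simp only [orient] at h
  ext i
  rw [AffineMap.lineMap_apply_module]
  fin_cases i
  · simp only [Fin.zero_eta, PiLp.add_apply, PiLp.smul_apply, smul_eq_mul]
    field_simp
    linear_combination (-(b 1 - a 1)) * h
  · simp only [Fin.mk_one, PiLp.add_apply, PiLp.smul_apply, smul_eq_mul]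
    field_simp
    linear_combination (b 0 - a 0) * h

theorem exists_mem_segment_orient_eq_zero {a b u v : Plane}
    (h : orient a b u * orient a b v < 0) : ∃ z ∈ segment ℝ u v, orient a b z = 0 := by
  have hne : orient a b u - orient a b v ≠ 0 := by
    intro h0
    have : orient a b u = orient a b v := by linarith
    rw [this] at h
    nlinarith [mul_self_nonneg (orient a b v)]
  have key : ∀ t : ℝ, t * (orient a b u - orient a b v) = orient a b u →
      orient a b (AffineMap.lineMap u v t) = 0 := fun t ht => by
    rw [orient_lineMap]; linarith
  refine ⟨AffineMap.lineMap u v (orient a b u / (orient a b u - orient a b v)), ?_,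
    key _ (div_mul_cancel₀ _ hne)⟩
  rw [segment_eq_image_lineMap]
  refine ⟨_, ?_, rfl⟩
  rcases mul_neg_iff.1 h with ⟨h1, h2⟩ | ⟨h1, h2⟩
  · exact ⟨div_nonneg h1.le (by linarith), (div_le_one (by linarith)).2 (by linarith)⟩
  · exact ⟨div_nonneg_of_nonpos h1.le (by linarith), (div_le_one_of_neg (by linarith)).2
      (by linarith)⟩

theorem ordConnected_lineMap_preimage {K : Set Plane} (hK : Convex ℝ K) (a b : Plane) :
    {t : ℝ | AffineMap.lineMap a b t ∈ K}.OrdConnected :=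
  (hK.affine_preimage (AffineMap.lineMap a b)).ordConnected

/-- The closed segments `a b` and `c d` have a common point. -/
def SegMeet (a b c d : Plane) : Prop := (segment ℝ a b ∩ segment ℝ c d).Nonempty

theorem SegMeet.symm {a b c d : Plane} (h : SegMeet a b c d) : SegMeet c d a b := by
  rwa [SegMeet, Set.inter_comm]

theorem SegMeet.swap_left {a b c d : Plane} (h : SegMeet a b c d) : SegMeet b a c d := by
  rwa [SegMeet, segment_symm]

theorem SegMeet.swap_right {a b c d : Plane} (h : SegMeet a b c d) : SegMeet a b d c :=
  h.symm.swap_left.symm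

/-- If two segments shorter than `1` meet, then the endpoint closest to the common point is at
distance less than `1` from both endpoints of the other segment. -/
theorem SegMeet.near {a b c d : Plane} (h : SegMeet a b c d) (hab : dist a b < 1)
    (hcd : dist c d < 1) :
    (dist a c < 1 ∧ dist a d < 1) ∨ (dist b c < 1 ∧ dist b d < 1) ∨
      (dist a c < 1 ∧ dist b c < 1) ∨ (dist a d < 1 ∧ dist b d < 1) := by
  obtain ⟨p, h1, h2⟩ := h
  have e1 := dist_add_dist_of_mem_segment h1
  have e2 := dist_add_dist_of_mem_segment h2
  have t1 := dist_triangle a p c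
  have t2 := dist_triangle a p d
  have t3 := dist_triangle b p c
  have t4 := dist_triangle b p d
  rw [dist_comm b p] at t3 t4
  rw [dist_comm c p] at e2
  rcases le_total (dist a p) (dist p b) with h3 | h3 <;>
  rcases le_total (dist p c) (dist p d) with h4 | h4
  · rcases le_total (dist a p) (dist p c) with h5 | h5
    · left; constructor <;> linarith
    · right; right; left; constructor <;> linarith
  · rcases le_total (dist a p) (dist p d) with h5 | h5
    · left; constructor <;> linarith
    · right; right; right; constructor <;> linarith
  · rcases le_total (dist p b) (dist p c) with h5 | h5
    · right; left; constructor <;> linarith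
    · right; right; left; constructor <;> linarith
  · rcases le_total (dist p b) (dist p d) with h5 | h5
    · right; left; constructor <;> linarith
    · right; right; right; constructor <;> linarith

/-- If all points of `S` are strictly on one side of a line, then so is its convex hull. -/
theorem orient_ne_zero_of_mem_convexHull {a b z : Plane} {S : Set Plane}
    (hz : z ∈ convexHull ℝ S)
    (h : (∀ u ∈ S, 0 < orient a b u) ∨ ∀ u ∈ S, orient a b u < 0) : orient a b z ≠ 0 := by
  rcases h with h | h
  · exact (convexHull_min (t := {p | 0 < orient a b p}) h (convex_orient_pos a b) hz).ne'
  · have := convexHull_min (t := {p | 0 < orient b a p})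
      (fun u hu => by simpa [orient_swap a b] using h u hu) (convex_orient_pos b a) hz
    simp only [Set.mem_ofPred_eq, orient_swap a b] at this
    linarith

/-- A segment that meets a triangle, such that neither contains a vertex of the other, meets at
least two edges of the triangle. -/
theorem segMeet_two_edges {x y u v w p : Plane} (hx : x ∉ convexHull ℝ {u, v, w})
    (hy : y ∉ convexHull ℝ {u, v, w}) (hp : p ∈ segment ℝ x y)
    (hp' : p ∈ convexHull ℝ {u, v, w}) (hu : u ∉ segment ℝ x y) (hv : v ∉ segment ℝ x y)
    (hw : w ∉ segment ℝ x y) :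
    (SegMeet x y u v ∧ SegMeet x y u w) ∨ (SegMeet x y u v ∧ SegMeet x y v w) ∨
      (SegMeet x y u w ∧ SegMeet x y v w) := by
  have hxy : x ≠ y := by
    rintro rfl
    rw [segment_same] at hp
    exact hx (hp ▸ hp')
  have huH : u ∈ convexHull ℝ {u, v, w} := subset_convexHull ℝ _ (by simp)
  have hvH : v ∈ convexHull ℝ {u, v, w} := subset_convexHull ℝ _ (by simp)
  have hwH : w ∈ convexHull ℝ {u, v, w} := subset_convexHull ℝ _ (by simp)
  have core : ∀ z ∈ convexHull ℝ {u, v, w}, orient x y z = 0 → z ∈ segment ℝ x y := by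
    intro z hz hz0
    obtain ⟨s, rfl⟩ := exists_lineMap_of_orient_eq_zero hxy hz0
    rw [segment_eq_image_lineMap] at hp ⊢
    obtain ⟨r, hr, rfl⟩ := hp
    have hoc := ordConnected_lineMap_preimage (convex_convexHull ℝ {u, v, w}) x y
    refine ⟨s, ⟨?_, ?_⟩, rfl⟩
    · by_contra hs
      refine hx ?_
      have : (0 : ℝ) ∈ {t : ℝ | AffineMap.lineMap x y t ∈ convexHull ℝ {u, v, w}} :=
        hoc.out hz hp' ⟨(not_le.1 hs).le, hr.1⟩
      simpa using this
    · by_contra hs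
      refine hy ?_
      have : (1 : ℝ) ∈ {t : ℝ | AffineMap.lineMap x y t ∈ convexHull ℝ {u, v, w}} :=
        hoc.out hp' hz ⟨hr.2, (not_le.1 hs).le⟩
      simpa using this
  have meet : ∀ c ∈ convexHull ℝ {u, v, w}, ∀ d ∈ convexHull ℝ {u, v, w},
      orient x y c * orient x y d < 0 → SegMeet x y c d := by
    intro c hc d hd h
    obtain ⟨z, hz, hz0⟩ := exists_mem_segment_orient_eq_zero h
    exact ⟨z, core z ((convex_convexHull ℝ _).segment_subset hc hd hz) hz0, hz⟩
  have hp0 : orient x y p = 0 := by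
    rw [segment_eq_image_lineMap] at hp
    obtain ⟨r, -, rfl⟩ := hp
    rw [orient_lineMap, orient_left, orient_right]
    ring
  have hu0 : orient x y u ≠ 0 := fun h => hu (core u huH h)
  have hv0 : orient x y v ≠ 0 := fun h => hv (core v hvH h)
  have hw0 : orient x y w ≠ 0 := fun h => hw (core w hwH h)
  have hno := fun h => orient_ne_zero_of_mem_convexHull (a := x) (b := y) hp' h hp0
  simp only [Set.mem_insert_iff, Set.mem_singleton_iff, forall_eq_or_imp, forall_eq] at hno
  rcases lt_or_gt_of_ne hu0 with h1 | h1 <;> rcases lt_or_gt_of_ne hv0 with h2 | h2 <;>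
  rcases lt_or_gt_of_ne hw0 with h3 | h3
  · exact absurd (Or.inr ⟨h1, h2, h3⟩) hno
  · exact Or.inr (Or.inr ⟨meet u huH w hwH (mul_neg_of_neg_of_pos h1 h3),
      meet v hvH w hwH (mul_neg_of_neg_of_pos h2 h3)⟩)
  · exact Or.inr (Or.inl ⟨meet u huH v hvH (mul_neg_of_neg_of_pos h1 h2),
      meet v hvH w hwH (mul_neg_of_pos_of_neg h2 h3)⟩)
  · exact Or.inl ⟨meet u huH v hvH (mul_neg_of_neg_of_pos h1 h2),
      meet u huH w hwH (mul_neg_of_neg_of_pos h1 h3)⟩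
  · exact Or.inl ⟨meet u huH v hvH (mul_neg_of_pos_of_neg h1 h2),
      meet u huH w hwH (mul_neg_of_pos_of_neg h1 h3)⟩
  · exact Or.inr (Or.inl ⟨meet u huH v hvH (mul_neg_of_pos_of_neg h1 h2),
      meet v hvH w hwH (mul_neg_of_neg_of_pos h2 h3)⟩)
  · exact Or.inr (Or.inr ⟨meet u huH w hwH (mul_neg_of_pos_of_neg h1 h3),
      meet v hvH w hwH (mul_neg_of_pos_of_neg h2 h3)⟩)
  · exact absurd (Or.inl ⟨h1, h2, h3⟩) hno

/-- A point of a triangle other than a vertex lies between that vertex and a point of the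
opposite edge. -/
theorem exists_mem_segment_of_mem_convexHull {a s t q : Plane}
    (hq : q ∈ convexHull ℝ {a, s, t}) : ∃ r ∈ segment ℝ s t, q ∈ segment ℝ a r := by
  rw [convexHull_insert (by simp), convexHull_pair, mem_convexJoin] at hq
  obtain ⟨x, hx, r, hr, hq⟩ := hq
  rw [Set.mem_singleton_iff] at hx
  subst hx
  exact ⟨r, hr, hq⟩

/-- Two points of the plane on the same side of `a b`, both no farther from `a` and `b` than
these are from each other, are no farther from each other. -/
theorem dist_le_of_same_side {a b c d : Plane} (hac : dist a c ≤ dist a b)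
    (hbc : dist b c ≤ dist a b) (had : dist a d ≤ dist a b) (hbd : dist b d ≤ dist a b)
    (h : 0 ≤ orient a b c * orient a b d) : dist c d ≤ dist a b := by
  by_cases hab : a = b
  · subst hab
    rw [dist_self] at *
    have h1 : a = c := dist_le_zero.1 hac
    have h2 : a = d := dist_le_zero.1 had
    rw [← h1, ← h2, dist_self]
  have sq : ∀ {p q r s : Plane}, dist p q ≤ dist r s ↔
      (p 0 - q 0) ^ 2 + (p 1 - q 1) ^ 2 ≤ (r 0 - s 0) ^ 2 + (r 1 - s 1) ^ 2 := by
    intro p q r s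
    rw [EuclideanSpace.dist_eq, EuclideanSpace.dist_eq, Real.sqrt_le_sqrt_iff (by positivity)]
    simp [Real.dist_eq, sq_abs]
  have hL : 0 < (a 0 - b 0) ^ 2 + (a 1 - b 1) ^ 2 := by
    have := mt (sq (p := a) (q := b) (r := a) (s := a)).2
      (by rw [dist_self]; exact not_le.2 (dist_pos.2 hab))
    simpa using this
  rw [sq] at *
  wlog hcd : orient a b c ^ 2 ≤ orient a b d ^ 2 generalizing c d
  · have := this had hbd hac hbc (by rwa [mul_comm]) (by linarith)
    rwa [sub_sq_comm (c 0), sub_sq_comm (c 1)]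
  simp only [orient] at h hcd
  set L := (a 0 - b 0) ^ 2 + (a 1 - b 1) ^ 2 with hLdef
  set P := (b 0 - a 0) * (c 0 - a 0) + (b 1 - a 1) * (c 1 - a 1) with hP
  set Q := (b 0 - a 0) * (c 1 - a 1) - (b 1 - a 1) * (c 0 - a 0) with hQ
  set R := (b 0 - a 0) * (d 0 - a 0) + (b 1 - a 1) * (d 1 - a 1) with hR
  set S := (b 0 - a 0) * (d 1 - a 1) - (b 1 - a 1) * (d 0 - a 0) with hS
  have i1 : P ^ 2 + Q ^ 2 = L * ((a 0 - c 0) ^ 2 + (a 1 - c 1) ^ 2) := by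
    rw [hP, hQ, hLdef]; ring
  have i2 : (L - P) ^ 2 + Q ^ 2 = L * ((b 0 - c 0) ^ 2 + (b 1 - c 1) ^ 2) := by
    rw [hP, hQ, hLdef]; ring
  have i3 : R ^ 2 + S ^ 2 = L * ((a 0 - d 0) ^ 2 + (a 1 - d 1) ^ 2) := by
    rw [hR, hS, hLdef]; ring
  have i4 : (L - R) ^ 2 + S ^ 2 = L * ((b 0 - d 0) ^ 2 + (b 1 - d 1) ^ 2) := by
    rw [hR, hS, hLdef]; ring
  have i5 : (P - R) ^ 2 + (Q - S) ^ 2 = L * ((c 0 - d 0) ^ 2 + (c 1 - d 1) ^ 2) := by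
    rw [hP, hQ, hR, hS, hLdef]; ring
  have j1 : P ^ 2 + Q ^ 2 ≤ L * L := i1 ▸ mul_le_mul_of_nonneg_left hac hL.le
  have j2 : (L - P) ^ 2 + Q ^ 2 ≤ L * L := i2 ▸ mul_le_mul_of_nonneg_left hbc hL.le
  have j3 : R ^ 2 + S ^ 2 ≤ L * L := i3 ▸ mul_le_mul_of_nonneg_left had hL.le
  have j4 : (L - R) ^ 2 + S ^ 2 ≤ L * L := i4 ▸ mul_le_mul_of_nonneg_left hbd hL.le
  have p1 : P ≤ L := (abs_le_of_sq_le_sq' (by linarith [sq_nonneg Q, pow_two L]) hL.le).2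
  have p2 : 0 ≤ P := by
    linarith [(abs_le_of_sq_le_sq' (a := L - P) (by linarith [sq_nonneg Q, pow_two L]) hL.le).2]
  have k : (Q - S) ^ 2 ≤ S ^ 2 := by
    have h1 : |Q| * |Q| ≤ |Q| * |S| :=
      mul_le_mul_of_nonneg_left (sq_le_sq.1 hcd) (abs_nonneg Q)
    rw [← abs_mul Q S, abs_of_nonneg h, abs_mul_abs_self] at h1
    linarith [sub_sq Q S, pow_two Q]
  have fin : (P - R) ^ 2 + (Q - S) ^ 2 ≤ L * L := by
    rcases le_total P R with hPR | hPR
    · have h1 : (P - R) ^ 2 ≤ R ^ 2 := sq_le_sq' (by linarith) (by linarith)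
      linarith
    · have h1 : (P - R) ^ 2 ≤ (L - R) ^ 2 := sq_le_sq' (by linarith) (by linarith)
      linarith
  rw [i5] at fin
  exact le_of_mul_le_mul_left fin hL

end PlaneGeometry

section Surfaces

variable {X : Set Plane}

/-- Three distinct points of `X` which are pairwise at distance less than `1`. -/
structure NearTriangle (X : Set Plane) (x y z : Plane) : Prop where
  mem₁ : x ∈ X
  mem₂ : y ∈ X
  mem₃ : z ∈ X
  ne₁₂ : x ≠ y
  ne₁₃ : x ≠ z
  ne₂₃ : y ≠ z
  near₁₂ : dist x y < 1
  near₁₃ : dist x z < 1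
  near₂₃ : dist y z < 1

theorem NearTriangle.swap {x y z : Plane} (h : NearTriangle X x y z) : NearTriangle X y x z :=
  ⟨h.mem₂, h.mem₁, h.mem₃, h.ne₁₂.symm, h.ne₂₃, h.ne₁₃, by rw [dist_comm]; exact h.near₁₂,
    h.near₂₃, h.near₁₃⟩

theorem NearTriangle.rotate {x y z : Plane} (h : NearTriangle X x y z) : NearTriangle X y z x :=
  ⟨h.mem₂, h.mem₃, h.mem₁, h.ne₂₃, h.ne₁₂.symm, h.ne₁₃.symm, h.near₂₃,
    by rw [dist_comm]; exact h.near₁₂, by rw [dist_comm]; exact h.near₁₃⟩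

theorem NearTriangle.isNearClique {x y z : Plane} (h : NearTriangle X x y z) :
    IsNearClique X {x, y, z} := by
  simp only [← insert_empty_eq z]
  refine isNearClique_insert.2 ⟨h.mem₁, ?_, isNearClique_insert.2 ⟨h.mem₂, ?_,
    isNearClique_insert.2 ⟨h.mem₃, by simp, isNearClique_empty X⟩⟩⟩
  · simpa using ⟨by rw [dist_comm]; exact h.near₁₂, by rw [dist_comm]; exact h.near₁₃⟩
  · simpa using by rw [dist_comm]; exact h.near₂₃

theorem IsNearClique.nearTriangle {s : Finset Plane} (hs : IsNearClique X s) {x y z : Plane}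
    (hx : x ∈ s) (hy : y ∈ s) (hz : z ∈ s) (hxy : x ≠ y) (hxz : x ≠ z) (hyz : y ≠ z) :
    NearTriangle X x y z :=
  ⟨hs.1 hx, hs.1 hy, hs.1 hz, hxy, hxz, hyz, hs.2 _ hx _ hy, hs.2 _ hx _ hz, hs.2 _ hy _ hz⟩

/-- There is no fourth point close to all vertices of a triangle. -/
theorem IsNearPseudomanifold.eq_of_near (h : IsNearPseudomanifold X 2) {x y z w : Plane}
    (ht : NearTriangle X x y z) (hw : w ∈ X) (hx : dist x w < 1) (hy : dist y w < 1)
    (hz : dist z w < 1) : w = x ∨ w = y ∨ w = z := by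
  by_contra hcon
  have h1 : IsNearClique X (insert w {x, y, z}) :=
    isNearClique_insert.2 ⟨hw, by simpa using ⟨hx, hy, hz⟩, ht.isNearClique⟩
  have h2 := h.card_le _ h1
  rw [Finset.card_insert_of_notMem (by simpa using hcon),
    Finset.card_eq_three.2 ⟨x, y, z, ht.ne₁₂, ht.ne₁₃, ht.ne₂₃, rfl⟩] at h2
  omega

theorem dist_lt_of_mem_convexHull {S : Set Plane} {u x : Plane} (hS : ∀ v ∈ S, dist u v < 1)
    (hx : x ∈ convexHull ℝ S) : dist u x < 1 := by
  have := convexHull_min (t := Metric.ball u 1)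
    (fun v hv => by rw [Metric.mem_ball']; exact hS v hv) (convex_ball u 1) hx
  rwa [Metric.mem_ball'] at this

/-- A triangle contains no points of `X` other than its vertices. -/
theorem IsNearPseudomanifold.eq_of_mem_convexHull (h : IsNearPseudomanifold X 2)
    {x y z w : Plane} (ht : NearTriangle X x y z) (hw : w ∈ X)
    (hwt : w ∈ convexHull ℝ {x, y, z}) : w = x ∨ w = y ∨ w = z := by
  have h1 := ht.rotate
  have h2 := h1.rotate
  refine h.eq_of_near ht hw (dist_lt_of_mem_convexHull ?_ hwt)
    (dist_lt_of_mem_convexHull ?_ hwt) (dist_lt_of_mem_convexHull ?_ hwt)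
  · simpa using And.intro ht.near₁₂ ht.near₁₃
  · simpa using And.intro h1.near₁₃ h1.near₁₂
  · simpa using And.intro h2.near₁₂ h2.near₁₃

/-- If `X` contains the vertices of an octahedron then it consists of these. -/
theorem IsNearPseudomanifold.hasAntipodes_of_octahedron (h : IsNearPseudomanifold X 2)
    (P : Fin 3 → Bool → Plane) (hP : ∀ i b, P i b ∈ X)
    (near : ∀ i j b c, i ≠ j → dist (P i b) (P j c) < 1)
    (far : ∀ i b, 1 ≤ dist (P i b) (P i !b)) : HasAntipodes X := by
  have ne' : ∀ i b, P i b ≠ P i !b := fun i b he => by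
    have := far i b
    rw [← he, dist_self] at this
    linarith
  have ne : ∀ i j b c, i ≠ j → P i b ≠ P j c := fun i j b c hij he => by
    have h1 := far i b
    rw [he] at h1
    exact absurd (near j i c (!b) hij.symm) (not_lt.2 h1)
  have third : ∀ i j : Fin 3, i ≠ j → ∃ k, k ≠ i ∧ k ≠ j := by decide
  have edge : ∀ i j b c, i ≠ j → ∀ q ∈ X, dist (P i b) q < 1 → dist (P j c) q < 1 →
      ∃ k e, q = P k e := by
    intro i j b c hij q hq hq1 hq2
    by_cases e1 : q = P i b
    · exact ⟨_, _, e1⟩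
    by_cases e2 : q = P j c
    · exact ⟨_, _, e2⟩
    obtain ⟨k, hki, hkj⟩ := third i j hij
    have hcl : IsNearClique X {P i b, P j c} := by
      refine ⟨?_, ?_⟩
      · intro v hv
        simp only [Finset.coe_insert, Finset.coe_singleton, Set.mem_insert_iff,
          Set.mem_singleton_iff] at hv
        rcases hv with rfl | rfl <;> exact hP _ _
      · simpa using ⟨near i j b c hij, near j i c b hij.symm⟩
    have h2 := h.two _ hcl (by simp) (Finset.card_pair (ne i j b c hij))
    have hsub : {P k true, P k false} ⊆ nearLink X {P i b, P j c} := by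
      intro v hv
      simp only [Set.mem_insert_iff, Set.mem_singleton_iff] at hv
      rcases hv with rfl | rfl <;>
        simp [nearLink, hP, near i k _ _ hki.symm, near j k _ _ hkj.symm, ne k i _ _ hki,
          ne k j _ _ hkj]
    have heq := Set.eq_of_subset_of_ncard_le hsub
      (by rw [h2, Set.ncard_pair (by simpa using ne' k true)])
      (Set.finite_of_ncard_ne_zero (by rw [h2]; norm_num))
    have hmem : q ∈ nearLink X {P i b, P j c} := by
      simp [nearLink, hq, e1, e2, hq1, hq2]
    rw [← heq] at hmem
    rcases hmem with h | h
    · exact ⟨_, _, h⟩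
    · exact ⟨_, _, h⟩
  have star : ∀ i b, ∀ q ∈ X, dist (P i b) q < 1 → ∃ k e, q = P k e := by
    intro i b q hq hq1
    by_cases e1 : q = P i b
    · exact ⟨_, _, e1⟩
    obtain ⟨j, hji, -⟩ := third i (i + 1) (by fin_cases i <;> decide)
    have hcon : NearConnected (nearLink X {P i b}) := by
      refine h.link _ ?_ (by simp) (by simp)
      exact ⟨by simpa using hP i b, by simp⟩
    refine hcon.induction (u := P j true) (P := fun q => ∃ k e, q = P k e)
      (mem_nearLink_singleton.2 ⟨hP _ _, ne _ _ _ _ hji, near _ _ _ _ hji.symm⟩)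
      ⟨_, _, rfl⟩ ?_ q (mem_nearLink_singleton.2 ⟨hq, e1, hq1⟩)
    rintro u hu v hv huv ⟨k, e, rfl⟩
    rw [mem_nearLink_singleton] at hu hv
    have hki : i ≠ k := by
      rintro rfl
      obtain rfl | rfl := Bool.eq_or_eq_not e b
      · exact hu.2.1 rfl
      · exact absurd hu.2.2 (not_lt.2 (far i b))
    exact edge i k b e hki v hv.1 hv.2.2 huv
  have all : ∀ q ∈ X, ∃ k e, q = P k e := by
    refine h.connected.induction (hP 0 true) ⟨_, _, rfl⟩ ?_
    rintro u hu v hv huv ⟨k, e, rfl⟩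
    exact star k e v hv huv
  intro x hx
  obtain ⟨i, b, rfl⟩ := all x hx
  refine ⟨P i !b, ⟨hP _ _, far i b⟩, ?_⟩
  rintro y ⟨hy, hd⟩
  obtain ⟨j, c, rfl⟩ := all y hy
  by_cases hij : i = j
  · subst hij
    obtain rfl | rfl := Bool.eq_or_eq_not c b
    · simp at hd
      linarith
    · rfl
  · exact absurd (near i j b c hij) (not_lt.2 hd)

/-- Two disjoint triangles in `X`. -/
structure TrianglePair (X : Set Plane) (x y z u v w : Plane) : Prop where
  left : NearTriangle X x y z
  right : NearTriangle X u v w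
  ne₁ : x ≠ u ∧ x ≠ v ∧ x ≠ w
  ne₂ : y ≠ u ∧ y ≠ v ∧ y ≠ w
  ne₃ : z ≠ u ∧ z ≠ v ∧ z ≠ w

namespace TrianglePair

variable {x y z u v w : Plane}

theorem symm (h : TrianglePair X x y z u v w) : TrianglePair X u v w x y z :=
  ⟨h.right, h.left, ⟨h.ne₁.1.symm, h.ne₂.1.symm, h.ne₃.1.symm⟩,
    ⟨h.ne₁.2.1.symm, h.ne₂.2.1.symm, h.ne₃.2.1.symm⟩,
    ⟨h.ne₁.2.2.symm, h.ne₂.2.2.symm, h.ne₃.2.2.symm⟩⟩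

theorem swap_left (h : TrianglePair X x y z u v w) : TrianglePair X y x z u v w :=
  ⟨h.left.swap, h.right, h.ne₂, h.ne₁, h.ne₃⟩

theorem rotate_left (h : TrianglePair X x y z u v w) : TrianglePair X y z x u v w :=
  ⟨h.left.rotate, h.right, h.ne₂, h.ne₃, h.ne₁⟩

theorem swap_right (h : TrianglePair X x y z u v w) : TrianglePair X x y z v u w :=
  h.symm.swap_left.symm

theorem rotate_right (h : TrianglePair X x y z u v w) : TrianglePair X x y z v w u :=
  h.symm.rotate_left.symm

theorem notMem_convexHull (hX : IsNearPseudomanifold X 2) (h : TrianglePair X x y z u v w) :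
    x ∉ convexHull ℝ {u, v, w} := fun hx => by
  rcases hX.eq_of_mem_convexHull h.right h.left.mem₁ hx with e | e | e
  · exact h.ne₁.1 e
  · exact h.ne₁.2.1 e
  · exact h.ne₁.2.2 e

theorem notMem_segment (hX : IsNearPseudomanifold X 2) (h : TrianglePair X x y z u v w) :
    u ∉ segment ℝ x y := fun hu =>
  h.symm.notMem_convexHull hX (segment_subset_convexHull (by simp) (by simp) hu)

theorem segMeet (hX : IsNearPseudomanifold X 2) (h : TrianglePair X x y z u v w) {p : Plane}
    (hp : p ∈ segment ℝ x y) (hp' : p ∈ convexHull ℝ {u, v, w}) :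
    (SegMeet x y u v ∧ SegMeet x y u w) ∨ (SegMeet x y u v ∧ SegMeet x y v w) ∨
      (SegMeet x y u w ∧ SegMeet x y v w) :=
  segMeet_two_edges (h.notMem_convexHull hX) (h.swap_left.notMem_convexHull hX) hp hp'
    (h.notMem_segment hX) (h.rotate_right.notMem_segment hX)
    (h.rotate_right.rotate_right.notMem_segment hX)

theorem segMeet_other (hX : IsNearPseudomanifold X 2) (h : TrianglePair X x y z u v w)
    (hm : SegMeet x y u v) : SegMeet x y u w ∨ SegMeet x y v w := by
  obtain ⟨p, hp, hp'⟩ := hm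
  have := h.segMeet hX hp (segment_subset_convexHull (by simp) (by simp) hp')
  tauto

theorem not_near_vertex (hX : IsNearPseudomanifold X 2) (h : TrianglePair X x y z u v w) :
    ¬(dist x u < 1 ∧ dist x v < 1 ∧ dist x w < 1) := fun hn => by
  rcases hX.eq_of_near h.right h.left.mem₁ (by rw [dist_comm]; exact hn.1)
    (by rw [dist_comm]; exact hn.2.1) (by rw [dist_comm]; exact hn.2.2) with e | e | e
  · exact h.ne₁.1 e
  · exact h.ne₁.2.1 e
  · exact h.ne₁.2.2 e

theorem not_near_edge (hX : IsNearPseudomanifold X 2) (h : TrianglePair X x y z u v w) :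
    ¬(dist x u < 1 ∧ dist x v < 1 ∧ dist y u < 1 ∧ dist y v < 1) := fun hn => by
  have ht : NearTriangle X x y u := ⟨h.left.mem₁, h.left.mem₂, h.right.mem₁, h.left.ne₁₂,
    h.ne₁.1, h.ne₂.1, h.left.near₁₂, hn.1, hn.2.2.1⟩
  rcases hX.eq_of_near ht h.right.mem₂ hn.2.1 hn.2.2.2 h.right.near₁₂ with e | e | e
  · exact h.ne₁.2.1 e.symm
  · exact h.ne₂.2.1 e.symm
  · exact h.right.ne₁₂ e.symm

/-- The conditions on the pairs at distance less than `1` between two disjoint triangles. -/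
theorem not_near (hX : IsNearPseudomanifold X 2) (h : TrianglePair X x y z u v w) :
    ¬(dist x u < 1 ∧ dist x v < 1 ∧ dist x w < 1) ∧
    ¬(dist y u < 1 ∧ dist y v < 1 ∧ dist y w < 1) ∧
    ¬(dist z u < 1 ∧ dist z v < 1 ∧ dist z w < 1) ∧
    ¬(dist x u < 1 ∧ dist y u < 1 ∧ dist z u < 1) ∧
    ¬(dist x v < 1 ∧ dist y v < 1 ∧ dist z v < 1) ∧
    ¬(dist x w < 1 ∧ dist y w < 1 ∧ dist z w < 1) ∧
    ¬(dist x u < 1 ∧ dist x v < 1 ∧ dist y u < 1 ∧ dist y v < 1) ∧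
    ¬(dist x v < 1 ∧ dist x w < 1 ∧ dist y v < 1 ∧ dist y w < 1) ∧
    ¬(dist x w < 1 ∧ dist x u < 1 ∧ dist y w < 1 ∧ dist y u < 1) ∧
    ¬(dist y u < 1 ∧ dist y v < 1 ∧ dist z u < 1 ∧ dist z v < 1) ∧
    ¬(dist y v < 1 ∧ dist y w < 1 ∧ dist z v < 1 ∧ dist z w < 1) ∧
    ¬(dist y w < 1 ∧ dist y u < 1 ∧ dist z w < 1 ∧ dist z u < 1) ∧
    ¬(dist z u < 1 ∧ dist z v < 1 ∧ dist x u < 1 ∧ dist x v < 1) ∧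
    ¬(dist z v < 1 ∧ dist z w < 1 ∧ dist x v < 1 ∧ dist x w < 1) ∧
    ¬(dist z w < 1 ∧ dist z u < 1 ∧ dist x w < 1 ∧ dist x u < 1) := by
  have hs := h.symm
  have col := fun {x y z u v w : Plane} (h : TrianglePair X x y z u v w) => by
    have := h.symm.not_near_vertex hX
    rwa [dist_comm u x, dist_comm u y, dist_comm u z] at this
  exact ⟨h.not_near_vertex hX, h.rotate_left.not_near_vertex hX,
    h.rotate_left.rotate_left.not_near_vertex hX, col h, col h.rotate_right,
    col h.rotate_right.rotate_right, h.not_near_edge hX, h.rotate_right.not_near_edge hX,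
    h.rotate_right.rotate_right.not_near_edge hX, h.rotate_left.not_near_edge hX,
    h.rotate_left.rotate_right.not_near_edge hX,
    h.rotate_left.rotate_right.rotate_right.not_near_edge hX,
    h.rotate_left.rotate_left.not_near_edge hX,
    h.rotate_left.rotate_left.rotate_right.not_near_edge hX,
    h.rotate_left.rotate_left.rotate_right.rotate_right.not_near_edge hX⟩

/-- Two edges of one triangle cannot both cross two edges of another one. -/
theorem false_of_four_crossings (hX : IsNearPseudomanifold X 2)
    (h : TrianglePair X x y z u v w) (h₁ : SegMeet x y u v) (h₂ : SegMeet x y u w)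
    (h₃ : SegMeet x z u v) (h₄ : SegMeet x z u w) : False := by
  have n := h.not_near hX
  have d₁ := h₁.near h.left.near₁₂ h.right.near₁₂
  have d₂ := h₂.near h.left.near₁₂ h.right.near₁₃
  have d₃ := h₃.near h.left.near₁₃ h.right.near₁₂
  have d₄ := h₄.near h.left.near₁₃ h.right.near₁₃
  grind

/-- Triangles all of whose edges cross in the cyclic pattern span an octahedron. -/
theorem hasAntipodes_of_six_crossings (hX : IsNearPseudomanifold X 2)
    (h : TrianglePair X x y z u v w) (h₁ : SegMeet x y u v) (h₂ : SegMeet x y u w)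
    (h₃ : SegMeet x z u v) (h₄ : SegMeet x z v w) (h₅ : SegMeet y z u w)
    (h₆ : SegMeet y z v w) : HasAntipodes X := by
  have n := h.not_near hX
  have d₁ := h₁.near h.left.near₁₂ h.right.near₁₂
  have d₂ := h₂.near h.left.near₁₂ h.right.near₁₃
  have d₃ := h₃.near h.left.near₁₃ h.right.near₁₂
  have d₄ := h₄.near h.left.near₁₃ h.right.near₂₃
  have d₅ := h₅.near h.left.near₂₃ h.right.near₁₃
  have d₆ := h₆.near h.left.near₂₃ h.right.near₂₃
  have key : (dist x u < 1 ∧ dist x v < 1 ∧ dist y u < 1 ∧ dist y w < 1 ∧ dist z v < 1 ∧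
      dist z w < 1) ∧ ¬dist x w < 1 ∧ ¬dist y v < 1 ∧ ¬dist z u < 1 := by
    grind (splits := 20)
  obtain ⟨⟨k₁, k₂, k₃, k₄, k₅, k₆⟩, k₇, k₈, k₉⟩ := key
  have l := h.left
  have r := h.right
  refine hX.hasAntipodes_of_octahedron
    (fun i b => if b then ![x, y, z] i else ![w, v, u] i) ?_ ?_ ?_
  · intro i b
    fin_cases i <;> cases b
    exacts [r.mem₃, l.mem₁, r.mem₂, l.mem₂, r.mem₁, l.mem₃]
  · have hd : ∀ i j : Fin 3, ∀ b c : Bool, i < j →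
        dist (if b then ![x, y, z] i else ![w, v, u] i)
          (if c then ![x, y, z] j else ![w, v, u] j) < 1 := by
      intro i j b c hij
      have := l.near₁₂; have := l.near₁₃; have := l.near₂₃
      have := r.near₁₂; have := r.near₁₃; have := r.near₂₃
      fin_cases i <;> fin_cases j <;> first | exact absurd hij (by decide) | skip
      all_goals
        cases b <;> cases c <;> simp <;> first | assumption | (rw [dist_comm]; assumption)
    intro i j b c hij
    rcases lt_or_gt_of_ne hij with hlt | hlt
    · exact hd i j b c hlt
    · rw [dist_comm]
      exact hd j i c b hlt
  · intro i b
    have k₇' := not_lt.1 k₇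
    have k₈' := not_lt.1 k₈
    have k₉' := not_lt.1 k₉
    fin_cases i <;> cases b <;> simp <;> first | assumption | (rw [dist_comm]; assumption)

theorem hasAntipodes_of_two_crossings (hX : IsNearPseudomanifold X 2)
    (h : TrianglePair X x y z u v w) (h₁ : SegMeet x y u v) (h₂ : SegMeet x y u w) :
    HasAntipodes X := by
  have main : ∀ {x y z u v w : Plane}, TrianglePair X x y z u v w → SegMeet x y u v →
      SegMeet x y u w → SegMeet x z u v → SegMeet y z u w → HasAntipodes X := by
    intro x y z u v w h h₁ h₂ h₃ h₄
    have c₁ := h.rotate_left.rotate_left.segMeet_other hX h₃.swap_left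
    have c₂ := h.rotate_left.rotate_right.rotate_right.segMeet_other hX h₄.swap_right
    rcases c₁ with c₁ | c₁
    · exact (h.false_of_four_crossings hX h₁ h₂ h₃ c₁.swap_left).elim
    rcases c₂ with c₂ | c₂
    swap
    · exact (h.swap_left.false_of_four_crossings hX h₁.swap_left h₂.swap_left c₂ h₄).elim
    exact h.hasAntipodes_of_six_crossings hX h₁ h₂ h₃ c₁.swap_left h₄ c₂.swap_right
  have c₁ := h.symm.segMeet_other hX h₁.symm
  have c₂ := h.symm.rotate_left.rotate_left.segMeet_other hX h₂.symm.swap_left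
  rcases c₁ with c₁ | c₁ <;> rcases c₂ with c₂ | c₂
  · exact (h.false_of_four_crossings hX h₁ h₂ c₁.symm c₂.symm.swap_right).elim
  · exact main h h₁ h₂ c₁.symm c₂.symm.swap_right
  · exact main h.swap_left h₁.swap_left h₂.swap_left c₁.symm c₂.symm.swap_right
  · exact (h.swap_left.false_of_four_crossings hX h₁.swap_left h₂.swap_left c₁.symm
      c₂.symm.swap_right).elim

/-- If an edge of a triangle meets a disjoint triangle, then `X` is an octahedron. -/
theorem hasAntipodes (hX : IsNearPseudomanifold X 2) (h : TrianglePair X x y z u v w)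
    {p : Plane} (hp : p ∈ segment ℝ x y) (hp' : p ∈ convexHull ℝ {u, v, w}) :
    HasAntipodes X := by
  rcases h.segMeet hX hp hp' with ⟨h₁, h₂⟩ | ⟨h₁, h₂⟩ | ⟨h₁, h₂⟩
  · exact h.hasAntipodes_of_two_crossings hX h₁ h₂
  · exact h.swap_right.hasAntipodes_of_two_crossings hX h₁.swap_right h₂
  · exact h.rotate_right.rotate_right.hasAntipodes_of_two_crossings hX h₁.swap_right
      h₂.swap_right

end TrianglePair

end Surfaces

section Rays

/-- The ray from `q` through `r` meets the segment `u v`. -/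
def RayMeets (q r u v : Plane) : Prop :=
  ∃ s : ℝ, 0 ≤ s ∧ AffineMap.lineMap q r s ∈ segment ℝ u v

variable {q r u v x y z : Plane}

theorem rayMeets_comm : RayMeets q r u v ↔ RayMeets q r v u := by
  simp only [RayMeets, segment_symm]

theorem orient_lineMap_self (q r : Plane) (s : ℝ) : orient q r (AffineMap.lineMap q r s) = 0 := by
  rw [orient_lineMap, orient_left, orient_right]
  ring

theorem not_rayMeets_of_same_side (h : 0 < orient q r u * orient q r v) :
    ¬RayMeets q r u v := by
  rintro ⟨s, -, hs⟩
  rw [← convexHull_pair] at hs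
  refine orient_ne_zero_of_mem_convexHull hs ?_ (orient_lineMap_self q r s)
  simpa using pos_and_pos_or_neg_and_neg_of_mul_pos h

theorem RayMeets.of_opposite (hq : q ∉ convexHull ℝ {x, y, z})
    (hxz : orient q r x * orient q r z < 0) (h : RayMeets q r x y) : RayMeets q r x z := by
  obtain ⟨s, hs0, hs⟩ := h
  have hqr : q ≠ r := by
    rintro rfl
    simp [orient] at hxz
  obtain ⟨p, hp, hp0⟩ := exists_mem_segment_orient_eq_zero hxz
  obtain ⟨t, rfl⟩ := exists_lineMap_of_orient_eq_zero hqr hp0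
  refine ⟨t, ?_, hp⟩
  by_contra ht
  apply hq
  have h0 : (0 : ℝ) ∈ {t : ℝ | AffineMap.lineMap q r t ∈ convexHull ℝ {x, y, z}} :=
    (ordConnected_lineMap_preimage (convex_convexHull ℝ {x, y, z}) q r).out
      (segment_subset_convexHull (by simp) (by simp) hp)
      (segment_subset_convexHull (by simp) (by simp) hs) ⟨(not_le.1 ht).le, hs0⟩
  simpa using h0

theorem rayMeets_lone_vertex (hq : q ∉ convexHull ℝ {x, y, z})
    (hxy : orient q r x * orient q r y < 0) (hxz : orient q r x * orient q r z < 0) :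
    (RayMeets q r x y ↔ RayMeets q r x z) ∧ ¬RayMeets q r y z := by
  refine ⟨⟨fun h => h.of_opposite hq hxz, fun h => h.of_opposite ?_ hxy⟩,
    not_rayMeets_of_same_side ?_⟩
  · rwa [Set.pair_comm z y]
  · rcases mul_neg_iff.1 hxy with h1 | h1 <;> rcases mul_neg_iff.1 hxz with h2 | h2
    · exact mul_pos_of_neg_of_neg h1.2 h2.2
    · linarith
    · linarith
    · exact mul_pos h1.2 h2.2

/-- A ray starting outside a triangle and missing its vertices meets an even number of its
edges. -/
theorem rayMeets_even (hq : q ∉ convexHull ℝ {x, y, z}) (hx : orient q r x ≠ 0)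
    (hy : orient q r y ≠ 0) (hz : orient q r z ≠ 0) :
    ((RayMeets q r x y ↔ RayMeets q r x z) ∧ ¬RayMeets q r y z) ∨
    ((RayMeets q r x y ↔ RayMeets q r y z) ∧ ¬RayMeets q r x z) ∨
    ((RayMeets q r x z ↔ RayMeets q r y z) ∧ ¬RayMeets q r x y) := by
  have hyq : q ∉ convexHull ℝ {y, x, z} := by rwa [Set.insert_comm]
  have hzq : q ∉ convexHull ℝ {z, x, y} := by
    rwa [Set.insert_comm z x, Set.pair_comm z y]
  rcases lt_or_gt_of_ne hx with h1 | h1 <;> rcases lt_or_gt_of_ne hy with h2 | h2 <;>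
  rcases lt_or_gt_of_ne hz with h3 | h3
  · have k1 := not_rayMeets_of_same_side (mul_pos_of_neg_of_neg h1 h2)
    have k2 := not_rayMeets_of_same_side (mul_pos_of_neg_of_neg h1 h3)
    have k3 := not_rayMeets_of_same_side (mul_pos_of_neg_of_neg h2 h3)
    tauto
  · have := rayMeets_lone_vertex hzq (mul_neg_of_pos_of_neg h3 h1) (mul_neg_of_pos_of_neg h3 h2)
    rw [rayMeets_comm (u := z), rayMeets_comm (u := z)] at this
    tauto
  · have := rayMeets_lone_vertex hyq (mul_neg_of_pos_of_neg h2 h1) (mul_neg_of_pos_of_neg h2 h3)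
    rw [rayMeets_comm (u := y) (v := x)] at this
    tauto
  · exact Or.inl (rayMeets_lone_vertex hq (mul_neg_of_neg_of_pos h1 h2)
      (mul_neg_of_neg_of_pos h1 h3))
  · exact Or.inl (rayMeets_lone_vertex hq (mul_neg_of_pos_of_neg h1 h2)
      (mul_neg_of_pos_of_neg h1 h3))
  · have := rayMeets_lone_vertex hyq (mul_neg_of_neg_of_pos h2 h1) (mul_neg_of_neg_of_pos h2 h3)
    rw [rayMeets_comm (u := y) (v := x)] at this
    tauto
  · have := rayMeets_lone_vertex hzq (mul_neg_of_neg_of_pos h3 h1) (mul_neg_of_neg_of_pos h3 h2)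
    rw [rayMeets_comm (u := z), rayMeets_comm (u := z)] at this
    tauto
  · have k1 := not_rayMeets_of_same_side (mul_pos h1 h2)
    have k2 := not_rayMeets_of_same_side (mul_pos h1 h3)
    have k3 := not_rayMeets_of_same_side (mul_pos h2 h3)
    tauto

theorem orient_eq_zero_of_mem_segment {a b : Plane} (h : q ∈ segment ℝ a b) :
    orient a b q = 0 := by
  rw [segment_eq_image_lineMap] at h
  obtain ⟨t, -, rfl⟩ := h
  exact orient_lineMap_self a b t

/-- A ray starting on the edge `a b` and pointing into the triangle `a b c` meets exactly one of
the other two edges. -/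
theorem rayMeets_of_mem_openSegment {a b c : Plane} (hq : q ∈ openSegment ℝ a b)
    (hr : 0 < orient a b r) (hc : 0 < orient a b c) (ha : orient q r a ≠ 0)
    (hc' : orient q r c ≠ 0) :
    (RayMeets q r a c ∧ ¬RayMeets q r b c) ∨ (¬RayMeets q r a c ∧ RayMeets q r b c) := by
  have hq0 := orient_eq_zero_of_mem_segment (openSegment_subset_segment ℝ a b hq)
  have hqr : q ≠ r := by
    rintro rfl
    linarith
  have meets : ∀ e, orient a b e = 0 → orient q r e * orient q r c < 0 → RayMeets q r e c := by
    intro e he hec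
    obtain ⟨p, hp, hp0⟩ := exists_mem_segment_orient_eq_zero hec
    obtain ⟨t, rfl⟩ := exists_lineMap_of_orient_eq_zero hqr hp0
    refine ⟨t, ?_, hp⟩
    have h1 : 0 ≤ orient a b (AffineMap.lineMap q r t) :=
      (convex_orient_nonneg a b).segment_subset (by simpa using he.ge) (by simpa using hc.le) hp
    rw [orient_lineMap, hq0, mul_zero, zero_add] at h1
    exact nonneg_of_mul_nonneg_left h1 hr
  obtain ⟨s, t, hs, ht, hst, rfl⟩ := hq
  have hopp := orient_combo (s • a + t • b) r a b hst
  rw [orient_left] at hopp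
  set A := orient (s • a + t • b) r a
  set B := orient (s • a + t • b) r b
  set C := orient (s • a + t • b) r c
  rcases lt_or_gt_of_ne ha with h1 | h1 <;> rcases lt_or_gt_of_ne hc' with h2 | h2
  · have hB : 0 < B := pos_of_mul_pos_right (by nlinarith [mul_neg_of_pos_of_neg hs h1]) ht.le
    exact Or.inr ⟨not_rayMeets_of_same_side (mul_pos_of_neg_of_neg h1 h2),
      meets b (orient_right a b) (mul_neg_of_pos_of_neg hB h2)⟩
  · have hB : 0 < B := pos_of_mul_pos_right (by nlinarith [mul_neg_of_pos_of_neg hs h1]) ht.le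
    exact Or.inl ⟨meets a (orient_left a b) (mul_neg_of_neg_of_pos h1 h2),
      not_rayMeets_of_same_side (mul_pos hB h2)⟩
  · have hB : B < 0 := neg_of_mul_neg_right (by nlinarith [mul_pos hs h1]) ht.le
    exact Or.inl ⟨meets a (orient_left a b) (mul_neg_of_pos_of_neg h1 h2),
      not_rayMeets_of_same_side (mul_pos_of_neg_of_neg hB h2)⟩
  · have hB : B < 0 := neg_of_mul_neg_right (by nlinarith [mul_pos hs h1]) ht.le
    exact Or.inr ⟨not_rayMeets_of_same_side (mul_pos h1 h2),
      meets b (orient_right a b) (mul_neg_of_neg_of_pos hB h2)⟩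

theorem not_rayMeets_of_opposite_side {a b d e : Plane} (hq : orient a b q = 0)
    (hr : 0 < orient a b r) (hd : orient a b d < 0) (he : orient a b e = 0)
    (he' : orient q r e ≠ 0) : ¬RayMeets q r e d := by
  rintro ⟨s, hs, h⟩
  have h0 := orient_lineMap_self q r s
  have h1 := orient_lineMap a b q r s
  rw [hq, mul_zero, zero_add] at h1
  rw [segment_eq_image_lineMap] at h
  obtain ⟨t, ht, h⟩ := h
  rw [← h, orient_lineMap, he, mul_zero, zero_add] at h1
  have ht0 : t = 0 := by
    have := mul_nonneg hs hr.le
    rcases ht.1.eq_or_lt with h | h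
    · exact h.symm
    · have := mul_neg_of_pos_of_neg h hd
      linarith
  rw [← h, ht0, AffineMap.lineMap_apply_zero] at h0
  exact he' h0

/-- From a point of the line `a b` there are rays to the left of it that avoid any finite set. -/
theorem exists_ray_avoiding {X : Set Plane} (hX : X.Finite) {a b : Plane} (hab : a ≠ b)
    (hq : orient a b q = 0) (hqX : q ∉ X) :
    ∃ r, 0 < orient a b r ∧ ∀ v ∈ X, orient q r v ≠ 0 := by
  obtain ⟨t, ht⟩ := (hX.image fun v => ((b 0 - a 0) * (v 0 - q 0) +
    (b 1 - a 1) * (v 1 - q 1)) / orient a b v).exists_notMem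
  have hL := sq_add_sq_pos_of_ne hab
  set r : Plane := !₂[q 0 - (b 1 - a 1) + t * (b 0 - a 0), q 1 + (b 0 - a 0) + t * (b 1 - a 1)]
    with hr
  have e0 : r 0 = q 0 - (b 1 - a 1) + t * (b 0 - a 0) := by simp [hr]
  have e1 : r 1 = q 1 + (b 0 - a 0) + t * (b 1 - a 1) := by simp [hr]
  clear_value r
  refine ⟨r, ?_, fun v hv hv0 => ?_⟩
  · have : orient a b r = orient a b q + ((b 0 - a 0) ^ 2 + (b 1 - a 1) ^ 2) := by
      simp only [orient, e0, e1]; ring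
    rw [this, hq]
    linarith
  · have key : t * orient a b v = (b 0 - a 0) * (v 0 - q 0) + (b 1 - a 1) * (v 1 - q 1) := by
      simp only [orient, e0, e1] at hv0 hq ⊢
      linear_combination hv0 + t * hq
    by_cases h0 : orient a b v = 0
    · rw [h0, mul_zero] at key
      apply hqX
      have h2 : (b 0 - a 0) * (v 1 - q 1) - (b 1 - a 1) * (v 0 - q 0) = 0 := by
        simp only [orient] at h0 hq
        linear_combination h0 - hq
      have h3 : ((b 0 - a 0) ^ 2 + (b 1 - a 1) ^ 2) * (v 0 - q 0) = 0 := by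
        linear_combination (-(b 0 - a 0)) * key - (b 1 - a 1) * h2
      have h4 : ((b 0 - a 0) ^ 2 + (b 1 - a 1) ^ 2) * (v 1 - q 1) = 0 := by
        linear_combination (-(b 1 - a 1)) * key + (b 0 - a 0) * h2
      have h5 := (mul_eq_zero.1 h3).resolve_left hL.ne'
      have h6 := (mul_eq_zero.1 h4).resolve_left hL.ne'
      have : v = q := by
        ext i
        fin_cases i
        · simp; linarith
        · simp; linarith
      rwa [← this]
    · exact ht ⟨v, hv, (div_eq_iff h0).2 key.symm⟩

end Rays

section Parity

theorem powersetCard_two_triple {α : Type*} [DecidableEq α] {x y z : α} (hxy : x ≠ y)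
    (hxz : x ≠ z) (hyz : y ≠ z) :
    ({x, y, z} : Finset α).powersetCard 2 = {{x, y}, {x, z}, {y, z}} := by
  ext e
  rw [Finset.mem_powersetCard]
  constructor
  · rintro ⟨h1, h2⟩
    obtain ⟨u, v, huv, rfl⟩ := Finset.card_eq_two.1 h2
    have hu : u ∈ ({x, y, z} : Finset α) := h1 (by simp)
    have hv : v ∈ ({x, y, z} : Finset α) := h1 (by simp)
    simp only [Finset.mem_insert, Finset.mem_singleton] at hu hv
    rcases hu with rfl | rfl | rfl <;> rcases hv with rfl | rfl | rfl <;>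
      simp_all [Finset.pair_comm]
  · simp only [Finset.mem_insert, Finset.mem_singleton]
    rintro (rfl | rfl | rfl)
    · exact ⟨by grind, Finset.card_pair hxy⟩
    · exact ⟨by grind, Finset.card_pair hxz⟩
    · exact ⟨by grind, Finset.card_pair hyz⟩

theorem card_filter_powersetCard_two {α : Type*} [DecidableEq α] {x y z : α} (hxy : x ≠ y)
    (hxz : x ≠ z) (hyz : y ≠ z) (H : Finset α → Prop) [DecidablePred H] :
    ((({x, y, z} : Finset α).powersetCard 2).filter H).card =
      (if H {x, y} then 1 else 0) + ((if H {x, z} then 1 else 0) +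
        (if H {y, z} then 1 else 0)) := by
  have h1 : ({x, y} : Finset α) ≠ {x, z} := fun h => by
    have : y ∈ ({x, z} : Finset α) := h ▸ by simp
    grind
  have h2 : ({x, y} : Finset α) ≠ {y, z} := fun h => by
    have : x ∈ ({y, z} : Finset α) := h ▸ by simp
    grind
  have h3 : ({x, z} : Finset α) ≠ {y, z} := fun h => by
    have : x ∈ ({y, z} : Finset α) := h ▸ by simp
    grind
  rw [powersetCard_two_triple hxy hxz hyz, Finset.card_filter, Finset.sum_insert (by simp [h1, h2]),
    Finset.sum_insert (by simp [h3]), Finset.sum_singleton]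

variable {X : Set Plane}

/-- Any set of edges has an even number of incidences with triangles. -/
theorem IsNearPseudomanifold.even_sum_card_edges (h : IsNearPseudomanifold X 2) {V : Finset Plane}
    (hV : (V : Set Plane) = X) (H : Finset Plane → Prop) :
    Even (∑ T ∈ (V.powersetCard 3).filter (IsNearClique X),
      ((T.powersetCard 2).filter H).card) := by
  have e1 : ∀ T ∈ (V.powersetCard 3).filter (IsNearClique X),
      ((T.powersetCard 2).filter H).card =
        (Finset.bipartiteAbove (fun T e => e ⊆ T)
          ((V.powersetCard 2).filter fun e => IsNearClique X e ∧ H e) T).card := by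
    intro T hT
    congr 1
    ext e
    rw [Finset.mem_filter, Finset.mem_powersetCard] at hT
    simp only [Finset.mem_filter, Finset.mem_powersetCard, Finset.bipartiteAbove]
    constructor
    · rintro ⟨⟨he, hc⟩, hH⟩
      exact ⟨⟨⟨he.trans hT.1.1, hc⟩, ⟨fun u hu => hT.2.1 (he hu),
        fun u hu v hv => hT.2.2 u (he hu) v (he hv)⟩, hH⟩, he⟩
    · rintro ⟨⟨⟨-, hc⟩, -, hH⟩, he⟩
      exact ⟨⟨he, hc⟩, hH⟩
  rw [Finset.sum_congr rfl e1, Finset.sum_card_bipartiteAbove_eq_sum_card_bipartiteBelow]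
  refine Finset.even_sum _ fun e he => ?_
  rw [Finset.mem_filter, Finset.mem_powersetCard] at he
  obtain ⟨⟨heV, hec⟩, heX, -⟩ := he
  have h2 := h.two e heX (Finset.card_pos.1 (by omega)) hec
  obtain ⟨v, w, hvw, hL⟩ := Set.ncard_eq_two.1 h2
  have hv : v ∈ nearLink X e := by simp [hL]
  have hw : w ∈ nearLink X e := by simp [hL]
  have heq : Finset.bipartiteBelow (fun T e => e ⊆ T)
      ((V.powersetCard 3).filter (IsNearClique X)) e = {insert v e, insert w e} := by
    ext T
    simp only [Finset.bipartiteBelow, Finset.mem_filter, Finset.mem_powersetCard,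
      Finset.mem_insert, Finset.mem_singleton]
    constructor
    · rintro ⟨⟨⟨hTV, hTc⟩, hTX⟩, heT⟩
      obtain ⟨p, hp, rfl⟩ := Finset.exists_eq_insert_iff.2 ⟨heT, by omega⟩
      have hT := isNearClique_insert.1 hTX
      have hpL : p ∈ nearLink X e := ⟨hT.1, hp, hT.2.1⟩
      rw [hL] at hpL
      rcases hpL with rfl | rfl
      · exact Or.inl rfl
      · exact Or.inr rfl
    · have mk : ∀ p ∈ nearLink X e, ((insert p e ⊆ V ∧ (insert p e).card = 3) ∧
          IsNearClique X (insert p e)) ∧ e ⊆ insert p e := by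
        intro p hp
        have hc : IsNearClique X (insert p e) :=
          isNearClique_insert.2 ⟨hp.1, hp.2.2, heX⟩
        refine ⟨⟨⟨fun u hu => ?_, ?_⟩, hc⟩, Finset.subset_insert p e⟩
        · have := hc.1 hu
          rwa [← hV] at this
        · rw [Finset.card_insert_of_notMem hp.2.1, hec]
      rintro (rfl | rfl)
      · exact mk v hv
      · exact mk w hw
  rw [heq, Finset.card_pair]
  · exact even_two
  · intro hins
    have : v ∈ insert w e := hins ▸ Finset.mem_insert_self v e
    rcases Finset.mem_insert.1 this with h | h
    · exact hvw h
    · exact hv.2.1 h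

/-- The triangles not containing the edge `a b` cover this edge, if the two triangles containing
it are on different sides. -/
theorem IsNearPseudomanifold.exists_triangle_of_mem_openSegment (h : IsNearPseudomanifold X 2)
    (hX : X.Finite) {a b c d q : Plane} (hc : NearTriangle X a b c) (hd : NearTriangle X a b d)
    (hL : ∀ v, NearTriangle X a b v → v = c ∨ v = d) (hc0 : 0 < orient a b c)
    (hd0 : orient a b d < 0) (hq : q ∈ openSegment ℝ a b) :
    ∃ x y z, NearTriangle X x y z ∧ q ∈ convexHull ℝ {x, y, z} ∧
      ¬((a = x ∨ a = y ∨ a = z) ∧ (b = x ∨ b = y ∨ b = z)) := by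
  by_contra hcon
  have hqs := openSegment_subset_segment ℝ a b hq
  have hq0 := orient_eq_zero_of_mem_segment hqs
  have hqX : q ∉ X := by
    intro hqX
    have hh : q ∈ convexHull ℝ {a, b, c} := segment_subset_convexHull (by simp) (by simp) hqs
    rcases h.eq_of_mem_convexHull hc hqX hh with rfl | rfl | rfl
    · exact hc.ne₁₂ (left_mem_openSegment_iff.1 hq)
    · exact hc.ne₁₂ (right_mem_openSegment_iff.1 hq)
    · exact hc0.ne' hq0
  obtain ⟨r, hr, hrX⟩ := exists_ray_avoiding hX hc.ne₁₂ hq0 hqX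
  have hV : (hX.toFinset : Set Plane) = X := hX.coe_toFinset
  obtain ⟨H, hH⟩ : ∃ H : Finset Plane → Prop, ∀ e, H e ↔ e ≠ {a, b} ∧
      ∃ s : ℝ, 0 ≤ s ∧ AffineMap.lineMap q r s ∈ convexHull ℝ (e : Set Plane) :=
    ⟨_, fun _ => Iff.rfl⟩
  have hHit : ∀ u v, H {u, v} ↔ ({u, v} : Finset Plane) ≠ {a, b} ∧ RayMeets q r u v := by
    intro u v
    simp only [hH, RayMeets, Finset.coe_pair, convexHull_pair]
  have hab : ¬H {a, b} := fun h => ((hH _).1 h).1 rfl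
  have hpair : ∀ u v w : Plane, w ≠ a → w ≠ b → (w = u ∨ w = v) →
      ({u, v} : Finset Plane) ≠ {a, b} := by
    intro u v w hwa hwb hw he
    have : w ∈ ({a, b} : Finset Plane) := he ▸ by simpa using hw
    simp only [Finset.mem_insert, Finset.mem_singleton] at this
    tauto
  have hsum := h.even_sum_card_edges hV H
  have hmem : ({a, b, c} : Finset Plane) ∈
      (hX.toFinset.powersetCard 3).filter (IsNearClique X) := by
    rw [Finset.mem_filter, Finset.mem_powersetCard]
    refine ⟨⟨fun u hu => ?_, Finset.card_eq_three.2 ⟨a, b, c, hc.ne₁₂, hc.ne₁₃, hc.ne₂₃, rfl⟩⟩,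
      hc.isNearClique⟩
    rw [Set.Finite.mem_toFinset]
    exact hc.isNearClique.1 hu
  rw [← Finset.add_sum_erase _ _ hmem] at hsum
  have hodd : ((({a, b, c} : Finset Plane).powersetCard 2).filter H).card = 1 := by
    rw [card_filter_powersetCard_two hc.ne₁₂ hc.ne₁₃ hc.ne₂₃, if_neg hab]
    have h1 : H {a, c} ↔ RayMeets q r a c := by
      rw [hHit]
      exact and_iff_right (hpair a c c hc.ne₁₃.symm hc.ne₂₃.symm (Or.inr rfl))
    have h2 : H {b, c} ↔ RayMeets q r b c := by
      rw [hHit]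
      exact and_iff_right (hpair b c c hc.ne₁₃.symm hc.ne₂₃.symm (Or.inr rfl))
    rcases rayMeets_of_mem_openSegment hq hr hc0 (hrX a hc.mem₁) (hrX c hc.mem₃) with
      ⟨k1, k2⟩ | ⟨k1, k2⟩
    · rw [if_pos (h1.2 k1), if_neg (mt h2.1 k2)]
    · rw [if_neg (mt h1.1 k1), if_pos (h2.2 k2)]
  have heven : Even (∑ T ∈ ((hX.toFinset.powersetCard 3).filter (IsNearClique X)).erase {a, b, c},
      ((T.powersetCard 2).filter H).card) := by
    refine Finset.even_sum _ fun T hT => ?_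
    rw [Finset.mem_erase, Finset.mem_filter, Finset.mem_powersetCard] at hT
    obtain ⟨hTne, ⟨-, hTc⟩, hTX⟩ := hT
    by_cases hTab : a ∈ T ∧ b ∈ T
    · obtain ⟨v, hv, hTv⟩ : ∃ v ∉ ({a, b} : Finset Plane), insert v {a, b} = T := by
        refine Finset.exists_eq_insert_iff.2 ⟨?_, ?_⟩
        · simpa [Finset.insert_subset_iff] using hTab
        · rw [Finset.card_pair hc.ne₁₂, hTc]
      simp only [Finset.mem_insert, Finset.mem_singleton, not_or] at hv
      have hT' : T = {a, b, v} := by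
        rw [← hTv]
        ext u
        simp only [Finset.mem_insert, Finset.mem_singleton]
        tauto
      have hvT : v ∈ T := by simp [hT']
      obtain rfl : v = d := by
        refine (hL v (hTX.nearTriangle hTab.1 hTab.2 hvT hc.ne₁₂ (Ne.symm hv.1)
          (Ne.symm hv.2))).resolve_left ?_
        rintro rfl
        exact hTne hT'
      have k1 := not_rayMeets_of_opposite_side hq0 hr hd0 (orient_left a b) (hrX a hc.mem₁)
      have k2 := not_rayMeets_of_opposite_side hq0 hr hd0 (orient_right a b) (hrX b hc.mem₂)
      rw [hT', card_filter_powersetCard_two hd.ne₁₂ hd.ne₁₃ hd.ne₂₃, if_neg hab,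
        if_neg fun h => k1 ((hHit _ _).1 h).2, if_neg fun h => k2 ((hHit _ _).1 h).2]
      exact Even.zero
    · obtain ⟨x, y, z, hxy, hxz, hyz, rfl⟩ := Finset.card_eq_three.1 hTc
      have ht := hTX.nearTriangle (x := x) (y := y) (z := z) (by simp) (by simp) (by simp)
        hxy hxz hyz
      have hqT : q ∉ convexHull ℝ {x, y, z} := fun hqT =>
        hcon ⟨x, y, z, ht, hqT, by simpa using hTab⟩
      have hHit' : ∀ u v, u ∈ ({x, y, z} : Finset Plane) → v ∈ ({x, y, z} : Finset Plane) →
          (H {u, v} ↔ RayMeets q r u v) := by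
        intro u v hu hv
        rw [hHit]
        refine and_iff_right fun he => hTab ?_
        have hsub : ({u, v} : Finset Plane) ⊆ {x, y, z} := by
          intro w hw
          rcases Finset.mem_insert.1 hw with rfl | hw
          · exact hu
          · rwa [Finset.mem_singleton.1 hw]
        exact ⟨hsub (he ▸ by simp), hsub (he ▸ by simp)⟩
      have k1 := hHit' x y (by simp) (by simp)
      have k2 := hHit' x z (by simp) (by simp)
      have k3 := hHit' y z (by simp) (by simp)
      rw [card_filter_powersetCard_two hxy hxz hyz]
      simp only [k1, k2, k3]
      rcases rayMeets_even hqT (hrX x ht.mem₁) (hrX y ht.mem₂) (hrX z ht.mem₃) with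
        ⟨m1, m2⟩ | ⟨m1, m2⟩ | ⟨m1, m2⟩
      · by_cases m : RayMeets q r x z <;> simp [m1, m2, m]
      · by_cases m : RayMeets q r y z <;> simp [m1, m2, m]
      · by_cases m : RayMeets q r y z <;> simp [m1, m2, m]
  rw [hodd, Nat.even_add] at hsum
  exact absurd (hsum.2 heven) (by decide)

end Parity

section LongestEdge

variable {X : Set Plane} {a b c d : Plane}

/-- The two triangles containing a longest edge are on different sides of it. -/
theorem IsNearPseudomanifold.exists_longest_edge (h : IsNearPseudomanifold X 2) (hX : X.Finite) :
    ∃ a b c d, NearTriangle X a b c ∧ NearTriangle X a b d ∧ 1 ≤ dist c d ∧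
      (∀ v, NearTriangle X a b v → v = c ∨ v = d) ∧ 0 < orient a b c ∧ orient a b d < 0 := by
  have hE : ((hX.toFinset ×ˢ hX.toFinset).filter
      fun p => p.1 ≠ p.2 ∧ dist p.1 p.2 < 1).Nonempty := by
    obtain ⟨t, ht, -, htc⟩ := h.pure ∅ (isNearClique_empty X)
    obtain ⟨x, y, z, hxy, -, -, rfl⟩ := Finset.card_eq_three.1 htc
    refine ⟨(x, y), ?_⟩
    simp only [Finset.mem_filter, Finset.mem_product, Set.Finite.mem_toFinset]
    exact ⟨⟨ht.1 (by simp), ht.1 (by simp)⟩, hxy, ht.2 x (by simp) y (by simp)⟩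
  obtain ⟨⟨a, b⟩, hab, hmax⟩ := Finset.exists_max_image _ (fun p => dist p.1 p.2) hE
  simp only [Finset.mem_filter, Finset.mem_product, Set.Finite.mem_toFinset, and_imp,
    Prod.forall] at hab hmax
  obtain ⟨⟨ha, hb⟩, hne, hlt⟩ := hab
  have hcl : IsNearClique X {a, b} := by
    refine ⟨?_, ?_⟩
    · intro v hv
      simp only [Finset.coe_insert, Finset.coe_singleton, Set.mem_insert_iff,
        Set.mem_singleton_iff] at hv
      rcases hv with rfl | rfl <;> assumption
    · simpa [dist_comm b a] using hlt
  obtain ⟨c, d, hcd, hL⟩ := Set.ncard_eq_two.1 (h.two _ hcl (by simp) (Finset.card_pair hne))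
  have hmem : ∀ v, v ∈ nearLink X {a, b} ↔ NearTriangle X a b v := by
    intro v
    simp only [nearLink, Finset.mem_insert, Finset.mem_singleton, not_or, forall_eq_or_imp,
      forall_eq, Set.mem_ofPred_eq]
    exact ⟨fun h => ⟨ha, hb, h.1, hne, Ne.symm h.2.1.1, Ne.symm h.2.1.2, hlt, h.2.2.1, h.2.2.2⟩,
      fun h => ⟨h.mem₃, ⟨h.ne₁₃.symm, h.ne₂₃.symm⟩, h.near₁₃, h.near₂₃⟩⟩
  have hall : ∀ v, NearTriangle X a b v → v = c ∨ v = d := fun v hv => by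
    rw [← hmem, hL] at hv
    simpa using hv
  have hc : NearTriangle X a b c := (hmem c).1 (by simp [hL])
  have hd : NearTriangle X a b d := (hmem d).1 (by simp [hL])
  have hfar : 1 ≤ dist c d := by
    by_contra hcon
    rcases h.eq_of_near hc hd.mem₃ hd.near₁₃ hd.near₂₃ (not_le.1 hcon) with e | e | e
    · exact hd.ne₁₃ e.symm
    · exact hd.ne₂₃ e.symm
    · exact hcd e.symm
  have hside : orient a b c * orient a b d < 0 := by
    by_contra hcon
    have := dist_le_of_same_side (hmax a c ha hc.mem₃ hc.ne₁₃ hc.near₁₃)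
      (hmax b c hb hc.mem₃ hc.ne₂₃ hc.near₂₃) (hmax a d ha hd.mem₃ hd.ne₁₃ hd.near₁₃)
      (hmax b d hb hd.mem₃ hd.ne₂₃ hd.near₂₃) (not_lt.1 hcon)
    linarith
  rcases mul_neg_iff.1 hside with ⟨h1, h2⟩ | ⟨h1, h2⟩
  · exact ⟨a, b, c, d, hc, hd, hfar, hall, h1, h2⟩
  · exact ⟨a, b, d, c, hd, hc, by rwa [dist_comm], fun v hv => (hall v hv).symm, h2, h1⟩

/-- The union of the triangles with vertex `a` which do not have the vertex `b`. -/
def starAvoiding (X : Set Plane) (a b : Plane) : Set Plane :=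
  ⋃ p ∈ {p : Plane × Plane | NearTriangle X a p.1 p.2 ∧ b ≠ p.1 ∧ b ≠ p.2},
    convexHull ℝ {a, p.1, p.2}

theorem mem_starAvoiding {q : Plane} : q ∈ starAvoiding X a b ↔
    ∃ s t, (NearTriangle X a s t ∧ b ≠ s ∧ b ≠ t) ∧ q ∈ convexHull ℝ {a, s, t} := by
  simp only [starAvoiding, Set.mem_iUnion, Set.mem_ofPred_eq, Prod.exists, exists_prop]

theorem isClosed_starAvoiding (hX : X.Finite) : IsClosed (starAvoiding X a b) := by
  refine Set.Finite.isClosed_biUnion ((hX.prod hX).subset fun p hp => ?_) fun p _ => ?_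
  · exact ⟨hp.1.mem₂, hp.1.mem₃⟩
  · exact (Set.Finite.isCompact_convexHull ℝ (Set.toFinite _)).isClosed

theorem IsNearPseudomanifold.notMem_starAvoiding (h : IsNearPseudomanifold X 2) (hb : b ∈ X)
    (hab : a ≠ b) : b ∉ starAvoiding X a b := by
  rw [mem_starAvoiding]
  rintro ⟨s, t, ⟨ht, hs1, hs2⟩, hmem⟩
  rcases h.eq_of_mem_convexHull ht hb hmem with e | e | e
  · exact hab e.symm
  · exact hs1 e
  · exact hs2 e

theorem IsNearPseudomanifold.openSegment_subset_union (h : IsNearPseudomanifold X 2)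
    (hX : X.Finite) (hA : ¬HasAntipodes X) (hc : NearTriangle X a b c)
    (hd : NearTriangle X a b d) (hcd : 1 ≤ dist c d)
    (hL : ∀ v, NearTriangle X a b v → v = c ∨ v = d) (hc0 : 0 < orient a b c)
    (hd0 : orient a b d < 0) :
    openSegment ℝ a b ⊆ starAvoiding X a b ∪ starAvoiding X b a := by
  intro q hq
  obtain ⟨x, y, z, ht, hqT, hnot⟩ :=
    h.exists_triangle_of_mem_openSegment hX hc hd hL hc0 hd0 hq
  have e1 : ({x, y, z} : Set Plane) = {y, z, x} := by
    rw [Set.insert_comm x y, Set.pair_comm x z]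
  have e2 : ({x, y, z} : Set Plane) = {z, x, y} := by
    rw [Set.pair_comm y z, Set.insert_comm x z]
  have star : ∀ e f : Plane, (e = x ∨ e = y ∨ e = z) → ¬(f = x ∨ f = y ∨ f = z) →
      q ∈ starAvoiding X e f := by
    intro e f he hf
    rw [mem_starAvoiding]
    rcases he with rfl | rfl | rfl
    · exact ⟨y, z, ⟨ht, by tauto, by tauto⟩, hqT⟩
    · exact ⟨z, x, ⟨ht.rotate, by tauto, by tauto⟩, e1 ▸ hqT⟩
    · exact ⟨x, y, ⟨ht.rotate.rotate, by tauto, by tauto⟩, e2 ▸ hqT⟩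
  by_cases ha : a = x ∨ a = y ∨ a = z
  · exact Or.inl (star a b ha fun hb => hnot ⟨ha, hb⟩)
  by_cases hb : b = x ∨ b = y ∨ b = z
  · exact Or.inr (star b a hb ha)
  exfalso
  have pair : ∀ e, NearTriangle X a b e → ¬(e = x ∨ e = y ∨ e = z) → False := by
    intro e he hne
    simp only [not_or] at ha hb hne
    exact hA (TrianglePair.hasAntipodes h ⟨he, ht, ha, hb, hne⟩
      (openSegment_subset_segment ℝ a b hq) hqT)
  have hcT : c = x ∨ c = y ∨ c = z := not_not.1 (pair c hc)
  have hdT : d = x ∨ d = y ∨ d = z := not_not.1 (pair d hd)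
  have := ht.isNearClique.2 c (by simpa using hcT) d (by simpa using hdT)
  linarith

/-- Some point of the edge `a b` lies in triangles containing only one of `a` and `b`, for both
choices of the latter. -/
theorem IsNearPseudomanifold.exists_mem_starAvoiding (h : IsNearPseudomanifold X 2)
    (hX : X.Finite) (ha : a ∈ X) (hb : b ∈ X) (hab : a ≠ b)
    (hsub : openSegment ℝ a b ⊆ starAvoiding X a b ∪ starAvoiding X b a) :
    ∃ q ∈ openSegment ℝ a b, q ∈ starAvoiding X a b ∧ q ∈ starAvoiding X b a := by
  have hseg : ∀ {e f g : Plane}, openSegment ℝ a b ⊆ starAvoiding X e f →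
      g ∈ segment ℝ a b → g ∈ starAvoiding X e f := by
    intro e f g hs hg
    rw [← closure_openSegment] at hg
    exact closure_minimal hs (isClosed_starAvoiding hX) hg
  refine isPreconnected_closed_iff.1 (convex_openSegment a b).isPreconnected _ _
    (isClosed_starAvoiding hX) (isClosed_starAvoiding hX) hsub ?_ ?_
  · by_contra hcon
    refine h.notMem_starAvoiding ha hab.symm (hseg (fun q hq => ?_) (left_mem_segment ℝ a b))
    exact (hsub hq).resolve_left fun hqa => hcon ⟨q, hq, hqa⟩
  · by_contra hcon
    refine h.notMem_starAvoiding hb hab (hseg (fun q hq => ?_) (right_mem_segment ℝ a b))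
    exact (hsub hq).resolve_right fun hqa => hcon ⟨q, hq, hqa⟩

/-- The line from `a` to `b` leaves a triangle at `a` through the opposite edge. -/
theorem IsNearPseudomanifold.exists_exit (h : IsNearPseudomanifold X 2) {s t : Plane} {τ : ℝ}
    (ht : NearTriangle X a s t) (hb : b ∈ X) (hab : a ≠ b) (hbs : b ≠ s) (hbt : b ≠ t)
    (hτ : 0 < τ) (hτ1 : τ < 1) (hq : AffineMap.lineMap a b τ ∈ convexHull ℝ {a, s, t}) :
    ∃ μ : ℝ, τ ≤ μ ∧ μ < 1 ∧ AffineMap.lineMap a b μ ∈ segment ℝ s t := by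
  obtain ⟨m, hm, hqm⟩ := exists_mem_segment_of_mem_convexHull hq
  rw [segment_eq_image_lineMap] at hqm
  obtain ⟨σ, hσ, hqm⟩ := hqm
  have hσ0 : σ ≠ 0 := by
    rintro rfl
    rw [AffineMap.lineMap_apply_zero, eq_comm, AffineMap.lineMap_eq_left_iff] at hqm
    rcases hqm with e | e
    · exact hab e
    · exact hτ.ne' e
  have h0 := orient_lineMap_self a b τ
  rw [← hqm, orient_lineMap, orient_left, mul_zero, zero_add] at h0
  obtain ⟨μ, rfl⟩ := exists_lineMap_of_orient_eq_zero hab ((mul_eq_zero.1 h0).resolve_left hσ0)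
  rw [AffineMap.lineMap_lineMap_right] at hqm
  have hστ := AffineMap.lineMap_injective ℝ hab hqm
  have hσpos : 0 < σ := lt_of_le_of_ne hσ.1 hσ0.symm
  have hμ : 0 < μ := pos_of_mul_pos_right (hστ.symm ▸ hτ) hσpos.le
  have hτμ : τ ≤ μ := by
    rw [← hστ]
    exact mul_le_of_le_one_left hμ.le hσ.2
  refine ⟨μ, hτμ, ?_, hm⟩
  by_contra hcon
  have h1 : (1 : ℝ) ∈ {r : ℝ | AffineMap.lineMap a b r ∈ convexHull ℝ {a, s, t}} :=
    (ordConnected_lineMap_preimage (convex_convexHull ℝ {a, s, t}) a b).out hq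
      (segment_subset_convexHull (by simp) (by simp) hm) ⟨hτ1.le, not_lt.1 hcon⟩
  have hbT : b ∈ convexHull ℝ {a, s, t} := by simpa using h1
  rcases h.eq_of_mem_convexHull ht hb hbT with e | e | e
  · exact hab e.symm
  · exact hbs e
  · exact hbt e

theorem IsNearPseudomanifold.false_of_mem_convexHull (h : IsNearPseudomanifold X 2)
    {t m : Plane} (hd : NearTriangle X a b d) (hcd : 1 ≤ dist c d) (htX : t ∈ X)
    (hct : dist c t < 1) (htb : 1 ≤ dist t b) (hta : t ≠ a) (hm : m ∈ segment ℝ c t)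
    (hmc : m ≠ c) (hmab : m ∈ segment ℝ a b) (hmH : m ∈ convexHull ℝ {c, d, b}) : False := by
  obtain ⟨r, hr, hmr⟩ := exists_mem_segment_of_mem_convexHull hmH
  have hrH : r ∈ convexHull ℝ {a, b, d} := segment_subset_convexHull (by simp) (by simp) hr
  rw [segment_eq_image_lineMap] at hm hmr
  obtain ⟨σ, hσ, hm⟩ := hm
  obtain ⟨ρ, hρ, hmr⟩ := hmr
  have hσ0 : 0 < σ := lt_of_le_of_ne hσ.1 fun e => hmc (by rw [← hm, ← e]; simp)
  have hρ0 : 0 < ρ := lt_of_le_of_ne hρ.1 fun e => hmc (by rw [← hmr, ← e]; simp)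
  have hvec : σ • (t - c) = ρ • (r - c) := by
    have := hm.trans hmr.symm
    rw [AffineMap.lineMap_apply_module', AffineMap.lineMap_apply_module'] at this
    exact add_right_cancel this
  rcases le_total σ ρ with hle | hle
  · have hrt : r ∈ segment ℝ c t := by
      rw [segment_eq_image_lineMap]
      refine ⟨σ / ρ, ⟨by positivity, (div_le_one hρ0).2 hle⟩, ?_⟩
      rw [AffineMap.lineMap_apply_module', div_eq_inv_mul, mul_smul, hvec, smul_smul,
        inv_mul_cancel₀ hρ0.ne', one_smul, sub_add_cancel]
    have hmeet : SegMeet c t d b := ⟨r, hrt, hr⟩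
    have hdb : dist d b < 1 := by
      rw [dist_comm]
      exact hd.near₂₃
    rcases hmeet.near hct hdb with k | k | k | k <;> linarith [k.1, k.2]
  · have htr : AffineMap.lineMap c r (ρ / σ) = t := by
      rw [AffineMap.lineMap_apply_module', div_eq_inv_mul, mul_smul, ← hvec, smul_smul,
        inv_mul_cancel₀ hσ0.ne', one_smul, sub_add_cancel]
    have htH : ρ / σ ∈ {s : ℝ | AffineMap.lineMap c r s ∈ convexHull ℝ {a, b, d}} := by
      refine (ordConnected_lineMap_preimage (convex_convexHull ℝ {a, b, d}) c r).out
        (x := ρ) (y := 1) ?_ ?_ ⟨?_, (div_le_one hσ0).2 hle⟩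
      · simp only [Set.mem_ofPred_eq, hmr]
        exact segment_subset_convexHull (by simp) (by simp) hmab
      · simpa using hrH
      · exact le_div_self hρ0.le hσ0 hσ.2
    simp only [Set.mem_ofPred_eq, htr] at htH
    rcases h.eq_of_mem_convexHull hd htX htH with e | e | e
    · exact hta e
    · rw [e, dist_self] at htb
      linarith
    · rw [e] at hct
      linarith

theorem IsNearPseudomanifold.false_of_common_vertex (h : IsNearPseudomanifold X 2)
    {t z : Plane} {μ ν : ℝ} (hc : NearTriangle X a b c) (hd : NearTriangle X a b d)
    (hcd : 1 ≤ dist c d) (hside : orient a b c * orient a b d < 0)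
    (ht : NearTriangle X a c t) (hbt : b ≠ t) (hz : NearTriangle X b c z) (haz : a ≠ z)
    (hν : 0 < ν) (hνμ : ν ≤ μ) (hμ : μ < 1) (hm : AffineMap.lineMap a b μ ∈ segment ℝ c t)
    (hm' : AffineMap.lineMap a b ν ∈ segment ℝ c z) : False := by
  obtain ⟨k, hk, hk0⟩ := exists_mem_segment_orient_eq_zero hside
  obtain ⟨κ, rfl⟩ := exists_lineMap_of_orient_eq_zero hc.ne₁₂ hk0
  have hne : ∀ s : ℝ, AffineMap.lineMap a b s ≠ c := by
    intro s e
    have := orient_lineMap_self a b s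
    rw [e] at this
    rw [this, zero_mul] at hside
    exact lt_irrefl _ hside
  have hseg : ∀ s : ℝ, 0 ≤ s → s ≤ 1 → AffineMap.lineMap a b s ∈ segment ℝ a b := by
    intro s h0 h1
    rw [segment_eq_image_lineMap]
    exact ⟨s, ⟨h0, h1⟩, rfl⟩
  rcases le_or_gt κ μ with hκ | hκ
  · have hmH : μ ∈ {s : ℝ | AffineMap.lineMap a b s ∈ convexHull ℝ {c, d, b}} := by
      refine (ordConnected_lineMap_preimage (convex_convexHull ℝ {c, d, b}) a b).out
        (x := κ) (y := 1) (segment_subset_convexHull (by simp) (by simp) hk) ?_ ⟨hκ, hμ.le⟩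
      simpa using subset_convexHull ℝ {c, d, b} (by simp)
    have htb : 1 ≤ dist t b := by
      by_contra hcon
      rcases h.eq_of_near ht hc.mem₂ hc.near₁₂ (by rw [dist_comm]; exact hc.near₂₃)
        (not_le.1 hcon) with e | e | e
      · exact hc.ne₁₂ e.symm
      · exact hc.ne₂₃ e
      · exact hbt e
    exact h.false_of_mem_convexHull hd hcd ht.mem₃ ht.near₂₃ htb ht.ne₁₃.symm hm (hne μ)
      (hseg μ (by linarith) hμ.le) hmH
  · have hmH : ν ∈ {s : ℝ | AffineMap.lineMap a b s ∈ convexHull ℝ {c, d, a}} := by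
      refine (ordConnected_lineMap_preimage (convex_convexHull ℝ {c, d, a}) a b).out
        (x := 0) (y := κ) ?_ (segment_subset_convexHull (by simp) (by simp) hk)
        ⟨hν.le, by linarith⟩
      simpa using subset_convexHull ℝ {c, d, a} (by simp)
    have hza : 1 ≤ dist z a := by
      by_contra hcon
      rcases h.eq_of_near hz hc.mem₁ (by rw [dist_comm]; exact hc.near₁₂)
        (by rw [dist_comm]; exact hc.near₁₃) (not_le.1 hcon) with e | e | e
      · exact hc.ne₁₂ e
      · exact hc.ne₁₃ e
      · exact haz e
    exact h.false_of_mem_convexHull hd.swap hcd hz.mem₃ hz.near₂₃ hza hz.ne₁₃.symm hm' (hne ν)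
      (by rw [segment_symm]; exact hseg ν hν.le (by linarith)) hmH

/-- A planar Rips complex which is a normal surface is an octahedron. -/
theorem IsNearPseudomanifold.hasAntipodes_of_plane (h : IsNearPseudomanifold X 2)
    (hX : X.Finite) : HasAntipodes X := by
  by_contra hA
  obtain ⟨a, b, c, d, hc, hd, hcd, hL, hc0, hd0⟩ := h.exists_longest_edge hX
  obtain ⟨q, hq, hqa, hqb⟩ := h.exists_mem_starAvoiding hX hc.mem₁ hc.mem₂ hc.ne₁₂
    (h.openSegment_subset_union hX hA hc hd hcd hL hc0 hd0)
  obtain ⟨s, t, ⟨hst, hbs, hbt⟩, hqs⟩ := mem_starAvoiding.1 hqa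
  obtain ⟨y, z, ⟨hyz, hay, haz⟩, hqy⟩ := mem_starAvoiding.1 hqb
  rw [openSegment_eq_image_lineMap] at hq
  obtain ⟨τ, hτ, rfl⟩ := hq
  obtain ⟨μ, hτμ, hμ, hm⟩ := h.exists_exit hst hc.mem₂ hc.ne₁₂ hbs hbt hτ.1 hτ.2 hqs
  rw [← AffineMap.lineMap_apply_one_sub] at hqy
  obtain ⟨ν, hτν, hν, hm'⟩ := h.exists_exit hyz hc.mem₁ hc.ne₁₂.symm hay haz
    (by linarith [hτ.2]) (by linarith [hτ.1]) hqy
  rw [← AffineMap.lineMap_apply_one_sub] at hm'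
  rw [AffineMap.lineMap_apply_one_sub] at hqy
  have common : ∀ e t z, NearTriangle X a e t → b ≠ e → b ≠ t → NearTriangle X b e z → a ≠ z →
      AffineMap.lineMap a b μ ∈ segment ℝ e t →
      AffineMap.lineMap a b (1 - ν) ∈ segment ℝ e z → False := by
    intro e t z ht hbe hbt hz haz hm hm'
    have he : NearTriangle X a b e := ⟨hc.mem₁, hc.mem₂, ht.mem₂, hc.ne₁₂, ht.ne₁₂, hbe,
      hc.near₁₂, ht.near₁₂, hz.near₁₂⟩
    rcases hL e he with rfl | rfl
    · exact h.false_of_common_vertex hc hd hcd (mul_neg_of_pos_of_neg hc0 hd0) ht hbt hz haz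
        (by linarith) (by linarith) hμ hm hm'
    · exact h.false_of_common_vertex hd hc (by rwa [dist_comm]) (mul_neg_of_neg_of_pos hd0 hc0)
        ht hbt hz haz (by linarith) (by linarith) hμ hm hm'
  have hst' : NearTriangle X a t s := hst.rotate.rotate.swap
  have hyz' : NearTriangle X b z y := hyz.rotate.rotate.swap
  have n1 : s ≠ y := by
    rintro rfl
    exact common s t z hst hbs hbt hyz haz hm hm'
  have n2 : s ≠ z := by
    rintro rfl
    exact common s t y hst hbs hbt hyz' hay hm (by rwa [segment_symm])
  have n3 : t ≠ y := by
    rintro rfl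
    exact common t s z hst' hbt hbs hyz haz (by rwa [segment_symm]) hm'
  have n4 : t ≠ z := by
    rintro rfl
    exact common t s y hst' hbt hbs hyz' hay (by rwa [segment_symm]) (by rwa [segment_symm])
  refine hA (TrianglePair.hasAntipodes h ⟨hst.rotate, hyz, ⟨hbs.symm, n1, n2⟩,
    ⟨hbt.symm, n3, n4⟩, ⟨hc.ne₁₂, hay, haz⟩⟩ hm ?_)
  refine (ordConnected_lineMap_preimage (convex_convexHull ℝ {b, y, z}) a b).out hqy
    (y := 1) ?_ ⟨hτμ, hμ.le⟩
  simpa using subset_convexHull ℝ {b, y, z} (by simp)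

end LongestEdge

section RipsFaces

variable {X : Set (EuclideanSpace ℝ (Fin 2))}

theorem mem_ripsFaces {s : Finset (EuclideanSpace ℝ (Fin 2))} :
    s ∈ ripsFaces X ↔ s.Nonempty ∧ IsNearClique X s := by
  refine and_congr_right fun hne => and_congr_right fun _ => ⟨fun h u hu v hv => ?_, fun h => ?_⟩
  · exact (Metric.dist_le_diam_of_mem s.finite_toSet.isBounded hu hv).trans_lt h
  · obtain ⟨⟨p, q⟩, hpq, hmax⟩ := (s ×ˢ s).exists_max_image (fun p => dist p.1 p.2)
      (hne.product hne)
    rw [Finset.mem_product] at hpq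
    refine (Metric.diam_le_of_forall_dist_le dist_nonneg fun u hu v hv => ?_).trans_lt
      (h p hpq.1 q hpq.2)
    exact hmax (u, v) (Finset.mem_product.2 ⟨hu, hv⟩)

theorem isNearClique_pair {u v : EuclideanSpace ℝ (Fin 2)} :
    IsNearClique X {u, v} ↔ u ∈ X ∧ v ∈ X ∧ dist u v < 1 := by
  rw [isNearClique_insert, ← insert_empty_eq, isNearClique_insert]
  simp [isNearClique_empty, dist_comm v u]
  tauto

theorem vertexSet_ripsFaces : vertexSet (ripsFaces X) = X := by
  ext v
  have : ({v} : Finset (EuclideanSpace ℝ (Fin 2))) ∈ ripsFaces X ↔ v ∈ X := by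
    rw [mem_ripsFaces, ← insert_empty_eq, isNearClique_insert]
    simp [isNearClique_empty]
  exact this

theorem vertexSet_complexLink_ripsFaces {s : Finset (EuclideanSpace ℝ (Fin 2))}
    (hs : IsNearClique X s) : vertexSet (complexLink (ripsFaces X) s) = nearLink X s := by
  ext v
  have : ({v} : Finset (EuclideanSpace ℝ (Fin 2))) ∈ complexLink (ripsFaces X) s ↔
      v ∈ X ∧ v ∉ s ∧ ∀ u ∈ s, dist u v < 1 := by
    have h2 : s ∪ {v} = insert v s := by ext; simp
    change ({v} : Finset _).Nonempty ∧ Disjoint s {v} ∧ s ∪ {v} ∈ ripsFaces X ↔ _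
    rw [h2, mem_ripsFaces, isNearClique_insert]
    simp [hs]
    tauto
  exact this

theorem nearConnected_of_isConnectedComplex {F : Set (Finset (EuclideanSpace ℝ (Fin 2)))}
    {Y : Set (EuclideanSpace ℝ (Fin 2))} (hF : IsConnectedComplex F) (hY : vertexSet F = Y)
    (hE : ∀ u v, {u, v} ∈ F → u ∈ Y ∧ v ∈ Y ∧ dist u v < 1) : NearConnected Y := by
  rw [IsConnectedComplex, hY] at hF
  exact ⟨hF.1, fun u hu w hw => (hF.2 u hu w hw).lift id fun x y hxy => hE x y hxy.2⟩

theorem IsNormalPseudomanifold.isNearPseudomanifold {d : ℕ}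
    (h : IsNormalPseudomanifold (ripsFaces X) d) : IsNearPseudomanifold X d := by
  obtain ⟨⟨hpure, hcard⟩, hconn, htwo, hlink⟩ := h
  have hX : NearConnected X := nearConnected_of_isConnectedComplex hconn vertexSet_ripsFaces
    fun u v huv => isNearClique_pair.1 (mem_ripsFaces.1 huv).2
  refine ⟨fun s hs => ?_, fun s hs => ?_, hX, fun s hs hne hsc => ?_, fun s hs hne hsc => ?_⟩
  · obtain ⟨r, hr, hsr⟩ : ∃ r ∈ ripsFaces X, s ⊆ r := by
      rcases s.eq_empty_or_nonempty with rfl | hne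
      · obtain ⟨x, hx⟩ := hX.1
        refine ⟨{x, x}, mem_ripsFaces.2 ⟨by simp, isNearClique_pair.2 ⟨hx, hx, by simp⟩⟩,
          by simp⟩
      · exact ⟨s, mem_ripsFaces.2 ⟨hne, hs⟩, subset_rfl⟩
    obtain ⟨t, ht, hrt, htc⟩ := hpure r hr
    exact ⟨t, (mem_ripsFaces.1 ht).2, hsr.trans hrt, htc⟩
  · rcases s.eq_empty_or_nonempty with rfl | hne
    · simp
    · exact hcard s (mem_ripsFaces.2 ⟨hne, hs⟩)
  · refine Eq.trans ?_ (htwo s (mem_ripsFaces.2 ⟨hne, hs⟩) hsc)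
    have hinj : Set.InjOn (fun v => insert v s) (nearLink X s) := by
      intro u hu v hv huv
      have : u ∈ insert v s := by
        rw [← show insert u s = insert v s from huv]; simp
      exact (Finset.mem_insert.1 this).resolve_right hu.2.1
    rw [← hinj.ncard_image]
    congr 1
    ext t
    constructor
    · rintro ⟨v, ⟨hvX, hvs, hv⟩, rfl⟩
      exact ⟨mem_ripsFaces.2 ⟨by simp, isNearClique_insert.2 ⟨hvX, hv, hs⟩⟩,
        Finset.subset_insert _ _, by rw [Finset.card_insert_of_notMem hvs, hsc]⟩
    · rintro ⟨ht, hst, htc⟩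
      obtain ⟨v, hv, hvs⟩ := Finset.exists_mem_notMem_of_card_lt_card (s := s) (t := t) (by omega)
      have hins : insert v s = t := Finset.eq_of_subset_of_card_le
        (Finset.insert_subset hv hst) (by rw [Finset.card_insert_of_notMem hvs]; omega)
      subst hins
      obtain ⟨h1, h2, -⟩ := isNearClique_insert.1 (mem_ripsFaces.1 ht).2
      exact ⟨v, ⟨h1, hvs, h2⟩, rfl⟩
  · refine nearConnected_of_isConnectedComplex (hlink s (mem_ripsFaces.2 ⟨hne, hs⟩) hsc)
      (vertexSet_complexLink_ripsFaces hs) ?_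
    rintro u v ⟨-, hdisj, huv⟩
    have hc := (mem_ripsFaces.1 huv).2
    have hmem : ∀ z, z ∈ ({u, v} : Finset (EuclideanSpace ℝ (Fin 2))) → z ∈ nearLink X s :=
      fun z hz => ⟨hc.1 (by simp only [Finset.coe_union]; exact Or.inr hz),
        Finset.disjoint_right.1 hdisj hz,
        fun w hw => hc.2 w (Finset.mem_union_left _ hw) z (Finset.mem_union_right _ hz)⟩
    exact ⟨hmem u (by simp), hmem v (by simp), hc.2 u (by simp) v (by simp)⟩

/-- A Rips complex of dimension `d` in which every vertex has exactly one non-neighbour is a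
crosspolytope boundary. -/
theorem complexIso_crossPolytopeBoundary {d : ℕ} (h : IsNearPseudomanifold X d)
    (ha : HasAntipodes X) : ComplexIso (ripsFaces X) (crossPolytopeBoundary d) := by
  obtain ⟨T, hT, -, hTc⟩ := h.pure ∅ (isNearClique_empty X)
  have hex : ∀ x, ∃ y, x ∈ X → (y ∈ X ∧ 1 ≤ dist x y) ∧
      ∀ z ∈ X, 1 ≤ dist x z → z = y := by
    intro x
    by_cases hx : x ∈ X
    · obtain ⟨y, hy, hu⟩ := ha x hx
      exact ⟨y, fun _ => ⟨hy, fun z hz hxz => hu z ⟨hz, hxz⟩⟩⟩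
    · exact ⟨x, fun h => absurd h hx⟩
  choose o ho using hex
  have hoX : ∀ x ∈ X, o x ∈ X := fun x hx => (ho x hx).1.1
  have hofar : ∀ x ∈ X, 1 ≤ dist x (o x) := fun x hx => (ho x hx).1.2
  have hoo : ∀ x ∈ X, o (o x) = x := fun x hx =>
    ((ho _ (hoX x hx)).2 x hx (by rw [dist_comm]; exact hofar x hx)).symm
  have hnot : ∀ x ∈ T, o x ∉ T := fun x hx hox =>
    absurd (hT.2 x hx _ hox) (not_lt.2 (hofar x (hT.1 hx)))
  have hor : ∀ x ∈ X, x ∉ T → o x ∈ T := by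
    intro x hx hxT
    by_contra hox
    have hclq : IsNearClique X (insert x T) := isNearClique_insert.2 ⟨hx, fun u hu => by
      by_contra hcon
      have := (ho x hx).2 u (hT.1 hu) (by rw [dist_comm]; exact not_lt.1 hcon)
      exact hox (this ▸ hu), hT⟩
    have := h.card_le _ hclq
    rw [Finset.card_insert_of_notMem hxT] at this
    omega
  have e : T ≃ Fin (d + 1) := T.equivFinOfCardEq hTc
  have e0 : Fin (d + 1) := 0
  let f : EuclideanSpace ℝ (Fin 2) → Fin (d + 1) × Fin 2 := fun x =>
    if hx : x ∈ T then (e ⟨x, hx⟩, 0) else if hx' : o x ∈ T then (e ⟨o x, hx'⟩, 1) else (e0, 0)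
  have f1 : ∀ x (hx : x ∈ T), f x = (e ⟨x, hx⟩, 0) := fun x hx => by simp [f, hx]
  have f2 : ∀ x (hx : x ∉ T) (hx' : o x ∈ T), f x = (e ⟨o x, hx'⟩, 1) := fun x hx hx' => by
    simp [f, hx, hx']
  have fo : ∀ x ∈ X, ∀ y ∈ X, (f x).1 = (f y).1 → (f x).2 ≠ (f y).2 → y = o x := by
    intro x hx y hy h1 h2
    by_cases hxT : x ∈ T <;> by_cases hyT : y ∈ T
    · simp [f1 x hxT, f1 y hyT] at h2
    · rw [f1 x hxT, f2 y hyT (hor y hy hyT)] at h1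
      simp at h1
      rw [h1, hoo y hy]
    · rw [f1 y hyT, f2 x hxT (hor x hx hxT)] at h1
      simp at h1
      exact h1.symm
    · simp [f2 x hxT (hor x hx hxT), f2 y hyT (hor y hy hyT)] at h2
  have fo' : ∀ x ∈ X, (f (o x)).1 = (f x).1 ∧ (f (o x)).2 ≠ (f x).2 := by
    intro x hx
    by_cases hxT : x ∈ T
    · have h2 : o (o x) ∈ T := by rwa [hoo x hx]
      rw [f1 x hxT, f2 (o x) (hnot x hxT) h2]
      simp [hoo x hx]
    · rw [f1 (o x) (hor x hx hxT), f2 x hxT (hor x hx hxT)]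
      simp
  have hinj : Set.InjOn f X := by
    intro x hx y hy hxy
    have h1 := fo' x hx
    have := fo (o x) (hoX x hx) y hy (by rw [h1.1, hxy]) (by rw [← hxy]; exact h1.2)
    rw [this, hoo x hx]
  have hvert : vertexSet (crossPolytopeBoundary d) = Set.univ := by
    ext p
    have : ({p} : Finset (Fin (d + 1) × Fin 2)) ∈ crossPolytopeBoundary d := by
      refine ⟨by simp, fun i hi => ?_⟩
      simp only [Finset.mem_singleton] at hi
      have := hi.1.trans hi.2.symm
      simp at this
    exact ⟨fun _ => trivial, fun _ => this⟩
  refine ⟨f, ?_, fun s hs => ?_⟩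
  · rw [vertexSet_ripsFaces, hvert]
    refine ⟨fun _ _ => trivial, hinj, ?_⟩
    rintro ⟨i, j⟩ -
    obtain ⟨⟨x, hxT⟩, rfl⟩ := e.surjective i
    have hxX := hT.1 hxT
    rcases Fin.exists_fin_two.1 ⟨j, rfl⟩ with rfl | rfl
    · exact ⟨x, hxX, f1 x hxT⟩
    · refine ⟨o x, hoX x hxX, ?_⟩
      have h2 : o (o x) ∈ T := by rwa [hoo x hxX]
      rw [f2 (o x) (hnot x hxT) h2]
      simp [hoo x hxX]
  · rw [vertexSet_ripsFaces] at hs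
    rw [mem_ripsFaces]
    change _ ↔ (s.image f).Nonempty ∧ _
    rw [Finset.image_nonempty]
    refine and_congr_right fun _ => ⟨fun hclq i hi => ?_, fun hcp => ⟨hs, fun u hu v hv => ?_⟩⟩
    · simp only [Finset.mem_image] at hi
      obtain ⟨⟨u, hu, hfu⟩, v, hv, hfv⟩ := hi
      have := fo u (hs hu) v (hs hv) (by rw [hfu, hfv]) (by rw [hfu, hfv]; simp)
      have h1 := hclq.2 u hu v hv
      rw [this] at h1
      linarith [hofar u (hs hu)]
    · by_contra hcon
      have hvu := (ho u (hs hu)).2 v (hs hv) (not_lt.1 hcon)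
      have h1 := fo' u (hs hu)
      rw [← hvu] at h1
      have hu' := Finset.mem_image_of_mem f hu
      have hv' := Finset.mem_image_of_mem f hv
      have key := hcp (f u).1
      have : ∀ j k : Fin 2, j ≠ k → (j = 0 ∧ k = 1) ∨ (j = 1 ∧ k = 0) := by decide
      rcases this _ _ h1.2 with ⟨h3, h4⟩ | ⟨h3, h4⟩
      · refine key ⟨?_, ?_⟩
        · rwa [← h1.1, ← h3]
        · rwa [← h4]
      · refine key ⟨?_, ?_⟩
        · rwa [← h4]
        · rwa [← h1.1, ← h3]

end RipsFaces

/-- **Normal pseudomanifolds in planar Rips complexes are crosspolytope boundaries.**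
If `X ⊆ ℝ²` is finite, `d ≥ 2`, and the Rips complex `R(X)` is a `d`-dimensional normal
pseudomanifold, then `R(X)` is isomorphic to the boundary complex of the
`(d+1)`-dimensional crosspolytope. -/
theorem planar_rips_normal_pseudomanifold (d : ℕ) (hd : 2 ≤ d)
    (X : Set (EuclideanSpace ℝ (Fin 2))) (hX : X.Finite)
    (hpm : IsNormalPseudomanifold (ripsFaces X) d) :
    ComplexIso (ripsFaces X) (crossPolytopeBoundary d) := by
  obtain ⟨k, rfl⟩ : ∃ k, d = k + 2 := ⟨d - 2, by omega⟩
  have h := hpm.isNearPseudomanifold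
  exact complexIso_crossPolytopeBoundary h
    (IsNearPseudomanifold.hasAntipodes (Q := Set.Finite)
      (fun X x hX => hX.subset fun v hv => hv.1)
      (fun X hX h => h.hasAntipodes_of_plane hX) k X hX h)
end

section
/- Let A, B, C, P, Q be points in ℝ³ (not necessarily distinct) such that |AB| < 1, |BC| < 1, |CA| < 1 and |PQ| < 1, and such that the segment conv{P,Q} and the triangle conv{A,B,C} have non-empty intersection. Then one of the five points A, B, C, P, Q is at Euclidean distance less than 1 from each of the remaining ones. -/
open Metric

section

variable {V : Type*} [NormedAddCommGroup V] [InnerProductSpace ℝ V]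

/-- **Stewart's theorem** for an affine combination `s • A + t • B`. -/
theorem dist_sq_affine_combination (A B P : V) {s t : ℝ} (hst : s + t = 1) :
    dist P (s • A + t • B) ^ 2
      = s * dist P A ^ 2 + t * dist P B ^ 2 - s * t * dist A B ^ 2 := by
  obtain rfl : t = 1 - s := by linarith
  have hD : P - (s • A + (1 - s) • B) = s • (P - A) + (1 - s) • (P - B) := by module
  have hAB : A - B = (P - B) - (P - A) := by abel
  rw [dist_eq_norm, dist_eq_norm, dist_eq_norm, dist_eq_norm, hD, hAB, norm_add_sq_real,
    norm_sub_sq_real (P - B) (P - A), norm_smul, norm_smul, mul_pow, mul_pow, Real.norm_eq_abs,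
    Real.norm_eq_abs, sq_abs, sq_abs, real_inner_smul_left, real_inner_smul_right,
    real_inner_comm (P - A) (P - B)]
  ring

/-- If `C` is closer than `r` to both ends of a segment and `P` is not closer than `r` to
either end, then `C` is closer than `P` to every point of the segment. -/
theorem dist_lt_dist_of_mem_segment {A B C D P : V} {r : ℝ} (hD : D ∈ segment ℝ A B)
    (hCA : dist C A < r) (hCB : dist C B < r) (hPA : r ≤ dist P A) (hPB : r ≤ dist P B) :
    dist C D < dist P D := by
  obtain ⟨s, t, hs, ht, hst, rfl⟩ := hD
  have hA : dist C A ^ 2 < dist P A ^ 2 := by gcongr; linarith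
  have hB : dist C B ^ 2 < dist P B ^ 2 := by gcongr; linarith
  refine lt_of_pow_lt_pow_left₀ 2 dist_nonneg ?_
  rw [dist_sq_affine_combination A B C hst, dist_sq_affine_combination A B P hst]
  rcases hs.eq_or_lt with rfl | hs
  · obtain rfl : t = 1 := by linarith
    linarith
  · linarith [mul_lt_mul_of_pos_left hA hs, mul_le_mul_of_nonneg_left hB.le ht]

/-- For two segments with a common point, the sum of two opposite sides of the quadrilateral
they span is at most the sum of the diagonals. -/
theorem dist_add_dist_le_of_mem_segment {C D P Q X : V} (hPQ : X ∈ segment ℝ P Q)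
    (hCD : X ∈ segment ℝ C D) : dist P D + dist Q C ≤ dist P Q + dist C D := by
  linarith [dist_add_dist_of_mem_segment hPQ, dist_add_dist_of_mem_segment hCD,
    dist_triangle P X D, dist_triangle Q X C, dist_comm X Q, dist_comm X C]

theorem disjoint_convexHull_of_le_dist {A B C P Q : V} {r : ℝ} (hCA : dist C A < r)
    (hCB : dist C B < r) (hPQ : dist P Q < r) (hPA : r ≤ dist P A) (hPB : r ≤ dist P B)
    (hQC : r ≤ dist Q C) : Disjoint (convexHull ℝ {P, Q}) (convexHull ℝ {A, B, C}) := by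
  rw [Set.disjoint_left]
  intro X hX hX'
  have hperm : ({A, B, C} : Set V) = {C, A, B} := by grind
  rw [convexHull_pair] at hX
  rw [hperm, convexHull_insert (Set.insert_nonempty _ _), convexHull_pair,
    mem_convexJoin] at hX'
  obtain ⟨_, rfl, D, hD, hXD⟩ := hX'
  linarith [dist_add_dist_le_of_mem_segment hX hXD,
    dist_lt_dist_of_mem_segment hD hCA hCB hPA hPB]

end

/-- **Proposition (apex).** If `A, B, C, P, Q` are points in Euclidean 3-space (not
necessarily distinct) with `|AB|, |BC|, |CA|, |PQ| < 1`, and the segment `conv {P, Q}`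
meets the triangle `conv {A, B, C}`, then one of the five points is at distance less
than `1` from all the remaining ones (note `dist z z = 0 < 1`, so quantifying over all
five points is equivalent). -/
theorem apex_of_segment_inter_triangle
    (A B C P Q : EuclideanSpace ℝ (Fin 3))
    (hAB : dist A B < 1) (hBC : dist B C < 1) (hCA : dist C A < 1)
    (hPQ : dist P Q < 1)
    (hinter : (convexHull ℝ {P, Q} ∩ convexHull ℝ {A, B, C}).Nonempty) :
    ∃ z ∈ ({A, B, C, P, Q} : Set (EuclideanSpace ℝ (Fin 3))),
      ∀ w ∈ ({A, B, C, P, Q} : Set (EuclideanSpace ℝ (Fin 3))), dist z w < 1 := by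
  have hBA := dist_comm A B ▸ hAB
  have hCB := dist_comm B C ▸ hBC
  have hAC := dist_comm C A ▸ hCA
  have hQP := dist_comm P Q ▸ hPQ
  rw [← Set.not_disjoint_iff_nonempty_inter] at hinter
  have hswap : ({Q, P} : Set (EuclideanSpace ℝ (Fin 3))) = {P, Q} := Set.pair_comm Q P
  have hBCA : ({B, C, A} : Set (EuclideanSpace ℝ (Fin 3))) = {A, B, C} := by grind
  have hCAB : ({C, A, B} : Set (EuclideanSpace ℝ (Fin 3))) = {A, B, C} := by grind
  have hC : ¬ (1 ≤ dist P A ∧ 1 ≤ dist P B ∧ 1 ≤ dist Q C) := fun ⟨h₁, h₂, h₃⟩ =>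
    hinter (disjoint_convexHull_of_le_dist hCA hCB hPQ h₁ h₂ h₃)
  have hA : ¬ (1 ≤ dist P B ∧ 1 ≤ dist P C ∧ 1 ≤ dist Q A) := fun ⟨h₁, h₂, h₃⟩ =>
    hinter (hBCA ▸ disjoint_convexHull_of_le_dist hAB hAC hPQ h₁ h₂ h₃)
  have hB : ¬ (1 ≤ dist P C ∧ 1 ≤ dist P A ∧ 1 ≤ dist Q B) := fun ⟨h₁, h₂, h₃⟩ =>
    hinter (hCAB ▸ disjoint_convexHull_of_le_dist hBC hBA hPQ h₁ h₂ h₃)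
  have hC' : ¬ (1 ≤ dist Q A ∧ 1 ≤ dist Q B ∧ 1 ≤ dist P C) := fun ⟨h₁, h₂, h₃⟩ =>
    hinter (hswap ▸ disjoint_convexHull_of_le_dist hCA hCB hQP h₁ h₂ h₃)
  have hA' : ¬ (1 ≤ dist Q B ∧ 1 ≤ dist Q C ∧ 1 ≤ dist P A) := fun ⟨h₁, h₂, h₃⟩ =>
    hinter (hswap ▸ hBCA ▸ disjoint_convexHull_of_le_dist hAB hAC hQP h₁ h₂ h₃)
  have hB' : ¬ (1 ≤ dist Q C ∧ 1 ≤ dist Q A ∧ 1 ≤ dist P B) := fun ⟨h₁, h₂, h₃⟩ =>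
    hinter (hswap ▸ hCAB ▸ disjoint_convexHull_of_le_dist hBC hBA hQP h₁ h₂ h₃)
  simp only [Set.mem_insert_iff, Set.mem_singleton_iff, exists_eq_or_imp, exists_eq_left,
    forall_eq_or_imp, forall_eq, dist_self, zero_lt_one, true_and, and_true, hAB, hBC, hCA,
    hBA, hCB, hAC, hPQ, hQP, dist_comm A P, dist_comm B P, dist_comm C P, dist_comm A Q,
    dist_comm B Q, dist_comm C Q]
  simp only [← not_lt] at hA hB hC hA' hB' hC'
  grind only
end

section
/- Let A, B, C, P, Q be points in ℝ³ with |AB| < 1, |BC| < 1, |CA| < 1, |PQ| < 1, such that the segment conv{P,Q} intersects the triangle conv{A,B,C}, and such that P does not coincide with any of A, B, C. If |PB| ≥ 1 and |PC| ≥ 1, then |QA| < 1. -/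
open Metric

/-- The set of points strictly closer to `a` than to `b` is convex, being an open half-space. -/
theorem convex_setOf_dist_lt_dist_s6 {E : Type*} [NormedAddCommGroup E] [InnerProductSpace ℝ E]
    (a b : E) : Convex ℝ {x | dist x a < dist x b} := by
  have h : {x | dist x a < dist x b} = {x | inner ℝ (b - a) x < (‖b‖ ^ 2 - ‖a‖ ^ 2) / 2} := by
    ext x
    rw [Set.mem_ofPred_eq, Set.mem_ofPred_eq, dist_eq_norm, dist_eq_norm,
      ← sq_lt_sq₀ (norm_nonneg _) (norm_nonneg _), norm_sub_sq_real, norm_sub_sq_real,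
      inner_sub_left, real_inner_comm x a, real_inner_comm x b]
    constructor <;> intro h <;> linarith
  rw [h]
  exact convex_halfSpace_lt (innerₛₗ ℝ (b - a)).isLinear _

/-- **Claim in the proof of the apex proposition.** Let `A, B, C, P, Q` be points in
Euclidean 3-space with `|AB|, |BC|, |CA|, |PQ| < 1`, such that the segment `conv {P, Q}`
meets the triangle `conv {A, B, C}` and `P` is distinct from `A`, `B` and `C`.
If `|PB| ≥ 1` and `|PC| ≥ 1`, then `|QA| < 1`. -/
theorem dist_lt_one_of_far
    (A B C P Q : EuclideanSpace ℝ (Fin 3))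
    (hAB : dist A B < 1) (hBC : dist B C < 1) (hCA : dist C A < 1)
    (hPQ : dist P Q < 1)
    (hinter : (convexHull ℝ {P, Q} ∩ convexHull ℝ {A, B, C}).Nonempty)
    (hPA : P ≠ A) (hPB' : P ≠ B) (hPC' : P ≠ C)
    (hPB : 1 ≤ dist P B) (hPC : 1 ≤ dist P C) :
    dist Q A < 1 := by
  by_contra! hQA
  obtain ⟨x, hxPQ, hxABC⟩ := hinter
  have hxP : dist x P < dist x A := by
    refine convexHull_min ?_ (convex_setOf_dist_lt_dist_s6 P A) hxPQ
    rintro y (rfl | rfl)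
    · simpa using hPA
    · exact (dist_comm y P ▸ hPQ).trans_le hQA
  have hxA : dist x A < dist x P := by
    refine convexHull_min ?_ (convex_setOf_dist_lt_dist_s6 A P) hxABC
    rintro y (rfl | rfl | rfl)
    · simpa using hPA.symm
    · exact (dist_comm A y ▸ hAB).trans_le (dist_comm P y ▸ hPB)
    · exact hCA.trans_le (dist_comm P y ▸ hPC)
  exact hxP.asymm hxA
end

section
/- Let d be a metric on ℝ³ with the property that for any two distinct points S, T ∈ ℝ³ the set {x ∈ ℝ³ : d(x,S) < d(x,T)} is convex. Let A, B, C, P, Q ∈ ℝ³ satisfy d(A,B) < 1, d(B,C) < 1, d(C,A) < 1, d(P,Q) < 1, and suppose the segment conv{P,Q} (convex hull with respect to the affine structure of ℝ³) intersects the triangle conv{A,B,C}. Then one of the five points A, B, C, P, Q is at d-distance less than 1 from each of the remaining ones. -/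
/-- If the region closer to `S` than to `T` is always convex, a set lying closer to `S` and a set
lying closer to `T` have disjoint convex hulls. -/
theorem convexHull_disjoint_of_convex_bisectors {E : Type*} [AddCommGroup E] [Module ℝ E]
    {d : E → E → ℝ} (hconv : ∀ S T : E, S ≠ T → Convex ℝ {x | d x S < d x T})
    {S T : E} (hST : S ≠ T) {U V : Set E} (hU : ∀ u ∈ U, d u S < d u T)
    (hV : ∀ v ∈ V, d v T < d v S) : Disjoint (convexHull ℝ U) (convexHull ℝ V) := by
  rw [Set.disjoint_left]
  intro x hxU hxV
  have hS : d x S < d x T := convexHull_min hU (hconv S T hST) hxU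
  have hT : d x T < d x S := convexHull_min hV (hconv T S hST.symm) hxV
  exact lt_asymm hS hT

/-- **Apex proposition for metrics with convex bisector half-spaces.** Let `d` be a metric
on `ℝ³` (symmetric, satisfying the triangle inequality, vanishing exactly on the diagonal)
such that for any two distinct points `S, T` the set `{x : d(x,S) < d(x,T)}` is convex
(with respect to the usual affine structure of `ℝ³`). If `A, B, C, P, Q` satisfy
`d(A,B), d(B,C), d(C,A), d(P,Q) < 1` and the segment `conv {P, Q}` meets the triangle
`conv {A, B, C}`, then one of the five points is at `d`-distance less than `1` from all
the remaining ones. -/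
theorem apex_of_convex_bisectors
    (d : EuclideanSpace ℝ (Fin 3) → EuclideanSpace ℝ (Fin 3) → ℝ)
    (hsymm : ∀ x y, d x y = d y x)
    (htriangle : ∀ x y z, d x z ≤ d x y + d y z)
    (heq : ∀ x y, d x y = 0 ↔ x = y)
    (hconv : ∀ S T : EuclideanSpace ℝ (Fin 3), S ≠ T → Convex ℝ {x | d x S < d x T})
    (A B C P Q : EuclideanSpace ℝ (Fin 3))
    (hAB : d A B < 1) (hBC : d B C < 1) (hCA : d C A < 1) (hPQ : d P Q < 1)
    (hinter : (convexHull ℝ {P, Q} ∩ convexHull ℝ {A, B, C}).Nonempty) :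
    ∃ z ∈ ({A, B, C, P, Q} : Set (EuclideanSpace ℝ (Fin 3))),
      ∀ w ∈ ({A, B, C, P, Q} : Set (EuclideanSpace ℝ (Fin 3))), w ≠ z → d z w < 1 := by
  have hself : ∀ x, d x x = 0 := fun x => (heq x x).2 rfl
  have hBA : d B A < 1 := hsymm A B ▸ hAB
  have hCB : d C B < 1 := hsymm B C ▸ hBC
  have hAC : d A C < 1 := hsymm C A ▸ hCA
  have hQP : d Q P < 1 := hsymm P Q ▸ hPQ
  by_contra! hno
  have farA : 1 ≤ d A P ∨ 1 ≤ d A Q := by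
    obtain ⟨w, rfl | rfl | rfl | rfl | rfl, hne, hd⟩ := hno A (by simp)
    exacts [absurd rfl hne, absurd hAB hd.not_gt, absurd hAC hd.not_gt,
      .inl hd, .inr hd]
  have farB : 1 ≤ d B P ∨ 1 ≤ d B Q := by
    obtain ⟨w, rfl | rfl | rfl | rfl | rfl, hne, hd⟩ := hno B (by simp)
    exacts [absurd hBA hd.not_gt, absurd rfl hne, absurd hBC hd.not_gt,
      .inl hd, .inr hd]
  have farC : 1 ≤ d C P ∨ 1 ≤ d C Q := by
    obtain ⟨w, rfl | rfl | rfl | rfl | rfl, hne, hd⟩ := hno C (by simp)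
    exacts [absurd hCA hd.not_gt, absurd hCB hd.not_gt, absurd rfl hne,
      .inl hd, .inr hd]
  have farP : 1 ≤ d A P ∨ 1 ≤ d B P ∨ 1 ≤ d C P := by
    obtain ⟨w, rfl | rfl | rfl | rfl | rfl, hne, hd⟩ := hno P (by simp)
    exacts [.inl (hd.trans_eq (hsymm _ _)), .inr (.inl (hd.trans_eq (hsymm _ _))),
      .inr (.inr (hd.trans_eq (hsymm _ _))),
      absurd rfl hne, absurd hPQ hd.not_gt]
  have farQ : 1 ≤ d A Q ∨ 1 ≤ d B Q ∨ 1 ≤ d C Q := by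
    obtain ⟨w, rfl | rfl | rfl | rfl | rfl, hne, hd⟩ := hno Q (by simp)
    exacts [.inl (hd.trans_eq (hsymm _ _)), .inr (.inl (hd.trans_eq (hsymm _ _))),
      .inr (.inr (hd.trans_eq (hsymm _ _))),
      absurd hQP hd.not_gt, absurd rfl hne]
  have hpos : ∀ x y, x ≠ y → 0 < d x y := fun x y hxy => by
    have h₁ := htriangle x y x
    rw [hself, hsymm y x] at h₁
    have h₂ : d x y ≠ 0 := fun h => hxy ((heq x y).1 h)
    exact lt_of_le_of_ne (by linarith) h₂.symm
  obtain ⟨X, hXPQ, hXABC⟩ := hinter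
  -- It is impossible that `P` is far from `A` while `Q` is far from both `B` and `C`.
  have key : ∀ A B C P Q, d A B < 1 → d C A < 1 → d P Q < 1 →
      X ∈ convexHull ℝ {P, Q} → X ∈ convexHull ℝ {A, B, C} →
      1 ≤ d A P → 1 ≤ d B Q → 1 ≤ d C Q → False := by
    intro A B C P Q hAB hCA hPQ hXPQ hXABC hAP hBQ hCQ
    have hQA : Q ≠ A := by
      rintro rfl
      linarith [hsymm P Q]
    refine Set.disjoint_left.1
      (convexHull_disjoint_of_convex_bisectors hconv hQA ?_ ?_) hXPQ hXABC
    · rintro u (rfl | rfl)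
      · linarith [hsymm u A]
      · rw [hself]
        exact hpos _ _ hQA
    · rintro v (rfl | rfl | rfl)
      · rw [hself]
        exact hpos _ _ hQA.symm
      · linarith [hsymm A v]
      · linarith
  have hXQP : X ∈ convexHull ℝ {Q, P} := by rwa [Set.pair_comm]
  have hrot : ∀ A B C : EuclideanSpace ℝ (Fin 3), ({A, B, C} : Set _) = {B, C, A} := by
    intro A B C
    rw [Set.insert_comm, Set.pair_comm]
  have hXBCA : X ∈ convexHull ℝ {B, C, A} := hrot A B C ▸ hXABC
  have hXCAB : X ∈ convexHull ℝ {C, A, B} := hrot B C A ▸ hXBCA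
  have kAP := key A B C P Q hAB hCA hPQ hXPQ hXABC
  have kAQ := key A B C Q P hAB hCA hQP hXQP hXABC
  have kBP := key B C A P Q hBC hAB hPQ hXPQ hXBCA
  have kBQ := key B C A Q P hBC hAB hQP hXQP hXBCA
  have kCP := key C A B P Q hCA hBC hPQ hXPQ hXCAB
  have kCQ := key C A B Q P hCA hBC hQP hXQP hXCAB
  rcases farA with a | a <;> rcases farB with b | b <;> rcases farC with c | c
  · rcases farQ with h | h | h
    exacts [kAQ h b c, kBQ h c a, kCQ h a b]
  · exact kCQ c a b
  · exact kBQ b c a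
  · exact kAP a b c
  · exact kAQ a b c
  · exact kBP b c a
  · exact kCP c a b
  · rcases farP with h | h | h
    exacts [kAP h b c, kBP h c a, kCP h a b]
end

section
/- Let d be the metric on ℝ³ = ℝ × ℝ² defined by d((x₁,y₁,z₁),(x₂,y₂,z₂)) = |x₁ − x₂| + √((y₁−y₂)² + (z₁−z₂)²). Then there exist points A, B, C, P, Q ∈ ℝ³ with d(A,B) < 1, d(B,C) < 1, d(C,A) < 1, d(P,Q) < 1, such that the segment conv{P,Q} intersects the triangle conv{A,B,C}, and yet none of the five points is at d-distance less than 1 from all the remaining ones; indeed all of d(P,A), d(P,B), d(P,C), d(Q,A), d(Q,B), d(Q,C) are at least 1. (Hence the apex proposition fails for this metric on ℝ³.) -/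
/-- **The apex proposition fails for the product metric on `ℝ³ = ℝ × ℝ²`.**
For the metric `d((x₁,y₁,z₁),(x₂,y₂,z₂)) = |x₁ − x₂| + √((y₁−y₂)² + (z₁−z₂)²)` there
are points `A, B, C, P, Q` with `d(A,B), d(B,C), d(C,A), d(P,Q) < 1` whose segment
`conv {P,Q}` meets the triangle `conv {A,B,C}` (convex hulls for the usual affine
structure), and yet `d(P,A), d(P,B), d(P,C), d(Q,A), d(Q,B), d(Q,C)` are all at
least `1`; in particular none of the five points is within `d`-distance less than `1`
of all the remaining ones. -/
theorem product_metric_no_apex :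
    ∃ A B C P Q : ℝ × EuclideanSpace ℝ (Fin 2),
      (let d : (ℝ × EuclideanSpace ℝ (Fin 2)) → (ℝ × EuclideanSpace ℝ (Fin 2)) → ℝ :=
        fun p q => |p.1 - q.1| + dist p.2 q.2
      d A B < 1 ∧ d B C < 1 ∧ d C A < 1 ∧ d P Q < 1 ∧
        (convexHull ℝ {P, Q} ∩ convexHull ℝ {A, B, C}).Nonempty ∧
        1 ≤ d P A ∧ 1 ≤ d P B ∧ 1 ≤ d P C ∧
        1 ≤ d Q A ∧ 1 ≤ d Q B ∧ 1 ≤ d Q C) := by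
  refine ⟨(0, !₂[14/25, 0]), (0, !₂[-7/25, 12/25]), (0, !₂[-7/25, -12/25]),
    (12/25, !₂[0, 0]), (-12/25, !₂[0, 0]), ?_⟩
  have dist_eq_sqrt (a b c e : ℝ) :
      dist !₂[a, b] !₂[c, e] = √((a - c) ^ 2 + (b - e) ^ 2) := by
    simp [EuclideanSpace.dist_eq, Real.dist_eq, sq_abs]
  have sqrt_lt_one {x : ℝ} (hx : x < 1) : √x < 1 := by
    rwa [Real.sqrt_lt' one_pos, one_pow]
  have circumradius_le {x : ℝ} (hx : (13 / 25 : ℝ) ^ 2 ≤ x) : 1 ≤ 12 / 25 + √x := by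
    linarith [Real.le_sqrt_of_sq_le hx]
  have abs_height : |(12 / 25 : ℝ)| = 12 / 25 := abs_of_pos (by norm_num)
  simp only [dist_eq_sqrt, sub_zero, zero_sub, abs_zero, zero_add, neg_div, abs_neg, abs_height]
  refine ⟨sqrt_lt_one (by norm_num), sqrt_lt_one (by norm_num), sqrt_lt_one (by norm_num), ?_,
    ⟨0, ?_, ?_⟩, circumradius_le (by norm_num), circumradius_le (by norm_num),
    circumradius_le (by norm_num), circumradius_le (by norm_num), circumradius_le (by norm_num),
    circumradius_le (by norm_num)⟩
  · norm_num [abs_of_pos]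
  · rw [convexHull_pair]
    refine ⟨1 / 2, 1 / 2, by norm_num, by norm_num, by norm_num, ?_⟩
    ext i
    · norm_num
    · fin_cases i <;> norm_num
  · rw [convexHull_insert (by simp), convexHull_pair, mem_convexJoin]
    refine ⟨_, rfl, (0, !₂[-7/25, 0]),
      ⟨1 / 2, 1 / 2, by norm_num, by norm_num, by norm_num, ?_⟩,
      1 / 3, 2 / 3, by norm_num, by norm_num, by norm_num, ?_⟩
    · ext i
      · norm_num
      · fin_cases i <;> norm_num
    · ext i
      · norm_num
      · fin_cases i <;> norm_num
end

section
/- Let 𝒜, ℬ ⊆ ℝ³ be sets with |𝒜| ≤ 4, |ℬ| ≤ 4 and conv(𝒜) ∩ conv(ℬ) ≠ ∅. Then at least one of the following holds: (a) conv(𝒜) ⊆ conv(ℬ) or conv(ℬ) ⊆ conv(𝒜); (b) there exist A, B, C ∈ 𝒜 and P, Q ∈ ℬ (choices not necessarily pairwise distinct) with conv{A,B,C} ∩ conv{P,Q} ≠ ∅; (c) there exist P, Q ∈ 𝒜 and A, B, C ∈ ℬ (not necessarily pairwise distinct) with conv{P,Q} ∩ conv{A,B,C} ≠ ∅. -/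
open Module

section ConvexIntersections

variable {E : Type*}

/-- Carathéodory's theorem for two intersecting hulls: supports of total size at most
`finrank ℝ E + 2` suffice for a common point. -/
theorem exists_subsets_convexHull_inter_nonempty [AddCommGroup E] [Module ℝ E]
    [FiniteDimensional ℝ E] {A B : Finset E}
    (h : (convexHull ℝ (A : Set E) ∩ convexHull ℝ (B : Set E)).Nonempty) :
    ∃ S ⊆ A, ∃ T ⊆ B, S.card + T.card ≤ finrank ℝ E + 2 ∧
      (convexHull ℝ (S : Set E) ∩ convexHull ℝ (T : Set E)).Nonempty := by
  classical
  obtain ⟨x, hxA, hxB⟩ := h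
  let f : E →ᵃ[ℝ] E × ℝ := (AffineMap.id ℝ E).prod (AffineMap.const ℝ E 0)
  let g : E →ᵃ[ℝ] E × ℝ := (-AffineMap.id ℝ E).prod (AffineMap.const ℝ E 1)
  have hf : ∀ a, f a = (a, 0) := fun a => rfl
  have hg : ∀ b, g b = (-b, 1) := fun b => rfl
  have hfi : Function.Injective f := fun a b hab => by simpa [hf] using hab
  have hgi : Function.Injective g := fun a b hab => by simpa [hg] using hab
  have hfx : f x ∈ convexHull ℝ (f '' A ∪ g '' B) :=
    convexHull_mono Set.subset_union_left (f.image_convexHull _ ▸ Set.mem_image_of_mem f hxA)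
  have hgx : g x ∈ convexHull ℝ (f '' A ∪ g '' B) :=
    convexHull_mono Set.subset_union_right (g.image_convexHull _ ▸ Set.mem_image_of_mem g hxB)
  have hmid : ((0, 1 / 2) : E × ℝ) ∈ convexHull ℝ (f '' A ∪ g '' B) := by
    have := (convex_convexHull ℝ (f '' (A : Set E) ∪ g '' B)) hfx hgx
      (by norm_num : (0 : ℝ) ≤ 1 / 2) (by norm_num : (0 : ℝ) ≤ 1 / 2) (by norm_num)
    simpa [hf, hg] using this
  rw [convexHull_eq_union] at hmid
  simp only [Set.mem_iUnion] at hmid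
  obtain ⟨t, ht, hind, hmem⟩ := hmid
  let S := A.filter fun a => f a ∈ t
  let T := B.filter fun b => g b ∈ t
  have htST : t = S.image f ∪ T.image g := by
    ext p
    simp only [Finset.mem_union, Finset.mem_image, S, T, Finset.mem_filter]
    constructor
    · intro hp
      rcases ht hp with ⟨a, ha, rfl⟩ | ⟨b, hb, rfl⟩
      · exact Or.inl ⟨a, ⟨ha, hp⟩, rfl⟩
      · exact Or.inr ⟨b, ⟨hb, hp⟩, rfl⟩
    · rintro (⟨a, ⟨-, hp⟩, rfl⟩ | ⟨b, ⟨-, hp⟩, rfl⟩) <;> exact hp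
  have hdisj : Disjoint (S.image f) (T.image g) := by
    rw [Finset.disjoint_left]
    simp only [Finset.mem_image]
    rintro _ ⟨a, -, rfl⟩ ⟨b, -, hab⟩
    simp [hf, hg] at hab
  have hcard : t.card ≤ finrank ℝ E + 2 := by
    have := hind.card_le_finrank_succ
    have h2 := Submodule.finrank_le (vectorSpan ℝ (Set.range ((↑) : t → E × ℝ)))
    simp only [Fintype.card_coe, finrank_prod, finrank_self] at this h2
    omega
  have hsum : t.card = S.card + T.card := by
    rw [htST, Finset.card_union_of_disjoint hdisj, Finset.card_image_of_injective _ hfi,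
      Finset.card_image_of_injective _ hgi]
  have hcover : (t : Set (E × ℝ)) = f '' S ∪ g '' T := by
    rw [htST]; push_cast; rfl
  have hsnd : ∀ {U : Set (E × ℝ)} {c : ℝ}, (∀ p ∈ U, p.2 = c) →
      ∀ p ∈ convexHull ℝ U, p.2 = c := by
    intro U c hU
    have hc : Convex ℝ {p : E × ℝ | p.2 = c} :=
      (convex_singleton c).linear_preimage (LinearMap.snd ℝ E ℝ)
    exact convexHull_min hU hc
  refine ⟨S, Finset.filter_subset _ _, T, Finset.filter_subset _ _, hsum ▸ hcard, ?_⟩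
  rw [hcover] at hmem
  have hS : (f '' (S : Set E)).Nonempty := by
    rw [Set.nonempty_iff_ne_empty]
    intro h0
    rw [h0, Set.empty_union] at hmem
    have := hsnd (c := 1) (by rintro _ ⟨b, -, rfl⟩; rfl) _ hmem
    norm_num at this
  have hT : (g '' (T : Set E)).Nonempty := by
    rw [Set.nonempty_iff_ne_empty]
    intro h0
    rw [h0, Set.union_empty] at hmem
    have := hsnd (c := 0) (by rintro _ ⟨b, -, rfl⟩; rfl) _ hmem
    norm_num at this
  rw [convexHull_union hS hT, mem_convexJoin, ← f.image_convexHull, ← g.image_convexHull] at hmem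
  obtain ⟨_, ⟨y, hy, rfl⟩, _, ⟨z, hz, rfl⟩, a, b, -, -, hab, hyz⟩ := hmem
  simp only [hf, hg, Prod.smul_mk, Prod.mk_add_mk, Prod.mk.injEq, smul_eq_mul] at hyz
  obtain ⟨h1, h2⟩ := hyz
  obtain rfl : b = 1 / 2 := by linarith
  obtain rfl : a = 1 / 2 := by linarith
  have hyz : y = z := by
    rw [← smul_add, smul_eq_zero] at h1
    exact add_neg_eq_zero.mp (h1.resolve_left (by norm_num))
  exact ⟨y, hy, hyz ▸ hz⟩

/-- A segment leaving the hull of at most `finrank ℝ E + 1` points crosses the hull of at most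
`finrank ℝ E` of them. -/
theorem exists_face_inter_segment_nonempty [NormedAddCommGroup E] [NormedSpace ℝ E]
    [FiniteDimensional ℝ E] {B : Finset E} (hB : B.card ≤ finrank ℝ E + 1) {p q : E}
    (hp : p ∈ convexHull ℝ (B : Set E)) (hq : q ∉ convexHull ℝ (B : Set E)) :
    ∃ T ⊆ B, T.card ≤ finrank ℝ E ∧ (segment ℝ p q ∩ convexHull ℝ (T : Set E)).Nonempty := by
  classical
  have hp' := hp
  rw [convexHull_eq_union] at hp'
  simp only [Set.mem_iUnion] at hp'
  obtain ⟨t, ht, hind, hpt⟩ := hp'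
  have htB : t ⊆ B := by exact_mod_cast ht
  by_cases hcard : t.card ≤ finrank ℝ E
  · exact ⟨t, htB, hcard, p, left_mem_segment ℝ p q, hpt⟩
  obtain rfl : t = B := Finset.eq_of_subset_of_card_le htB (by omega)
  have hcard' : t.card = finrank ℝ E + 1 := by omega
  let b : AffineBasis t ℝ E := ⟨(↑), hind, by
    rw [hind.affineSpan_eq_top_iff_card_eq_finrank_add_one]; simpa using hcard'⟩
  have hrange : Set.range b = (t : Set E) := Subtype.range_coe
  obtain ⟨x, hxseg, hx⟩ :
      (segment ℝ p q ∩ (convexHull ℝ (t : Set E) \ interior (convexHull ℝ (t : Set E)))).Nonempty := by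
    by_contra hne
    have hcross : ∀ x ∈ segment ℝ p q, x ∈ convexHull ℝ (t : Set E) →
        x ∈ interior (convexHull ℝ (t : Set E)) := fun x hx hxt =>
      not_not.mp fun hxi => hne ⟨x, hx, hxt, hxi⟩
    obtain ⟨y, -, hyi, hyc⟩ := (convex_segment p q).isPreconnected _ _ isOpen_interior
      (t.finite_toSet.isClosed_convexHull ℝ).isOpen_compl
      (fun x hx => or_iff_not_imp_right.mpr fun hxt => hcross x hx (not_not.mp hxt))
      ⟨p, left_mem_segment ℝ p q, hcross p (left_mem_segment ℝ p q) hp⟩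
      ⟨q, right_mem_segment ℝ p q, hq⟩
    exact hyc (interior_subset hyi)
  rw [← hrange, b.interior_convexHull, b.convexHull_eq_nonneg_coord] at hx
  obtain ⟨hx0, hx1⟩ := hx
  simp only [Set.mem_ofPred_eq, not_forall, not_lt] at hx0 hx1
  obtain ⟨i, hi⟩ := hx1
  have hi0 : b.coord i x = 0 := le_antisymm hi (hx0 i)
  refine ⟨t.erase i, Finset.erase_subset _ _, ?_, x, hxseg, ?_⟩
  · rw [Finset.card_erase_of_mem i.2]; omega
  have hsum : ∑ j ∈ Finset.univ.erase i, b.coord j x = 1 := by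
    rw [Finset.sum_erase (f := fun j => b.coord j x) _ hi0, b.sum_coord_apply_eq_one]
  have hcomb : ∑ j ∈ Finset.univ.erase i, b.coord j x • (j : E) = x := by
    rw [Finset.sum_erase _ (by rw [hi0, zero_smul])]
    exact b.linear_combination_coord_eq_self x
  rw [← hcomb]
  refine (convex_convexHull ℝ _).sum_mem (fun j _ => hx0 j) hsum fun j hj => ?_
  refine subset_convexHull ℝ _ ?_
  exact Finset.mem_erase.mpr ⟨fun h => (Finset.mem_erase.mp hj).1 (Subtype.ext h), j.2⟩

/-- If `p` lies in the hull of `B`, then that hull contains the hull of `A`, or a segment from `p`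
to a point of `A` meets the hull of at most `finrank ℝ E` points of `B`. -/
theorem convexHull_subset_or_exists_segment_inter_face [NormedAddCommGroup E] [NormedSpace ℝ E]
    [FiniteDimensional ℝ E] {A B : Finset E} (hB : B.card ≤ finrank ℝ E + 1) {p : E}
    (hp : p ∈ convexHull ℝ (B : Set E)) :
    convexHull ℝ (A : Set E) ⊆ convexHull ℝ (B : Set E) ∨
      ∃ q ∈ A, ∃ T ⊆ B, T.card ≤ finrank ℝ E ∧
        (convexHull ℝ {p, q} ∩ convexHull ℝ (T : Set E)).Nonempty := by
  by_cases hAB : (A : Set E) ⊆ convexHull ℝ (B : Set E)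
  · exact Or.inl (convexHull_min hAB (convex_convexHull ℝ _))
  obtain ⟨q, hqA, hq⟩ := Set.not_subset.mp hAB
  refine Or.inr ⟨q, hqA, ?_⟩
  rw [convexHull_pair]
  exact exists_face_inter_segment_nonempty hB hp hq

theorem Finset.exists_subset_pair_of_card_le_two {α : Type*} {S A : Finset α} (hSA : S ⊆ A)
    (hS : S.Nonempty) (hcard : S.card ≤ 2) :
    ∃ P ∈ A, ∃ Q ∈ A, (S : Set α) ⊆ {P, Q} := by
  classical
  obtain ⟨P, hP⟩ := hS
  have hle : (S.erase P).card ≤ 1 := by rw [Finset.card_erase_of_mem hP]; omega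
  have hins := Finset.insert_erase hP
  rcases (S.erase P).eq_empty_or_nonempty with h | ⟨Q, hQ⟩
  · refine ⟨P, hSA hP, P, hSA hP, ?_⟩
    rw [← hins, h]; simp
  · refine ⟨P, hSA hP, Q, hSA (Finset.mem_of_mem_erase hQ), fun x hx => ?_⟩
    by_cases hxP : x = P
    · exact Or.inl hxP
    · exact Or.inr (Finset.card_le_one.mp hle x (Finset.mem_erase.mpr ⟨hxP, hx⟩) Q hQ)

theorem Finset.exists_subset_triple_of_card_le_three {α : Type*} {S A : Finset α} (hSA : S ⊆ A)
    (hS : S.Nonempty) (hcard : S.card ≤ 3) :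
    ∃ P ∈ A, ∃ Q ∈ A, ∃ R ∈ A, (S : Set α) ⊆ {P, Q, R} := by
  classical
  obtain ⟨P, hP⟩ := hS
  have hle : (S.erase P).card ≤ 2 := by rw [Finset.card_erase_of_mem hP]; omega
  rcases (S.erase P).eq_empty_or_nonempty with h | h
  · refine ⟨P, hSA hP, P, hSA hP, P, hSA hP, ?_⟩
    rw [← Finset.insert_erase hP, h]; simp
  · obtain ⟨Q, hQ, R, hR, hQR⟩ :=
      exists_subset_pair_of_card_le_two ((S.erase_subset P).trans hSA) h hle
    refine ⟨P, hSA hP, Q, hQ, R, hR, fun x hx => ?_⟩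
    by_cases hxP : x = P
    · exact Or.inl hxP
    · exact Or.inr (hQR (Finset.mem_erase.mpr ⟨hxP, hx⟩))

theorem exists_triple_inter_of_card_le_three [AddCommGroup E] [Module ℝ E] {T B : Finset E}
    {K : Set E} (hTB : T ⊆ B) (hcard : T.card ≤ 3)
    (h : (K ∩ convexHull ℝ (T : Set E)).Nonempty) :
    ∃ P ∈ B, ∃ Q ∈ B, ∃ R ∈ B, (K ∩ convexHull ℝ ({P, Q, R} : Set E)).Nonempty := by
  have hT : T.Nonempty := by simpa using h.right
  obtain ⟨P, hP, Q, hQ, R, hR, hsub⟩ := Finset.exists_subset_triple_of_card_le_three hTB hT hcard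
  exact ⟨P, hP, Q, hQ, R, hR, h.mono (Set.inter_subset_inter_right _ (convexHull_mono hsub))⟩

theorem exists_pair_triple_inter [AddCommGroup E] [Module ℝ E] {S A T B : Finset E}
    (hSA : S ⊆ A) (hTB : T ⊆ B) (hS : S.card ≤ 2) (hT : T.card ≤ 3)
    (h : (convexHull ℝ (S : Set E) ∩ convexHull ℝ (T : Set E)).Nonempty) :
    ∃ P ∈ A, ∃ Q ∈ A, ∃ X ∈ B, ∃ Y ∈ B, ∃ Z ∈ B,
      (convexHull ℝ ({P, Q} : Set E) ∩ convexHull ℝ ({X, Y, Z} : Set E)).Nonempty := by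
  have hS' : S.Nonempty := by simpa using h.left
  obtain ⟨P, hP, Q, hQ, hsub⟩ := Finset.exists_subset_pair_of_card_le_two hSA hS' hS
  exact ⟨P, hP, Q, hQ, exists_triple_inter_of_card_le_three hTB hT
    (h.mono (Set.inter_subset_inter_left _ (convexHull_mono hsub)))⟩

/-- In dimension three, intersecting supports `S ⊆ A` and `T ⊆ B` with `S` the smaller one yield
a containment or a segment of `A` meeting a triangle of `B`. -/
theorem convexHull_subset_or_exists_pair_triple_inter [NormedAddCommGroup E] [NormedSpace ℝ E]
    [FiniteDimensional ℝ E] (hE : finrank ℝ E = 3) {S A T B : Finset E} (hB : B.card ≤ 4)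
    (hSA : S ⊆ A) (hTB : T ⊆ B) (hcard : S.card + T.card ≤ 5) (hS : S.card ≤ 2)
    (h : (convexHull ℝ (S : Set E) ∩ convexHull ℝ (T : Set E)).Nonempty) :
    convexHull ℝ (A : Set E) ⊆ convexHull ℝ (B : Set E) ∨
      ∃ P ∈ A, ∃ Q ∈ A, ∃ X ∈ B, ∃ Y ∈ B, ∃ Z ∈ B,
        (convexHull ℝ ({P, Q} : Set E) ∩ convexHull ℝ ({X, Y, Z} : Set E)).Nonempty := by
  by_cases hT : T.card ≤ 3
  · exact Or.inr (exists_pair_triple_inter hSA hTB hS hT h)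
  have hS0 : S.Nonempty := by simpa using h.left
  obtain ⟨p, rfl⟩ := Finset.card_eq_one.mp (by have := hS0.card_pos; omega : S.card = 1)
  obtain ⟨x, hx, hxT⟩ := h
  obtain rfl : x = p := by simpa using hx
  have hxA : x ∈ A := by simpa using hSA
  refine (convexHull_subset_or_exists_segment_inter_face (A := A) (by omega)
    (convexHull_mono (by exact_mod_cast hTB) hxT)).imp_right ?_
  rintro ⟨q, hq, U, hU, hUcard, hne⟩
  exact ⟨x, hxA, q, hq, exists_triple_inter_of_card_le_three hU (by omega) hne⟩

end ConvexIntersections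

/-- **Intersecting (possibly degenerate) tetrahedra in `ℝ³`.** If `𝒜, ℬ ⊆ ℝ³` have at
most four points each and their convex hulls intersect, then (a) one hull contains the
other, or (b) some triangle spanned by points of `𝒜` meets some segment spanned by points
of `ℬ`, or (c) some segment spanned by points of `𝒜` meets some triangle spanned by
points of `ℬ` (the chosen points need not be pairwise distinct). -/
theorem tetrahedra_inter
    (𝒜 ℬ : Finset (EuclideanSpace ℝ (Fin 3)))
    (hA : 𝒜.card ≤ 4) (hB : ℬ.card ≤ 4)
    (hinter : (convexHull ℝ (𝒜 : Set (EuclideanSpace ℝ (Fin 3))) ∩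
        convexHull ℝ (ℬ : Set (EuclideanSpace ℝ (Fin 3)))).Nonempty) :
    (convexHull ℝ (𝒜 : Set (EuclideanSpace ℝ (Fin 3))) ⊆
        convexHull ℝ (ℬ : Set (EuclideanSpace ℝ (Fin 3))) ∨
      convexHull ℝ (ℬ : Set (EuclideanSpace ℝ (Fin 3))) ⊆
        convexHull ℝ (𝒜 : Set (EuclideanSpace ℝ (Fin 3)))) ∨
    (∃ A ∈ 𝒜, ∃ B ∈ 𝒜, ∃ C ∈ 𝒜, ∃ P ∈ ℬ, ∃ Q ∈ ℬ,
      (convexHull ℝ ({A, B, C} : Set (EuclideanSpace ℝ (Fin 3))) ∩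
        convexHull ℝ ({P, Q} : Set (EuclideanSpace ℝ (Fin 3)))).Nonempty) ∨
    (∃ P ∈ 𝒜, ∃ Q ∈ 𝒜, ∃ A ∈ ℬ, ∃ B ∈ ℬ, ∃ C ∈ ℬ,
      (convexHull ℝ ({P, Q} : Set (EuclideanSpace ℝ (Fin 3))) ∩
        convexHull ℝ ({A, B, C} : Set (EuclideanSpace ℝ (Fin 3)))).Nonempty) := by
  have hE : finrank ℝ (EuclideanSpace ℝ (Fin 3)) = 3 := by simp
  obtain ⟨S, hSA, T, hTB, hcard, hne⟩ := exists_subsets_convexHull_inter_nonempty hinter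
  rw [hE] at hcard
  by_cases hS : S.card ≤ 2
  · rcases convexHull_subset_or_exists_pair_triple_inter hE hB hSA hTB hcard hS hne with h | h
    · exact Or.inl (Or.inl h)
    · exact Or.inr (Or.inr h)
  · rw [Set.inter_comm] at hne
    rcases convexHull_subset_or_exists_pair_triple_inter hE hA hTB hSA (by omega) (by omega) hne
      with h | ⟨P, hP, Q, hQ, X, hX, Y, hY, Z, hZ, h⟩
    · exact Or.inl (Or.inr h)
    · rw [Set.inter_comm] at h
      exact Or.inr (Or.inl ⟨X, hX, Y, hY, Z, hZ, P, hP, Q, hQ, h⟩)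
end
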